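/- (Bol-type lemma) Let Ω ⊂ ℝ² be an open, simply connected set and let g : Ω → ℝ be C² with Δg(y) + e^{g(y)} > 0 for all y ∈ Ω and ∫_Ω e^{g(y)} dy ≤ 8π. Let ω ⊂ Ω be an open set and suppose there exists a Lipschitz function ψ : ℝ² → ℝ, not identically zero, vanishing outside a compact subset of ω, such that ∫_ω |∇ψ(y)|² dy ≤ ∫_ω e^{g(y)} ψ(y)² dy (i.e. the first Dirichlet eigenvalue of Δ + e^g on ω is ≤ 0). Then ∫_ω e^{g(y)} dy > 4π. -/

import Mathlib

open MeasureTheory Real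

/-- The Euclidean Laplacian on `ℝ²`: the sum of the two pure second partial
derivatives in the standard coordinate directions. -/
noncomputable def planeLaplacian (v : EuclideanSpace ℝ (Fin 2) → ℝ)
    (y : EuclideanSpace ℝ (Fin 2)) : ℝ :=
  ∑ i : Fin 2,
    fderiv ℝ (fun z => fderiv ℝ v z (EuclideanSpace.single i 1)) y
      (EuclideanSpace.single i 1)

set_option linter.all false

namespace Bol
open Set Filter Topology

/-- the Cauchy kernel vector -/
noncomputable def ker (u : ℂ) : ℂ := (starRingEnd ℂ) u⁻¹

lemma norm_ker (u : ℂ) : ‖ker u‖ = ‖u‖⁻¹ := by simp [ker]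

lemma fderiv_zero_of_far {f : ℂ → ℝ} {R : ℝ} (hR : tsupport f ⊆ Metric.closedBall 0 R) {y : ℂ} (hy : R < ‖y‖) :
    fderiv ℝ f y = 0 := by
  have : y ∉ tsupport (fderiv ℝ f) := fun h => by
    have := hR (tsupport_fderiv_subset ℝ h)
    simp at this; linarith
  exact image_eq_zero_of_notMem_tsupport this

lemma KI0 {f : ℂ → ℝ} (hf : ContDiff ℝ 1 f) (hc : HasCompactSupport f) :
    ∫ y, fderiv ℝ f y (ker y) = -(2 * π * f 0) := by
  obtain ⟨R, hR0, hR⟩ : ∃ R, 0 < R ∧ tsupport f ⊆ Metric.closedBall 0 R := by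
    obtain ⟨R, hR⟩ := hc.isCompact.isBounded.subset_closedBall 0
    exact ⟨max R 1, by positivity, hR.trans (Metric.closedBall_subset_closedBall (le_max_left _ _))⟩
  have hDc : Continuous (fderiv ℝ f) := hf.continuous_fderiv (by norm_num)
  let e : ℝ → ℂ := fun θ => (Real.cos θ + Real.sin θ * Complex.I)
  have he : Continuous e := by fun_prop
  have hen : ∀ θ, ‖e θ‖ = 1 := by
    intro θ
    have : e θ = Complex.exp (θ * Complex.I) := by
      simp [e, Complex.exp_mul_I]
    rw [this, Complex.norm_exp_ofReal_mul_I]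
  rw [← Complex.integral_comp_polarCoord_symm]
  have h1 : ∀ p ∈ polarCoord.target, p.1 • (fderiv ℝ f (Complex.polarCoord.symm p) (ker (Complex.polarCoord.symm p)))
      = fderiv ℝ f (p.1 • e p.2) (e p.2) := by
    intro p hp
    have hp1 : 0 < p.1 := hp.1
    have : (p.1 : ℝ) • ker (Complex.polarCoord.symm p) = e p.2 := by
      rw [Complex.polarCoord_symm_apply]
      change p.1 • ker (p.1 * e p.2) = e p.2
      have h2 : e p.2 * (starRingEnd ℂ) (e p.2) = 1 := by
        rw [Complex.mul_conj, Complex.normSq_eq_norm_sq, hen]; simp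
      have h3 : (starRingEnd ℂ) (e p.2)⁻¹ = e p.2 := by
        rw [map_inv₀]; exact (eq_inv_of_mul_eq_one_left h2).symm
      unfold ker
      rw [mul_inv, map_mul, h3]
      have : (p.1 : ℂ) ≠ 0 := by exact_mod_cast hp1.ne'
      simp; field_simp
    rw [← map_smul, this]
    rw [Complex.polarCoord_symm_apply, Complex.real_smul]
  rw [setIntegral_congr_fun polarCoord.open_target.measurableSet h1]
  have ht : polarCoord.target = Ioi (0:ℝ) ×ˢ Ioo (-π) π := rfl
  have hcont : Continuous (fun p : ℝ × ℝ => fderiv ℝ f (p.1 • e p.2) (e p.2)) := by fun_prop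
  have hzero : ∀ r θ : ℝ, R < r → fderiv ℝ f (r • e θ) = 0 := by
    intro r θ hr
    apply fderiv_zero_of_far hR
    rw [norm_smul, hen]; simp; exact lt_of_lt_of_le hr (le_abs_self r)
  have hintg : IntegrableOn (fun p : ℝ × ℝ => fderiv ℝ f (p.1 • e p.2) (e p.2)) (Ioi (0:ℝ) ×ˢ Ioo (-π) π) := by
    have hk : IntegrableOn (fun p : ℝ × ℝ => fderiv ℝ f (p.1 • e p.2) (e p.2)) (Icc 0 R ×ˢ Icc (-π) π) :=
      hcont.continuousOn.integrableOn_compact (isCompact_Icc.prod isCompact_Icc)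
    refine hk.of_forall_sdiff_eq_zero (measurableSet_Ioi.prod measurableSet_Ioo) ?_
    rintro ⟨r, θ⟩ ⟨⟨h1, h2⟩, h3⟩
    have : R < r := by
      by_contra h
      exact h3 ⟨⟨le_of_lt h1, not_lt.1 h⟩, Ioo_subset_Icc_self h2⟩
    simp only [hzero r θ this]; rfl
  rw [ht, Measure.volume_eq_prod, ← Measure.prod_restrict, integral_prod_symm]
  swap
  · rw [Measure.prod_restrict, ← Measure.volume_eq_prod]; exact hintg
  have h2 : ∀ θ : ℝ, ∫ r in Ioi (0:ℝ), fderiv ℝ f (r • e θ) (e θ) = - f 0 := by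
    intro θ
    have hd : ∀ r ∈ Ioi (0:ℝ), HasDerivAt (fun r : ℝ => f (r • e θ)) (fderiv ℝ f (r • e θ) (e θ)) r := by
      intro r _
      have h := (hf.differentiable (by norm_num) (r • e θ)).hasFDerivAt
      have h' : HasDerivAt (fun r : ℝ => r • e θ) (e θ) r := by
        simpa using (hasDerivAt_id r).smul_const (e θ)
      exact h.comp_hasDerivAt r h'
    have hi : IntegrableOn (fun r : ℝ => fderiv ℝ f (r • e θ) (e θ)) (Ioi 0) := by
      have hk : IntegrableOn (fun r : ℝ => fderiv ℝ f (r • e θ) (e θ)) (Icc 0 R) :=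
        Continuous.integrableOn_Icc (by fun_prop)
      refine hk.of_forall_sdiff_eq_zero measurableSet_Ioi ?_
      rintro r ⟨h1, h3⟩
      have : R < r := by
        by_contra h
        exact h3 ⟨le_of_lt h1, not_lt.1 h⟩
      simp only [hzero r θ this]; rfl
    have hlim : Tendsto (fun r : ℝ => f (r • e θ)) atTop (𝓝 0) := by
      apply tendsto_const_nhds.congr'
      filter_upwards [eventually_gt_atTop R] with r hr
      symm
      apply image_eq_zero_of_notMem_tsupport
      intro h
      have := hR h
      simp [norm_smul, hen] at this
      linarith [le_abs_self r]
    have := integral_Ioi_of_hasDerivAt_of_tendsto (a := 0) (f := fun r : ℝ => f (r • e θ)) (m := 0)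
      (by have := hf.continuous; exact Continuous.continuousWithinAt (by fun_prop)) hd hi hlim
    rw [this]; simp
  simp_rw [h2]
  simp
  rw [max_eq_left (by positivity)]; ring_nf; simp

lemma KI {f : ℂ → ℝ} (hf : ContDiff ℝ 1 f) (hc : HasCompactSupport f) (w : ℂ) :
    ∫ y, fderiv ℝ f y (ker (y - w)) = -(2 * π * f w) := by
  have h := KI0 (f := fun y => f (y + w)) (by fun_prop) (hc.comp_homeomorph (Homeomorph.addRight w))
  simp only [zero_add] at h
  rw [← h, ← integral_add_right_eq_self _ w]
  congr 1; ext y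
  rw [fderiv_comp_add_right]; simp
end Bol

namespace Bol
open Set Filter Topology

lemma polar_target : polarCoord.target = Ioi (0:ℝ) ×ˢ Ioo (-π) π := rfl

lemma lint_norm_inv_ball : ∫⁻ u in Metric.ball (0:ℂ) 1, ENNReal.ofReal (‖u‖⁻¹) ≤ ENNReal.ofReal (2 * π) := by
  rw [← lintegral_indicator Metric.isOpen_ball.measurableSet, ← Complex.lintegral_comp_polarCoord_symm]
  calc _ ≤ ∫⁻ p in polarCoord.target, (Ioo (0:ℝ) 1 ×ˢ Ioo (-π) π).indicator 1 p := by
        refine setLIntegral_mono' polarCoord.open_target.measurableSet ?_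
        intro p hp
        have hp1 : 0 < p.1 := hp.1
        have hn := Complex.norm_polarCoord_symm p
        by_cases h : p.1 < 1
        · have h1 : p ∈ (Ioo (0:ℝ) 1 ×ˢ Ioo (-π) π) := ⟨⟨hp1, h⟩, hp.2⟩
          rw [indicator_of_mem h1]
          refine (mul_le_mul_right (indicator_le_self _ _ _) _).trans ?_
          rw [hn, abs_of_pos hp1, ← ENNReal.ofReal_mul hp1.le, mul_inv_cancel₀ hp1.ne']; simp
        · rw [indicator_of_notMem]
          · simp
          · rw [mem_ball_zero_iff, hn, abs_of_pos hp1]; exact h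
    _ = ∫⁻ p in polarCoord.target ∩ (Ioo (0:ℝ) 1 ×ˢ Ioo (-π) π), 1 := by
        rw [lintegral_indicator (measurableSet_Ioo.prod measurableSet_Ioo), Measure.restrict_restrict (measurableSet_Ioo.prod measurableSet_Ioo), inter_comm]; rfl
    _ ≤ volume (Ioo (0:ℝ) 1 ×ˢ Ioo (-π) π) := by
        simp; exact measure_mono inter_subset_right
    _ = ENNReal.ofReal (2 * π) := by
        rw [Measure.volume_eq_prod, Measure.prod_prod, Real.volume_Ioo, Real.volume_Ioo, sub_zero, ENNReal.ofReal_one, one_mul]; ring_nf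

lemma lint_norm_inv (T : Set ℂ) (hT : MeasurableSet T) (z : ℂ) :
    ∫⁻ w in T, ENNReal.ofReal (‖z - w‖⁻¹) ≤ volume T + ENNReal.ofReal (2 * π) := by
  have h0 : Measurable (fun w : ℂ => (Metric.ball (0:ℂ) 1).indicator (fun u => ENNReal.ofReal (‖u‖⁻¹)) (z - w)) := by
    apply Measurable.comp (g := (Metric.ball (0:ℂ) 1).indicator (fun u => ENNReal.ofReal (‖u‖⁻¹))) _ (by fun_prop)
    exact Measurable.indicator (by fun_prop) Metric.isOpen_ball.measurableSet
  calc _ ≤ ∫⁻ w in T, (1 + (Metric.ball (0:ℂ) 1).indicator (fun u => ENNReal.ofReal (‖u‖⁻¹)) (z - w)) := by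
        refine lintegral_mono fun w => ?_
        by_cases h : z - w ∈ Metric.ball (0:ℂ) 1
        · rw [indicator_of_mem h]; exact le_add_self
        · rw [indicator_of_notMem h, add_zero]
          rw [mem_ball_zero_iff, not_lt] at h
          exact ENNReal.ofReal_le_one.2 (inv_le_one_of_one_le₀ h)
    _ = volume T + ∫⁻ w in T, (Metric.ball (0:ℂ) 1).indicator (fun u => ENNReal.ofReal (‖u‖⁻¹)) (z - w) := by
        rw [lintegral_add_left (by fun_prop)]; simp
    _ ≤ volume T + ∫⁻ w, (Metric.ball (0:ℂ) 1).indicator (fun u => ENNReal.ofReal (‖u‖⁻¹)) (z - w) := by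
        gcongr; exact Measure.restrict_le_self
    _ ≤ _ := by
        rw [lintegral_sub_left_eq_self (fun u => (Metric.ball (0:ℂ) 1).indicator (fun u => ENNReal.ofReal (‖u‖⁻¹)) u) z,
          lintegral_indicator Metric.isOpen_ball.measurableSet]
        gcongr; exact lint_norm_inv_ball

lemma lint_line (a c : ℝ) (hc : 0 < c) : ∫⁻ r in Ioi (0:ℝ), ENNReal.ofReal (a - c * r) ≤ ENNReal.ofReal ((max a 0)^2 / (2*c)) := by
  rcases le_or_gt a 0 with ha | ha
  · have : ∀ r ∈ Ioi (0:ℝ), ENNReal.ofReal (a - c * r) = 0 := by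
      intro r hr
      apply ENNReal.ofReal_of_nonpos
      have : 0 < c * r := mul_pos hc hr
      linarith
    rw [setLIntegral_congr_fun measurableSet_Ioi this]; simp
  · rw [max_eq_left ha.le]
    calc _ ≤ ∫⁻ r in Ioi (0:ℝ), (Ioc 0 (a/c)).indicator (fun r => ENNReal.ofReal (a - c * r)) r := by
          refine setLIntegral_mono' measurableSet_Ioi fun r hr => ?_
          by_cases h : r ≤ a / c
          · rw [indicator_of_mem (show r ∈ Ioc 0 (a/c) from ⟨hr, h⟩)]
          · rw [ENNReal.ofReal_of_nonpos]; · exact zero_le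
            rw [not_le, div_lt_iff₀ hc] at h; linarith
      _ = ∫⁻ r in Ioc 0 (a/c), ENNReal.ofReal (a - c * r) := by
          rw [lintegral_indicator measurableSet_Ioc, Measure.restrict_restrict measurableSet_Ioc, inter_eq_left.2 Ioc_subset_Ioi_self]
      _ = ENNReal.ofReal (∫ r in Ioc 0 (a/c), (a - c * r)) := by
          rw [ofReal_integral_eq_lintegral_ofReal]
          · exact (Continuous.integrableOn_Icc (by fun_prop)).mono_set Ioc_subset_Icc_self
          · rw [EventuallyLE, ae_restrict_iff' measurableSet_Ioc]
            refine ae_of_all _ fun r hr => ?_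
            have := hr.2
            rw [le_div_iff₀ hc] at this; simp; linarith
      _ ≤ _ := by
          rw [← intervalIntegral.integral_of_le (by positivity)]
          apply le_of_eq
          congr 1
          rw [intervalIntegral.integral_sub (by simp) (by apply Continuous.intervalIntegrable; fun_prop), intervalIntegral.integral_const_mul, integral_id]
          simp; field_simp; ring

lemma lint_cos (c : ℝ) (hc : 0 < c) : ∫⁻ θ in Ioo (-π) π, ENNReal.ofReal ((max (cos θ) 0)^2 / (2*c)) ≤ ENNReal.ofReal (π / (4 * c)) := by
  have hcont : Continuous (fun θ => (max (cos θ) 0)^2 / (2*c)) := by fun_prop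
  rw [← ofReal_integral_eq_lintegral_ofReal (hcont.integrableOn_Icc.mono_set Ioo_subset_Icc_self) (ae_of_all _ fun θ => by positivity)]
  apply ENNReal.ofReal_le_ofReal
  rw [← integral_Ioc_eq_integral_Ioo, ← intervalIntegral.integral_of_le (by linarith [pi_pos])]
  have hi : ∀ a b, IntervalIntegrable (fun θ => (max (cos θ) 0)^2 / (2*c)) volume a b := fun a b => hcont.intervalIntegrable a b
  rw [← intervalIntegral.integral_add_adjacent_intervals (hi (-π) (-(π/2))) (hi _ π), ← intervalIntegral.integral_add_adjacent_intervals (hi (-(π/2)) (π/2)) (hi _ π)]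
  have h1 : ∫ θ in (-π)..(-(π/2)), (max (cos θ) 0)^2 / (2*c) = 0 := by
    rw [intervalIntegral.integral_congr (g := fun _ => 0)]; · simp
    intro θ hθ
    rw [uIcc_of_le (by linarith [pi_pos])] at hθ
    have : cos θ ≤ 0 := by
      rw [← cos_neg]; exact cos_nonpos_of_pi_div_two_le_of_le (by linarith [hθ.2]) (by linarith [hθ.1, pi_pos])
    simp [max_eq_right this]
  have h3 : ∫ θ in (π/2)..π, (max (cos θ) 0)^2 / (2*c) = 0 := by
    rw [intervalIntegral.integral_congr (g := fun _ => 0)]; · simp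
    intro θ hθ
    rw [uIcc_of_le (by linarith [pi_pos])] at hθ
    have : cos θ ≤ 0 := cos_nonpos_of_pi_div_two_le_of_le (by linarith [hθ.1]) (by linarith [hθ.2, pi_pos])
    simp [max_eq_right this]
  have h2 : ∫ θ in (-(π/2))..(π/2), (max (cos θ) 0)^2 / (2*c) = π / (4 * c) := by
    rw [intervalIntegral.integral_congr (g := fun θ => cos θ ^2 / (2*c))]
    · rw [intervalIntegral.integral_div, integral_cos_sq]; simp; field_simp; ring
    intro θ hθ
    rw [uIcc_of_le (by linarith [pi_pos])] at hθ
    have : 0 ≤ cos θ := cos_nonneg_of_mem_Icc hθ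
    simp [max_eq_left this]
  rw [h1, h2, h3]; simp

lemma bath1 (c : ℝ) (hc : 0 < c) : ∫⁻ u : ℂ, ENNReal.ofReal ((u⁻¹).re - c) ≤ ENNReal.ofReal (π / (4 * c)) := by
  rw [← Complex.lintegral_comp_polarCoord_symm]
  have h1 : ∀ p ∈ polarCoord.target, ENNReal.ofReal p.1 • ENNReal.ofReal (((Complex.polarCoord.symm p)⁻¹).re - c)
      = ENNReal.ofReal (cos p.2 - c * p.1) := by
    intro p hp
    have hp1 : 0 < p.1 := hp.1
    rw [smul_eq_mul, ← ENNReal.ofReal_mul hp1.le]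
    congr 1
    rw [Complex.inv_re, Complex.normSq_eq_norm_sq, Complex.norm_polarCoord_symm, sq_abs, Complex.polarCoord_symm_apply]
    have : (↑p.1 * (↑(cos p.2) + ↑(sin p.2) * Complex.I) : ℂ).re = p.1 * cos p.2 := by
      rw [Complex.re_ofReal_mul]; simp [← Complex.ofReal_cos, ← Complex.ofReal_sin]
    rw [this]; field_simp
  rw [setLIntegral_congr_fun polarCoord.open_target.measurableSet h1, polar_target, Measure.volume_eq_prod, ← Measure.prod_restrict, lintegral_prod_symm _ (by fun_prop)]
  calc _ ≤ ∫⁻ θ in Ioo (-π) π, ENNReal.ofReal ((max (cos θ) 0)^2 / (2*c)) := lintegral_mono fun θ => lint_line _ c hc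
    _ ≤ _ := lint_cos c hc

lemma bath2 (b : ℂ) (hb : ‖b‖ = 1) (c : ℝ) (hc : 0 < c) :
    ∫⁻ u : ℂ, ENNReal.ofReal ((b * u⁻¹).re - c) ≤ ENNReal.ofReal (π / (4 * c)) := by
  obtain ⟨bb, hbb⟩ : ∃ bb : Circle, (bb : ℂ) = b :=
    ⟨⟨b, mem_sphere_zero_iff_norm.2 hb⟩, rfl⟩
  have h := (rotation bb : ℂ ≃ₗᵢ[ℝ] ℂ).measurePreserving
  rw [← h.lintegral_comp_emb (rotation _).toHomeomorph.measurableEmbedding]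
  have hb0 : b ≠ 0 := by intro h; simp [h] at hb
  refine le_trans (le_of_eq ?_) (bath1 c hc)
  congr 1; ext u
  rw [rotation_apply, mul_inv]
  rw [hbb, ← mul_assoc, mul_inv_cancel₀ hb0, one_mul]

lemma integrableOn_norm_inv {T : Set ℂ} (hT : MeasurableSet T) (hv : volume T ≠ ⊤) (z : ℂ) :
    IntegrableOn (fun w => ‖z - w‖⁻¹) T := by
  refine ⟨by fun_prop, ?_⟩
  rw [hasFiniteIntegral_iff_ofReal (ae_of_all _ fun w => by positivity)]
  exact (lint_norm_inv T hT z).trans_lt (ENNReal.add_lt_top.2 ⟨hv.lt_top, ENNReal.ofReal_lt_top⟩)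

lemma bath3 {T : Set ℂ} (hT : MeasurableSet T) (hv : volume T ≠ ⊤) (z b : ℂ) (hb : ‖b‖ = 1) :
    ∫ w in T, (b * (z - w)⁻¹).re ≤ √(π * volume.real T) := by
  rcases (measureReal_nonneg (μ := volume) (s := T)).eq_or_lt with h0 | h0
  · have : volume T = 0 := by
      rw [Measure.real, eq_comm, ENNReal.toReal_eq_zero_iff] at h0; tauto
    rw [Measure.restrict_eq_zero.2 this, integral_zero_measure]; positivity
  set A := volume.real T
  set c := √(π / (4 * A)) with hcdef
  have hc : 0 < c := by positivity
  have hi : IntegrableOn (fun w => (b * (z - w)⁻¹).re) T := by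
    refine (integrableOn_norm_inv hT hv z).mono' (by fun_prop) (ae_of_all _ fun w => ?_)
    refine (Complex.abs_re_le_norm _).trans ?_
    rw [norm_mul, hb, one_mul, norm_inv]
  have hf : ∫⁻ w in T, ENNReal.ofReal ((b * (z - w)⁻¹).re - c) ≤ ENNReal.ofReal (π / (4 * c)) := by
    refine (lintegral_mono' Measure.restrict_le_self le_rfl).trans ?_
    rw [lintegral_sub_left_eq_self (fun u => ENNReal.ofReal ((b * u⁻¹).re - c)) z]
    exact bath2 b hb c hc
  have hi2 : IntegrableOn (fun w => (b * (z - w)⁻¹).re - c) T := hi.sub (integrableOn_const hv)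
  have h3 : ∫ w in T, ((b * (z - w)⁻¹).re - c) ≤ π / (4 * c) := by
    rw [integral_eq_lintegral_pos_part_sub_lintegral_neg_part hi2]
    have := ENNReal.toReal_mono ENNReal.ofReal_ne_top hf
    rw [ENNReal.toReal_ofReal (by positivity)] at this
    linarith [ENNReal.toReal_nonneg (a := ∫⁻ w in T, ENNReal.ofReal (-((b * (z - w)⁻¹).re - c)))]
  rw [integral_sub hi (integrableOn_const hv)] at h3
  simp only [setIntegral_const, smul_eq_mul] at h3
  have h5 : c * c = π / (4 * A) := mul_self_sqrt (by positivity)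
  have hs : √(π * A) = 2 * A * c := by
    have h6 : π * A = (2 * A * c)^2 := by
      calc π * A = 4 * A^2 * (π / (4 * A)) := by field_simp
        _ = _ := by rw [← h5]; ring
    rw [h6, sqrt_sq (by positivity)]
  have hs2 : π / (4 * c) = A * c := by
    rw [div_eq_iff (by positivity)]
    calc π = 4 * A * (π / (4 * A)) := by field_simp
      _ = _ := by rw [← h5]; ring
  rw [hs2] at h3
  rw [hs]; change _ - A * c ≤ _ at h3; linarith

lemma bath {T : Set ℂ} (hT : MeasurableSet T) (hv : volume T ≠ ⊤) (z b : ℂ) :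
    ∫ w in T, (b * (z - w)⁻¹).re ≤ ‖b‖ * √(π * volume.real T) := by
  by_cases hb : b = 0
  · simp [hb]
  have hn : 0 < ‖b‖ := norm_pos_iff.2 hb
  have h := bath3 hT hv z (b / ‖b‖) (by simp [hb])
  have h2 : ∀ w, (b * (z - w)⁻¹).re = ‖b‖ * (b / ‖b‖ * (z - w)⁻¹).re := by
    intro w
    rw [← Complex.re_ofReal_mul]; congr 1
    have : (‖b‖ : ℂ) ≠ 0 := by exact_mod_cast hn.ne'
    field_simp
  simp_rw [h2]
  rw [integral_const_mul]
  gcongr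
end Bol

namespace Bol
open Set Filter Topology
open scoped Manifold ContDiff

lemma det_smul_one (c : ℂ) : (c • (1 : ℂ →L[ℝ] ℂ)).det = ‖c‖^2 := by
  rw [ContinuousLinearMap.det, ← LinearMap.det_toMatrix Complex.basisOneI, Matrix.det_fin_two]
  simp [LinearMap.toMatrix_apply, Complex.coe_basisOneI, Complex.coe_basisOneI_repr]
  rw [← Complex.normSq_eq_norm_sq, Complex.normSq_apply]

/-- gradient of a real linear functional, conjugated -/
noncomputable def gr (L : ℂ →L[ℝ] ℝ) : ℂ := L 1 + L Complex.I * Complex.I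

lemma gr_apply (L : ℂ →L[ℝ] ℝ) (z : ℂ) : L ((starRingEnd ℂ) z) = (gr L * z).re := by
  have : (starRingEnd ℂ) z = (z.re) • (1:ℂ) + (-z.im) • Complex.I := by
    apply Complex.ext <;> simp
  rw [this, map_add, map_smul, map_smul]
  simp [gr]; ring

lemma apply_eq (L : ℂ →L[ℝ] ℝ) (z : ℂ) : L z = z.re * L 1 + z.im * L Complex.I := by
  have : z = (z.re) • (1:ℂ) + (z.im) • Complex.I := by
    apply Complex.ext <;> simp
  conv_lhs => rw [this, map_add, map_smul, map_smul]
  simp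

lemma norm_gr (L : ℂ →L[ℝ] ℝ) : ‖gr L‖ = ‖L‖ := by
  have h1 : ‖gr L‖^2 = L (gr L) := by
    rw [apply_eq, ← Complex.normSq_eq_norm_sq, Complex.normSq_apply]; simp [gr]
  apply le_antisymm
  · have h2 : ‖gr L‖ * ‖gr L‖ ≤ ‖L‖ * ‖gr L‖ := by
      rw [← pow_two, h1]; exact (le_abs_self _).trans (L.le_opNorm _)
    rcases (norm_nonneg (gr L)).eq_or_lt with h | h
    · rw [← h]; positivity
    · exact le_of_mul_le_mul_right h2 h
  · refine L.opNorm_le_bound (norm_nonneg _) fun z => ?_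
    have := gr_apply L ((starRingEnd ℂ) z)
    rw [Complex.conj_conj] at this
    rw [this, Real.norm_eq_abs]
    refine (Complex.abs_re_le_norm _).trans ?_
    simp

lemma norm_sq_L (L : ℂ →L[ℝ] ℝ) : ‖L‖^2 = L 1 ^2 + L Complex.I ^ 2 := by
  rw [← norm_gr, ← Complex.normSq_eq_norm_sq, Complex.normSq_apply]; simp [gr]; ring

lemma continuous_gr : Continuous gr := by
  unfold gr; fun_prop

lemma cont_derivF {F : ℂ → ℂ} (hF : Differentiable ℂ F) : Continuous (deriv F) := (hF.contDiff (n := 1)).continuous_deriv (by norm_num)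

lemma hasFDerivF {F : ℂ → ℂ} (hF : Differentiable ℂ F) (z : ℂ) : HasFDerivAt F (deriv F z • (1 : ℂ →L[ℝ] ℂ)) z :=
  (hF z).hasDerivAt.complexToReal_fderiv

lemma V_integrable {F : ℂ → ℂ} (hF : Differentiable ℂ F) {f : ℂ → ℝ} (hf : ContDiff ℝ 1 f) (hc : HasCompactSupport f) {T : Set ℂ} (hT : MeasurableSet T)
    (hv : volume T ≠ ⊤) :
    Integrable (Function.uncurry fun w y : ℂ => (gr (fderiv ℝ f y) * deriv F y * (F y - w)⁻¹).re) ((volume.restrict T).prod volume) := by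
  have hD : Continuous (fderiv ℝ f) := hf.continuous_fderiv (by norm_num)
  have hF' := cont_derivF hF
  have hFc : Continuous F := hF.continuous
  have hg := continuous_gr
  have hgD : Continuous (fun y => gr (fderiv ℝ f y) * deriv F y) := by fun_prop
  have hm : Measurable (Function.uncurry fun w y : ℂ => (gr (fderiv ℝ f y) * deriv F y * (F y - w)⁻¹).re) := by
    have h1 : Measurable (fun p : ℂ × ℂ => gr (fderiv ℝ f p.2) * deriv F p.2) := (hgD.comp continuous_snd).measurable
    have h2 : Measurable (fun p : ℂ × ℂ => F p.2 - p.1) := by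
      exact (Continuous.measurable (by fun_prop))
    exact Complex.measurable_re.comp (h1.mul h2.inv)
  have hb : ∀ y w : ℂ, ‖(gr (fderiv ℝ f y) * deriv F y * (F y - w)⁻¹).re‖ ≤ ‖gr (fderiv ℝ f y) * deriv F y‖ * ‖F y - w‖⁻¹ := by
    intro y w
    rw [Real.norm_eq_abs]
    refine (Complex.abs_re_le_norm _).trans ?_
    rw [norm_mul, norm_inv]
  have hsl : ∀ y, Integrable (fun w => (gr (fderiv ℝ f y) * deriv F y * (F y - w)⁻¹).re) (volume.restrict T) := by
    intro y
    refine ((integrableOn_norm_inv hT hv (F y)).const_mul ‖gr (fderiv ℝ f y) * deriv F y‖).mono' ?_ (ae_of_all _ (hb y))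
    exact (hm.comp (measurable_id.prodMk measurable_const)).aestronglyMeasurable
  rw [integrable_prod_iff' hm.aestronglyMeasurable]
  refine ⟨ae_of_all _ hsl, ?_⟩
  have hI : Integrable (fun y => ‖gr (fderiv ℝ f y) * deriv F y‖ * (volume.real T + 2 * π)) := by
    apply Continuous.integrable_of_hasCompactSupport (by fun_prop)
    refine HasCompactSupport.mul_right ?_
    apply HasCompactSupport.norm
    apply HasCompactSupport.mul_right
    exact (hc.fderiv (𝕜 := ℝ)).comp_left (g := gr) (by simp [gr])
  refine hI.mono' ?_ (ae_of_all _ fun y => ?_)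
  · exact hm.aestronglyMeasurable.norm.prod_swap.integral_prod_right'
  · rw [Real.norm_of_nonneg (integral_nonneg fun _ => norm_nonneg _)]
    have h5 := integrableOn_norm_inv hT hv (F y)
    calc _ ≤ ∫ w in T, ‖gr (fderiv ℝ f y) * deriv F y‖ * ‖F y - w‖⁻¹ :=
          integral_mono (hsl y).norm (h5.const_mul _) (hb y)
      _ = ‖gr (fderiv ℝ f y) * deriv F y‖ * ∫ w in T, ‖F y - w‖⁻¹ := by rw [integral_const_mul]
      _ ≤ _ := by
          gcongr
          rw [integral_eq_lintegral_of_nonneg_ae (ae_of_all _ fun w => by positivity) h5.1]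
          have := ENNReal.toReal_mono (ENNReal.add_ne_top.2 ⟨hv, ENNReal.ofReal_ne_top⟩) (lint_norm_inv T hT (F y))
          rwa [ENNReal.toReal_add hv ENNReal.ofReal_ne_top, ENNReal.toReal_ofReal (by positivity)] at this

/-- main upper bound -/
lemma V_bound {F : ℂ → ℂ} (hF : Differentiable ℂ F) {f : ℂ → ℝ} (hf : ContDiff ℝ 1 f) (hc : HasCompactSupport f) {T : Set ℂ} (hT : MeasurableSet T)
    (hv : volume T ≠ ⊤) :
    - ∫ w in T, ∫ y, (gr (fderiv ℝ f y) * deriv F y * (F y - w)⁻¹).re ≤ (∫ y, ‖fderiv ℝ f y‖ * ‖deriv F y‖) * √(π * volume.real T) := by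
  have hD : Continuous (fderiv ℝ f) := hf.continuous_fderiv (by norm_num)
  have hF' := cont_derivF hF
  have h := V_integrable hF hf hc hT hv
  rw [integral_integral_swap h, ← integral_neg, ← integral_mul_const]
  refine integral_mono (h.integral_prod_right).neg ?_ fun y => ?_
  · apply Continuous.integrable_of_hasCompactSupport (by fun_prop)
    apply HasCompactSupport.mul_right
    apply HasCompactSupport.mul_right
    exact (hc.fderiv (𝕜 := ℝ)).norm
  · have := bath hT hv (F y) (-(gr (fderiv ℝ f y) * deriv F y))
    simp only [neg_mul, Complex.neg_re, integral_neg, norm_neg, norm_mul, norm_gr] at this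
    exact this

/-- local chart version -/
lemma V_chart {F : ℂ → ℂ} (hF : Differentiable ℂ F) (hF0 : ∀ z, deriv F z ≠ 0) {f : ℂ → ℝ} (hf : ContDiff ℝ 1 f) (hc : HasCompactSupport f)
    (hf0 : ∀ z, 0 ≤ f z)
    (e : OpenPartialHomeomorph ℂ ℂ) (heF : ∀ z, e z = F z) (hs : tsupport f ⊆ e.source)
    {S : Set ℂ} (hS : IsCompact S) :
    2 * π * ∫ y in S, f y * ‖deriv F y‖^2 ≤ - ∫ w in F '' S, ∫ y, (gr (fderiv ℝ f y) * deriv F y * (F y - w)⁻¹).re := by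
  have hFc : Continuous F := hF.continuous
  set ft : ℂ → ℝ := e.target.indicator (fun w => f (e.symm w)) with hft
  have hftF : ∀ y ∈ e.source, ft (F y) = f y := by
    intro y hy
    rw [← heF, hft, indicator_of_mem (e.map_source hy), e.left_inv hy]
  have hcF : IsCompact (F '' tsupport f) := hc.isCompact.image hFc
  have hsup : ∀ w ∉ F '' tsupport f, ft w = 0 := by
    intro w hw
    by_cases h : w ∈ e.target
    · rw [hft, indicator_of_mem h]
      apply image_eq_zero_of_notMem_tsupport
      intro h2
      exact hw ⟨_, h2, by rw [← heF, e.right_inv h]⟩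
    · rw [hft, indicator_of_notMem h]
  have hftc : HasCompactSupport ft := HasCompactSupport.intro hcF hsup
  have hftd : ContDiff ℝ 1 ft := by
    rw [contDiff_iff_contDiffAt]
    intro w
    by_cases h : w ∈ F '' tsupport f
    · obtain ⟨y, hy, rfl⟩ := h
      have ht : F y ∈ e.target := by rw [← heF]; exact e.map_source (hs hy)
      have h1 : ContDiffAt ℂ 1 e.symm (F y) := by
        have hee : (e : ℂ → ℂ) = F := funext heF
        apply e.contDiffAt_symm_deriv (hF0 (e.symm (F y))) ht
        · rw [hee]; exact (hF _).hasDerivAt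
        · rw [hee]; exact hF.contDiff.contDiffAt
      have h2 : ContDiffAt ℝ 1 e.symm (F y) := h1.restrict_scalars ℝ
      refine (hf.contDiffAt.comp (F y) h2).congr_of_eventuallyEq ?_
      filter_upwards [e.open_target.mem_nhds ht] with w hw
      rw [hft, indicator_of_mem hw]; rfl
    · refine (contDiffAt_const (c := (0:ℝ))).congr_of_eventuallyEq ?_
      filter_upwards [hcF.isClosed.isOpen_compl.mem_nhds h] with w hw
      exact hsup w hw
  have hV : ∀ w, ∫ y, (gr (fderiv ℝ f y) * deriv F y * (F y - w)⁻¹).re = -(2 * π * ft w) := by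
    intro w
    rw [← KI hftd hftc w]
    have h1 : ∫ u, fderiv ℝ ft u (ker (u - w)) = ∫ u in e.target, fderiv ℝ ft u (ker (u - w)) := by
      rw [setIntegral_eq_integral_of_forall_compl_eq_zero]
      intro u hu
      have : u ∉ tsupport (fderiv ℝ ft) := fun h => by
        have h1 := tsupport_fderiv_subset ℝ h
        have h2 : tsupport ft ⊆ F '' tsupport f := by
          apply closure_minimal _ hcF.isClosed
          intro x hx; by_contra h; exact hx (hsup x h)
        obtain ⟨y, hy, rfl⟩ := h2 h1
        apply hu; rw [← heF]; exact e.map_source (hs hy)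
      rw [image_eq_zero_of_notMem_tsupport this]; rfl
    have h2 : ∫ y, (gr (fderiv ℝ f y) * deriv F y * (F y - w)⁻¹).re = ∫ y in e.source, (gr (fderiv ℝ f y) * deriv F y * (F y - w)⁻¹).re := by
      rw [setIntegral_eq_integral_of_forall_compl_eq_zero]
      intro u hu
      have : u ∉ tsupport (fderiv ℝ f) := fun h => hu (hs (tsupport_fderiv_subset ℝ h))
      rw [image_eq_zero_of_notMem_tsupport this]; simp [gr]
    rw [h1, h2, integral_target_eq_integral_abs_det_fderiv_smul volume (f := e) (f' := fun y => deriv F y • (1 : ℂ →L[ℝ] ℂ))]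
    swap
    · intro y _
      have hee : (e : ℂ → ℂ) = F := funext heF
      rw [hee]; exact hasFDerivF hF y
    refine setIntegral_congr_fun e.open_source.measurableSet fun y hy => ?_
    have h3 : fderiv ℝ f y = (fderiv ℝ ft (F y)).comp (deriv F y • (1 : ℂ →L[ℝ] ℂ)) := by
      have h4 : f =ᶠ[𝓝 y] ft ∘ F := by
        filter_upwards [e.open_source.mem_nhds hy] with x hx
        exact (hftF x hx).symm
      rw [h4.fderiv_eq]
      exact ((hftd.differentiable (by norm_num) (F y)).hasFDerivAt.comp y (hasFDerivF hF y)).fderiv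
    rw [mul_assoc, ← gr_apply, h3, det_smul_one, heF, smul_eq_mul, abs_of_nonneg (by positivity)]
    simp only [ContinuousLinearMap.comp_apply, ContinuousLinearMap.smul_apply, ContinuousLinearMap.one_apply, map_mul, smul_eq_mul, ker]
    rw [← mul_assoc, Complex.mul_conj, Complex.normSq_eq_norm_sq]
    rw [← smul_eq_mul (‖deriv F y‖^2), ← map_smul]; simp
  simp_rw [hV]
  rw [integral_neg, neg_neg, integral_const_mul]
  have hSe : MeasurableSet (S ∩ e.source) := hS.isClosed.measurableSet.inter e.open_source.measurableSet
  have hinj : InjOn F (S ∩ e.source) := by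
    intro x hx y hy h
    rw [← heF, ← heF] at h
    exact e.injOn hx.2 hy.2 h
  have hcv := integral_image_eq_integral_abs_det_fderiv_smul volume hSe (fun y _ => (hasFDerivF hF y).hasFDerivWithinAt) hinj ft
  have hft0 : ∀ w, 0 ≤ ft w := fun w => indicator_nonneg (fun _ _ => hf0 _) w
  gcongr
  calc ∫ y in S, f y * ‖deriv F y‖^2 = ∫ y in S ∩ e.source, f y * ‖deriv F y‖^2 := by
        rw [setIntegral_eq_of_subset_of_forall_sdiff_eq_zero hS.isClosed.measurableSet inter_subset_left]
        intro y hy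
        have : y ∉ tsupport f := fun h => hy.2 ⟨hy.1, hs h⟩
        rw [image_eq_zero_of_notMem_tsupport this]; simp
    _ = ∫ w in F '' (S ∩ e.source), ft w := by
        rw [hcv]
        refine setIntegral_congr_fun hSe fun y hy => ?_
        rw [det_smul_one, hftF y hy.2, abs_of_nonneg (by positivity), smul_eq_mul, mul_comm]
    _ ≤ ∫ w in F '' S, ft w := by
        apply setIntegral_mono_set
        · exact (hftd.continuous.integrable_of_hasCompactSupport hftc).integrableOn
        · exact ae_of_all _ hft0
        · exact (image_mono inter_subset_left).eventuallyLE

lemma V_all {F : ℂ → ℂ} (hF : Differentiable ℂ F) (hF0 : ∀ z, deriv F z ≠ 0) {f : ℂ → ℝ} (hf : ContDiff ℝ 1 f) (hc : HasCompactSupport f)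
    (hf0 : ∀ z, 0 ≤ f z) {S : Set ℂ} (hS : IsCompact S) :
    2 * π * ∫ y in S, f y * ‖deriv F y‖^2 ≤ - ∫ w in F '' S, ∫ y, (gr (fderiv ℝ f y) * deriv F y * (F y - w)⁻¹).re := by
  have hFc : Continuous F := hF.continuous
  have hF' := cont_derivF hF
  have hchart : ∀ a : ℂ, ∃ e : OpenPartialHomeomorph ℂ ℂ, (∀ z, e z = F z) ∧ a ∈ e.source := by
    intro a
    have h1 : HasFDerivAt F ((ContinuousLinearEquiv.unitsEquivAut ℂ (Units.mk0 (deriv F a) (hF0 a)) : ℂ ≃L[ℂ] ℂ) : ℂ →L[ℂ] ℂ) a := by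
      exact (hF a).hasDerivAt.hasFDerivAt_equiv (hF0 a)
    have h2 : ContDiffAt ℂ 1 F a := hF.contDiff.contDiffAt
    refine ⟨h2.toOpenPartialHomeomorph F h1 (by norm_num), fun z => by rw [ContDiffAt.toOpenPartialHomeomorph_coe], ?_⟩
    exact h2.mem_toOpenPartialHomeomorph_source h1 (by norm_num)
  choose e he hea using hchart
  obtain ⟨t, ht⟩ := hc.isCompact.elim_finite_subcover (fun a => (e a).source) (fun a => (e a).open_source)
    (fun a _ => mem_iUnion.2 ⟨a, hea a⟩)
  obtain ⟨ρ, hρ⟩ := SmoothPartitionOfUnity.exists_isSubordinate 𝓘(ℝ, ℂ) (isClosed_tsupport f) (fun a : t => (e a).source)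
    (fun a => (e a).open_source) (by rwa [iUnion_subtype])
  set fj : t → ℂ → ℝ := fun a y => ρ a y * f y with hfj
  have hfjd : ∀ a, ContDiff ℝ 1 (fj a) := fun a => by
    have : ContDiff ℝ 1 (ρ a) := ((ρ a).contMDiff.contDiff).of_le (by exact_mod_cast le_top)
    exact this.mul hf
  have hfjc : ∀ a, HasCompactSupport (fj a) := fun a => hc.mul_left
  have hfjs : ∀ a, tsupport (fj a) ⊆ (e a).source := fun a =>
    (closure_mono (by intro x hx; simp only [Function.mem_support, hfj] at hx ⊢; exact left_ne_zero_of_mul hx)).trans (hρ a)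
  have hsum : ∀ y, f y = ∑ a, fj a y := by
    intro y
    by_cases hy : y ∈ tsupport f
    · have := ρ.sum_eq_one hy
      rw [finsum_eq_sum_of_fintype] at this
      rw [hfj]; simp only; rw [← Finset.sum_mul, this, one_mul]
    · simp [hfj, image_eq_zero_of_notMem_tsupport hy]
  have hT : MeasurableSet (F '' S) := (hS.image hFc).isClosed.measurableSet
  have hv : volume (F '' S) ≠ ⊤ := (hS.image hFc).measure_ne_top
  have hch := fun a => V_chart hF hF0 (hfjd a) (hfjc a) (fun z => mul_nonneg (ρ.nonneg a z) (hf0 z)) (e a) (he a) (hfjs a) hS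
  have h1 : ∫ y in S, f y * ‖deriv F y‖^2 = ∑ a, ∫ y in S, fj a y * ‖deriv F y‖^2 := by
    rw [← integral_finsetSum]
    · congr 1; ext y; rw [hsum y, Finset.sum_mul]
    · intro a _
      exact ((hfjd a).continuous.mul (hF'.norm.pow 2)).continuousOn.integrableOn_compact hS
  have h2 : ∀ y, gr (fderiv ℝ f y) = ∑ a, gr (fderiv ℝ (fj a) y) := by
    intro y
    have : fderiv ℝ f y = ∑ a, fderiv ℝ (fj a) y := by
      rw [← fderiv_fun_sum (fun a _ => (hfjd a).differentiable (by norm_num) y)]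
      congr 1; ext y; exact hsum y
    rw [this]
    simp only [gr, ContinuousLinearMap.sum_apply, Complex.ofReal_sum, Finset.sum_mul, Finset.sum_add_distrib]
  have h3 : ∫ w in F '' S, ∫ y, (gr (fderiv ℝ f y) * deriv F y * (F y - w)⁻¹).re
      = ∑ a, ∫ w in F '' S, ∫ y, (gr (fderiv ℝ (fj a) y) * deriv F y * (F y - w)⁻¹).re := by
    have hVi := fun a => V_integrable hF (hfjd a) (hfjc a) hT hv
    have hfi : Integrable (Function.uncurry fun w y : ℂ => (gr (fderiv ℝ f y) * deriv F y * (F y - w)⁻¹).re) ((volume.restrict (F '' S)).prod volume) := V_integrable hF hf hc hT hv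
    have e1 : ∀ p : ℂ × ℂ, Function.uncurry (fun w y : ℂ => (gr (fderiv ℝ f y) * deriv F y * (F y - w)⁻¹).re) p
       = ∑ a, Function.uncurry (fun w y : ℂ => (gr (fderiv ℝ (fj a) y) * deriv F y * (F y - w)⁻¹).re) p := by
      rintro ⟨w, y⟩
      simp only [Function.uncurry, h2 y, Finset.sum_mul, Complex.re_sum]
    rw [integral_integral hfi]
    simp_rw [integral_integral (hVi _)]
    refine Eq.trans ?_ (integral_finsetSum _ (fun a _ => hVi a))
    congr 1; ext p; exact e1 p
  rw [h1, h3, Finset.mul_sum, ← Finset.sum_neg_distrib]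
  exact Finset.sum_le_sum fun a _ => hch a

/-- weighted isoperimetric inequality -/
lemma kernel_ineq {F : ℂ → ℂ} (hF : Differentiable ℂ F) (hF0 : ∀ z, deriv F z ≠ 0) {f : ℂ → ℝ} (hf : ContDiff ℝ 1 f) (hc : HasCompactSupport f)
    (hf0 : ∀ z, 0 ≤ f z) {S : Set ℂ} (hS : IsCompact S) (hf1 : ∀ z ∈ S, 1 ≤ f z) :
    2 * √(π * ∫ y in S, ‖deriv F y‖^2) ≤ ∫ y, ‖fderiv ℝ f y‖ * ‖deriv F y‖ := by
  have hFc : Continuous F := hF.continuous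
  have hF' := cont_derivF hF
  have hSm := hS.isClosed.measurableSet
  have hT : MeasurableSet (F '' S) := (hS.image hFc).isClosed.measurableSet
  have hv : volume (F '' S) ≠ ⊤ := (hS.image hFc).measure_ne_top
  set A := ∫ y in S, ‖deriv F y‖^2 with hA
  set J := ∫ y, ‖fderiv ℝ f y‖ * ‖deriv F y‖ with hJ
  have hJ0 : 0 ≤ J := integral_nonneg fun y => by positivity
  have hA0 : 0 ≤ A := integral_nonneg fun y => by positivity
  have hAi : IntegrableOn (fun y => ‖deriv F y‖^2) S := (hF'.norm.pow 2).continuousOn.integrableOn_compact hS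
  have h1 : A ≤ ∫ y in S, f y * ‖deriv F y‖^2 := by
    refine setIntegral_mono_on hAi ((hf.continuous.mul (hF'.norm.pow 2)).continuousOn.integrableOn_compact hS) hSm ?_
    intro y hy
    have := hf1 y hy
    nlinarith [sq_nonneg ‖deriv F y‖]
  have h2 : volume.real (F '' S) ≤ A := by
    have := addHaar_image_le_lintegral_abs_det_fderiv volume hSm (fun y _ => (hasFDerivF hF y).hasFDerivWithinAt)
    simp_rw [det_smul_one] at this
    rw [hA, integral_eq_lintegral_of_nonneg_ae (ae_of_all _ fun y => by positivity) hAi.1]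
    refine ENNReal.toReal_mono ?_ (this.trans (le_of_eq ?_))
    · exact hAi.lintegral_lt_top.ne
    · congr 1; ext y; rw [abs_of_nonneg (by positivity)]
  have h3 := V_bound hF hf hc hT hv
  have h4 := V_all hF hF0 hf hc hf0 hS
  have h5 : √(π * volume.real (F '' S)) ≤ √(π * A) := by gcongr
  have h6 : 2 * π * A ≤ J * √(π * A) := by
    have h7 : 2 * π * A ≤ 2 * π * ∫ y in S, f y * ‖deriv F y‖^2 := by gcongr
    have h8 : J * √(π * volume.real (F '' S)) ≤ J * √(π * A) := by gcongr
    linarith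
  rcases hA0.eq_or_lt with h | h
  · rw [← h]; simpa using hJ0
  · have h9 : 0 < √(π * A) := by positivity
    have h10 : √(π * A) * √(π * A) = π * A := mul_self_sqrt (by positivity)
    refine le_of_mul_le_mul_right ?_ h9
    linarith

/-- weighted isoperimetric inequality for a conformal factor exp (Re P) -/
lemma kernel_exp {P : ℂ → ℂ} (hP : Differentiable ℂ P) {f : ℂ → ℝ} (hf : ContDiff ℝ 1 f) (hc : HasCompactSupport f)
    (hf0 : ∀ z, 0 ≤ f z) {S : Set ℂ} (hS : IsCompact S) (hf1 : ∀ z ∈ S, 1 ≤ f z) :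
    2 * √(π * ∫ y in S, exp ((P y).re)) ≤ ∫ y, ‖fderiv ℝ f y‖ * exp ((P y).re / 2) := by
  obtain ⟨F, hF⟩ := (Differentiable.isExactOn_univ (f := fun z => Complex.exp (P z / 2)) (by fun_prop))
  have hd : ∀ z, deriv F z = Complex.exp (P z / 2) := fun z => (hF z (mem_univ z)).deriv
  have hn : ∀ z, ‖deriv F z‖ = exp ((P z).re / 2) := by
    intro z; rw [hd, Complex.norm_exp]; congr 1; simp
  have := kernel_ineq (F := F) (fun z => (hF z (mem_univ z)).differentiableAt) (fun z => by rw [hd]; exact Complex.exp_ne_zero _)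
    hf hc hf0 hS hf1
  simp_rw [hn] at this
  convert this using 5
  ext y
  rw [← exp_nat_mul]; congr 1; push_cast; ring
end Bol

namespace Bol
open Set Filter Topology
open scoped Manifold ContDiff

lemma ibp {u k : ℂ → ℝ} (hu : ContDiff ℝ 1 u) (hc : HasCompactSupport u) (hk : ContDiff ℝ 1 k) (v : ℂ) :
    ∫ y, fderiv ℝ u y v * k y = - ∫ y, u y * fderiv ℝ k y v := by
  have hDu : Continuous (fderiv ℝ u) := hu.continuous_fderiv (by norm_num)
  have hDk : Continuous (fderiv ℝ k) := hk.continuous_fderiv (by norm_num)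
  have hcu := hu.continuous
  have hck := hk.continuous
  have hDuc : HasCompactSupport (fun y => fderiv ℝ u y v) := (hc.fderiv (𝕜 := ℝ)).comp_left (g := fun L : ℂ →L[ℝ] ℝ => L v) (by simp)
  rw [integral_mul_fderiv_eq_neg_fderiv_mul_of_integrable, neg_neg]
  · exact Continuous.integrable_of_hasCompactSupport ((hDu.clm_apply continuous_const).mul hck) hDuc.mul_right
  · exact Continuous.integrable_of_hasCompactSupport (hcu.mul (hDk.clm_apply continuous_const)) hc.mul_right
  · exact Continuous.integrable_of_hasCompactSupport (by fun_prop) hc.mul_right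
  · exact fun x _ => hu.differentiable (by norm_num) x
  · exact fun x _ => hk.differentiable (by norm_num) x

lemma integrable_mul_norm_inv {u : ℂ → ℝ} (hu : Continuous u) (hc : HasCompactSupport u) (w : ℂ) :
    Integrable (fun y => u y * ‖y - w‖⁻¹) := by
  have h1 := integrableOn_norm_inv hc.isCompact.isClosed.measurableSet hc.isCompact.measure_ne_top w
  obtain ⟨C, hC⟩ := hu.bounded_above_of_compact_support hc
  have h2 : IntegrableOn (fun y => u y * ‖y - w‖⁻¹) (tsupport u) := by
    refine (h1.const_mul C).mono' (hu.aestronglyMeasurable.mul (Measurable.aestronglyMeasurable (by fun_prop))) (ae_of_all _ fun y => ?_)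
    rw [norm_mul, norm_inv, norm_norm, norm_sub_rev]
    gcongr; exact hC y
  rwa [integrableOn_iff_integrable_of_support_subset] at h2
  intro y hy
  apply subset_tsupport u
  intro h; apply hy; simp [h]

lemma abs_log_le {x : ℝ} (hx : 0 ≤ x) : |log x| ≤ x⁻¹ + x := by
  rcases hx.eq_or_lt with h | h
  · simp [← h]
  rw [abs_le]
  constructor
  · have := log_le_sub_one_of_pos (inv_pos.2 h)
    rw [log_inv] at this; linarith
  · have := log_le_sub_one_of_pos h
    have : 0 < x⁻¹ := inv_pos.2 h
    linarith

lemma integrable_mul_log {u : ℂ → ℝ} (hu : Continuous u) (hc : HasCompactSupport u) (w : ℂ) :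
    Integrable (fun y => u y * log ‖y - w‖) := by
  have h1 := (integrable_mul_norm_inv hu hc w).norm
  have h2 : Integrable (fun y => ‖u y * ‖y - w‖‖) :=
    (Continuous.integrable_of_hasCompactSupport (f := fun y => u y * ‖y - w‖) (by fun_prop) hc.mul_right).norm
  refine (h1.add h2).mono' ?_ (ae_of_all _ fun y => ?_)
  · exact hu.aestronglyMeasurable.mul (Measurable.aestronglyMeasurable (by fun_prop))
  · simp only [Pi.add_apply, norm_mul, norm_inv, norm_norm]
    rw [← mul_add]
    gcongr
    exact abs_log_le (norm_nonneg _)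

set_option maxHeartbeats 1000000 in
lemma logIBP {u : ℂ → ℝ} (hu : ContDiff ℝ 1 u) (hc : HasCompactSupport u) (v w : ℂ) :
    ∫ y, fderiv ℝ u y v * log ‖y - w‖ = - ∫ y, u y * (v * (y - w)⁻¹).re := by
  have hDu : Continuous (fderiv ℝ u) := hu.continuous_fderiv (by norm_num)
  have hDuc : HasCompactSupport (fun y => fderiv ℝ u y v) := (hc.fderiv (𝕜 := ℝ)).comp_left (g := fun L : ℂ →L[ℝ] ℝ => L v) (by simp)
  have hDuv : Continuous (fun y => fderiv ℝ u y v) := hDu.clm_apply continuous_const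
  obtain ⟨k, hkdef⟩ : ∃ k : ℕ → ℂ → ℝ, ∀ n, k n = fun y => 1/2 * log (‖y - w‖^2 + (1/((n:ℝ)+1))^2) := ⟨_, fun _ => rfl⟩
  have hpos : ∀ (n : ℕ) (y : ℂ), 0 < ‖y - w‖^2 + (1/((n:ℝ)+1))^2 := fun n y => by positivity
  have hk : ∀ n, ContDiff ℝ 1 (k n) := by
    intro n
    rw [hkdef]
    refine contDiff_const.mul (ContDiff.log ?_ fun y => (hpos n y).ne')
    exact ((contDiff_id.sub contDiff_const).norm_sq ℝ).add contDiff_const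
  have hkd : ∀ n y, fderiv ℝ (k n) y v = (((starRingEnd ℂ) (y - w)) * v).re / (‖y - w‖^2 + (1/((n:ℝ)+1))^2) := by
    intro n y
    have h1 : HasFDerivAt (fun y : ℂ => ‖y - w‖^2 + (1/((n:ℝ)+1))^2) (2 • (innerSL ℝ (y - w))) y := by
      have := ((hasFDerivAt_id (𝕜 := ℝ) y).sub_const w).norm_sq
      exact (this.add_const _)
    have h2 := ((h1.log (hpos n y).ne').const_mul (1/2)).fderiv
    rw [hkdef, h2]
    simp [Complex.inner]
    field_simp
    ring
  have hib := fun n => ibp hu hc (hk n) v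
  have hsq : Tendsto (fun n : ℕ => (1/((n:ℝ)+1))^2) atTop (𝓝 0) := by
    simpa using (tendsto_one_div_add_atTop_nhds_zero_nat (𝕜 := ℝ)).pow 2
  have hle1 : ∀ n : ℕ, (1/((n:ℝ)+1))^2 ≤ 1 := by
    intro n
    have h : (1:ℝ)/((n:ℝ)+1) ≤ 1 := by rw [div_le_one (by positivity)]; linarith [Nat.cast_nonneg (α := ℝ) n]
    have h0 : 0 ≤ (1:ℝ)/((n:ℝ)+1) := by positivity
    nlinarith
  have hne : ∀ᵐ y : ℂ, y ≠ w := by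
    rw [ae_iff]; simp
  have hnorm : ∀ y, y ≠ w → 0 < ‖y - w‖ := fun y hy => norm_pos_iff.2 (sub_ne_zero.2 hy)
  have hlim1 : Tendsto (fun n => ∫ y, fderiv ℝ u y v * k n y) atTop (𝓝 (∫ y, fderiv ℝ u y v * log ‖y - w‖)) := by
    refine tendsto_integral_of_dominated_convergence (fun y => ‖fderiv ℝ u y v * log ‖y - w‖‖ + ‖fderiv ℝ u y v * (‖y - w‖^2+1)‖) ?_ ?_ ?_ ?_
    · intro n
      exact (hDuv.mul (hk n).continuous).aestronglyMeasurable (μ := volume)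
    · refine (integrable_mul_log hDuv hDuc w).norm.add ?_
      exact (Continuous.integrable_of_hasCompactSupport (f := fun y => fderiv ℝ u y v * (‖y - w‖^2+1)) (hDuv.mul (((continuous_id.sub continuous_const).norm.pow 2).add continuous_const)) hDuc.mul_right).norm
    · intro n
      filter_upwards [hne] with y hy
      have hy' := hnorm y hy
      rw [norm_mul, norm_mul, norm_mul, ← mul_add]
      gcongr
      have e1 : log ‖y - w‖ ≤ k n y := by
        have : log ‖y - w‖ = 1/2 * log (‖y - w‖^2) := by rw [log_pow]; push_cast; ring
        rw [this]
        simp only [hkdef]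
        gcongr
        linarith [sq_nonneg (1/((n:ℝ)+1))]
      have e2 : k n y ≤ ‖y - w‖^2 + 1 := by
        simp only [hkdef]
        have h3 := log_le_sub_one_of_pos (hpos n y)
        have := hle1 n
        nlinarith [sq_nonneg ‖y - w‖]
      rw [Real.norm_eq_abs, Real.norm_eq_abs, Real.norm_eq_abs, abs_of_nonneg (by positivity : 0 ≤ ‖y - w‖^2 + 1)]
      rw [abs_le]
      constructor
      · linarith [neg_abs_le (log ‖y - w‖), sq_nonneg ‖y - w‖]
      · linarith [abs_nonneg (log ‖y - w‖)]
    · filter_upwards [hne] with y hy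
      have hy' := hnorm y hy
      refine Tendsto.const_mul _ ?_
      have : log ‖y - w‖ = 1/2 * log (‖y - w‖^2 + 0) := by rw [add_zero, log_pow]; push_cast; ring
      rw [this]
      simp only [hkdef]
      refine Tendsto.const_mul _ (Tendsto.log ?_ (by positivity))
      exact hsq.const_add _
  have hlim2 : Tendsto (fun n => ∫ y, u y * fderiv ℝ (k n) y v) atTop (𝓝 (∫ y, u y * (v * (y - w)⁻¹).re)) := by
    refine tendsto_integral_of_dominated_convergence (fun y => ‖u y * ‖y - w‖⁻¹‖ * ‖v‖) ?_ ?_ ?_ ?_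
    · intro n
      exact (hu.continuous.mul (((hk n).continuous_fderiv (by norm_num)).clm_apply continuous_const)).aestronglyMeasurable
    · exact (integrable_mul_norm_inv hu.continuous hc w).norm.mul_const _
    · intro n
      filter_upwards [hne] with y hy
      have hy' := hnorm y hy
      rw [norm_mul, norm_mul, mul_assoc]
      gcongr
      rw [hkd, norm_div, Real.norm_of_nonneg (hpos n y).le, norm_inv, norm_norm, div_le_iff₀ (hpos n y)]
      have e1 : ‖((starRingEnd ℂ) (y - w) * v).re‖ ≤ ‖y - w‖ * ‖v‖ := by
        refine (Complex.abs_re_le_norm _).trans ?_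
        rw [norm_mul, RCLike.norm_conj]
      refine e1.trans ?_
      have : ‖y - w‖ * ‖v‖ = ‖y - w‖⁻¹ * ‖v‖ * ‖y - w‖^2 := by field_simp
      rw [this]
      gcongr
      linarith [sq_nonneg (1/((n:ℝ)+1))]
    · filter_upwards [hne] with y hy
      have hy' := hnorm y hy
      refine Tendsto.const_mul _ ?_
      simp_rw [hkd]
      have : (v * (y - w)⁻¹).re = (((starRingEnd ℂ) (y - w)) * v).re / (‖y - w‖^2 + 0) := by
        rw [add_zero, Complex.inv_def, Complex.normSq_eq_norm_sq, ← mul_assoc, Complex.re_mul_ofReal, mul_comm v]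
        rfl
      rw [this]
      refine Tendsto.div tendsto_const_nhds (hsq.const_add _) (by positivity)
  have h3 := tendsto_nhds_unique hlim1 ((hlim2.neg).congr (fun n => (hib n).symm))
  exact h3

/-- Laplacian on ℂ -/
noncomputable def lap (f : ℂ → ℝ) (y : ℂ) : ℝ :=
  fderiv ℝ (fun z => fderiv ℝ f z 1) y 1 + fderiv ℝ (fun z => fderiv ℝ f z Complex.I) y Complex.I

lemma contDiff_fderiv_apply {f : ℂ → ℝ} (hf : ContDiff ℝ 2 f) (v : ℂ) : ContDiff ℝ 1 (fun z => fderiv ℝ f z v) :=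
  (hf.fderiv_right (m := 1) (by norm_num)).clm_apply contDiff_const

lemma continuous_lap {f : ℂ → ℝ} (hf : ContDiff ℝ 2 f) : Continuous (lap f) := by
  unfold lap
  have h1 := (contDiff_fderiv_apply hf 1).continuous_fderiv (by norm_num)
  have h2 := (contDiff_fderiv_apply hf Complex.I).continuous_fderiv (by norm_num)
  exact (h1.clm_apply continuous_const).add (h2.clm_apply continuous_const)

lemma fderiv_apply_compact {f : ℂ → ℝ} (hc : HasCompactSupport f) (v : ℂ) : HasCompactSupport (fun y => fderiv ℝ f y v) :=
  (hc.fderiv (𝕜 := ℝ)).comp_left (g := fun L : ℂ →L[ℝ] ℝ => L v) (by simp)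

lemma lap_compact {f : ℂ → ℝ} (hc : HasCompactSupport f) : HasCompactSupport (lap f) :=
  (fderiv_apply_compact (fderiv_apply_compact hc 1) 1).add (fderiv_apply_compact (fderiv_apply_compact hc _) _)

lemma log_rep {f : ℂ → ℝ} (hf : ContDiff ℝ 2 f) (hc : HasCompactSupport f) (w : ℂ) :
    ∫ y, lap f y * log ‖y - w‖ = 2 * π * f w := by
  have h1 := contDiff_fderiv_apply hf 1
  have h2 := contDiff_fderiv_apply hf Complex.I
  have c1 := fderiv_apply_compact hc 1
  have c2 := fderiv_apply_compact hc Complex.I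
  have k := KI (hf.of_le (by norm_num)) hc w
  have i : ∀ v : ℂ, Integrable (fun y => fderiv ℝ f y v * (v * (y - w)⁻¹).re) := by
    intro v
    have hcv : Continuous (fun z => fderiv ℝ f z v) := (contDiff_fderiv_apply hf v).continuous
    refine ((integrable_mul_norm_inv hcv (fderiv_apply_compact hc v) w).norm.mul_const ‖v‖).mono' ?_ (ae_of_all _ fun y => ?_)
    · exact hcv.aestronglyMeasurable.mul (Measurable.aestronglyMeasurable (by fun_prop))
    · rw [norm_mul, norm_mul, mul_assoc]; gcongr
      refine (Complex.abs_re_le_norm _).trans ?_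
      rw [norm_mul, norm_inv, norm_inv, norm_norm, mul_comm]
  have e1 : ∀ y, fderiv ℝ f y (ker (y - w)) = fderiv ℝ f y 1 * (1 * (y - w)⁻¹).re + fderiv ℝ f y Complex.I * (Complex.I * (y - w)⁻¹).re := by
    intro y
    rw [ker, gr_apply]
    simp [gr]; ring
  simp_rw [e1] at k
  rw [integral_add (i 1) (i Complex.I)] at k
  unfold lap
  simp_rw [add_mul]
  have hi : ∀ v : ℂ, Integrable (fun y => fderiv ℝ (fun z => fderiv ℝ f z v) y v * log ‖y - w‖) := by
    intro v
    refine integrable_mul_log ?_ (fderiv_apply_compact (fderiv_apply_compact hc v) v) w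
    exact ((contDiff_fderiv_apply hf v).continuous_fderiv (by norm_num)).clm_apply continuous_const
  rw [integral_add (hi 1) (hi Complex.I), logIBP h1 c1, logIBP h2 c2]
  linarith
end Bol

namespace Bol
open Set Filter Topology
open scoped Manifold ContDiff

lemma hb_pos {E V : Type*} [AddCommGroup E] [Module ℝ E] [AddCommGroup V] [Module ℝ V]
    (s : PointedCone ℝ E) (i : V →ₗ[ℝ] E) (l : V →ₗ[ℝ] ℝ)
    (hpos : ∀ v, i v ∈ s → 0 ≤ l v) (hd : ∀ y, ∃ v, i v + y ∈ s) :
    ∃ Λ : E →ₗ[ℝ] ℝ, (∀ v, Λ (i v) = l v) ∧ ∀ x ∈ s, 0 ≤ Λ x := by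
  have hker : ∀ v, i v = 0 → l v = 0 := by
    intro v hv
    have h1 := hpos v (by rw [hv]; exact s.zero_mem)
    have h2 := hpos (-v) (by rw [map_neg, hv, neg_zero]; exact s.zero_mem)
    rw [map_neg] at h2
    linarith
  obtain ⟨j, hj⟩ := i.rangeRestrict.exists_rightInverse_of_surjective (LinearMap.range_rangeRestrict i)
  have hj' : ∀ x : LinearMap.range i, i (j x) = x := by
    intro x
    have := congrArg (fun f => ((f x : LinearMap.range i) : E)) hj
    simpa using this
  have hl : ∀ v, l (j (i.rangeRestrict v)) = l v := by
    intro v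
    have : l (j (i.rangeRestrict v) - v) = 0 := hker _ (by rw [map_sub, hj']; simp)
    rw [map_sub] at this; linarith
  obtain ⟨Λ, h1, h2⟩ := riesz_extension s ⟨LinearMap.range i, l ∘ₗ j⟩ (by
      rintro ⟨x, v, rfl⟩ hx
      have := hl v
      show 0 ≤ l (j ⟨i v, _⟩)
      have h3 : l (j ⟨i v, ⟨v, rfl⟩⟩) = l v := this
      rw [h3]; exact hpos v hx) (by
      intro y
      obtain ⟨v, hv⟩ := hd y
      exact ⟨⟨i v, ⟨v, rfl⟩⟩, hv⟩)
  refine ⟨Λ, fun v => ?_, h2⟩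
  have := h1 ⟨i v, ⟨v, rfl⟩⟩
  refine this.trans (hl v)

/-- Riesz representation for positive functionals on `C(S)`, with measures on `ℂ`. -/
lemma rmk {S : Set ℂ} (hS : IsCompact S) (Λ : C(S, ℝ) →ₗ[ℝ] ℝ) (hpos : ∀ f, 0 ≤ f → 0 ≤ Λ f) :
    ∃ μ : Measure ℂ, IsFiniteMeasure μ ∧ μ Sᶜ = 0 ∧
      ∀ f : ℂ → ℝ, ∀ hf : Continuous f, ∫ z, f z ∂μ = Λ ⟨fun x : S => f x, by fun_prop⟩ := by
  haveI : CompactSpace S := isCompact_iff_compactSpace.mp hS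
  obtain ⟨Λ', hΛ'⟩ : ∃ Λ' : CompactlySupportedContinuousMap S ℝ →ₚ[ℝ] ℝ, ∀ f, Λ' f = Λ f.toContinuousMap :=
    ⟨PositiveLinearMap.mk₀ (Λ ∘ₗ
      { toFun := fun f => f.toContinuousMap
        map_add' := fun f g => rfl
        map_smul' := fun c f => rfl }) (fun f hf => hpos _ hf), fun f => rfl⟩
  set ν := RealRMK.rieszMeasure Λ'
  haveI : IsFiniteMeasure ν := ⟨isCompact_univ.measure_lt_top⟩
  have hm : MeasurableEmbedding (Subtype.val : S → ℂ) := MeasurableEmbedding.subtype_coe hS.measurableSet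
  refine ⟨ν.map Subtype.val, inferInstance, ?_, ?_⟩
  · rw [hm.map_apply]
    simp
  · intro f hf
    rw [hm.integral_map]
    have := RealRMK.integral_rieszMeasure Λ' ⟨⟨fun x : S => f x, by fun_prop⟩, HasCompactSupport.of_compactSpace _⟩
    rw [hΛ'] at this
    exact this

/-- restriction of real parts of polynomials, as a linear map -/
noncomputable def reP (S : Set ℂ) : Polynomial ℂ →ₗ[ℝ] C(S, ℝ) where
  toFun p := ⟨fun x => (p.eval (x:ℂ)).re, by fun_prop⟩
  map_add' p q := by ext x; simp
  map_smul' c p := by ext x; simp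

noncomputable def evP (a : ℂ) : Polynomial ℂ →ₗ[ℝ] ℝ where
  toFun p := (p.eval a).re
  map_add' p q := by simp
  map_smul' c p := by simp

lemma max_principle {K : Set ℂ} (hK : IsCompact K) (p : Polynomial ℂ)
    (h : ∀ z ∈ frontier K, 0 ≤ (p.eval z).re) {a : ℂ} (ha : a ∈ K) : 0 ≤ (p.eval a).re := by
  have := Complex.norm_le_of_forall_mem_frontier_norm_le (f := fun z => Complex.exp (- p.eval z)) (U := K) (C := 1) hK.isBounded
    (Differentiable.diffContOnCl (by fun_prop)) (fun z hz => by
      rw [Complex.norm_exp]; simpa using h z hz) (subset_closure ha)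
  rw [Complex.norm_exp] at this
  simpa using this

/-- balayage of a point mass -/
lemma balayage {K : Set ℂ} (hK : IsCompact K) {a : ℂ} (ha : a ∈ K) :
    ∃ η : Measure ℂ, IsFiniteMeasure η ∧ η (frontier K)ᶜ = 0 ∧
      ∀ p : Polynomial ℂ, ∫ z, (p.eval z).re ∂η = (p.eval a).re := by
  have hS : IsCompact (frontier K) := hK.of_isClosed_subset isClosed_frontier hK.isClosed.frontier_subset
  haveI : CompactSpace (frontier K) := isCompact_iff_compactSpace.mp hS
  obtain ⟨Λ, h1, h2⟩ := hb_pos (PointedCone.positive ℝ C(frontier K, ℝ)) (reP (frontier K)) (evP a)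
    (by
      intro p hp
      refine max_principle hK p (fun z hz => ?_) ha
      exact ContinuousMap.le_def.1 ((PointedCone.mem_positive _ _).1 hp) ⟨z, hz⟩)
    (by
      intro y
      refine ⟨Polynomial.C (‖y‖:ℂ), ?_⟩
      rw [PointedCone.mem_positive, ContinuousMap.le_def]
      intro x
      have := neg_abs_le (y x)
      have := y.norm_coe_le_norm x
      simp [reP] at *
      linarith)
  obtain ⟨η, h3, h4, h5⟩ := rmk hS Λ (fun f hf => h2 f ((PointedCone.mem_positive _ _).2 hf))
  exact ⟨η, h3, h4, fun p => (h5 (fun z => (p.eval z).re) (by fun_prop)).trans (h1 p)⟩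

/-- duality for approximating `g` by harmonic polynomials -/
lemma duality {S : Set ℂ} (hS : IsCompact S) {g : ℂ → ℝ} (hg : Continuous g) {d : ℝ} (hd : 0 < d)
    (h : ∀ p : Polynomial ℂ, ∃ z ∈ S, d < |(p.eval z).re - g z|) :
    ∃ μ₁ μ₂ : Measure ℂ, IsFiniteMeasure μ₁ ∧ IsFiniteMeasure μ₂ ∧ μ₁ Sᶜ = 0 ∧ μ₂ Sᶜ = 0 ∧
      (∀ p : Polynomial ℂ, ∫ z, (p.eval z).re ∂μ₁ = ∫ z, (p.eval z).re ∂μ₂) ∧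
      ∫ z, g z ∂μ₁ ≠ ∫ z, g z ∂μ₂ := by
  haveI : CompactSpace S := isCompact_iff_compactSpace.mp hS
  obtain ⟨G, hG⟩ : ∃ G : C(S, ℝ), G = ⟨fun x : S => g x, by fun_prop⟩ := ⟨_, rfl⟩
  have hGx : ∀ x : S, G x = g x := by intro x; rw [hG]; rfl
  let L1 : (Polynomial ℂ × ℝ × ℝ) →ₗ[ℝ] C(S, ℝ) :=
    (reP S).coprod ((LinearMap.toSpanSingleton ℝ C(S, ℝ) 1).coprod (LinearMap.toSpanSingleton ℝ C(S, ℝ) G))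
  let L2 : (Polynomial ℂ × ℝ × ℝ) →ₗ[ℝ] C(S, ℝ) :=
    (-reP S).coprod ((LinearMap.toSpanSingleton ℝ C(S, ℝ) 1).coprod (LinearMap.toSpanSingleton ℝ C(S, ℝ) (-G)))
  let l : (Polynomial ℂ × ℝ × ℝ) →ₗ[ℝ] ℝ :=
    (0 : Polynomial ℂ →ₗ[ℝ] ℝ).coprod ((LinearMap.toSpanSingleton ℝ ℝ 1).coprod (LinearMap.toSpanSingleton ℝ ℝ d))
  obtain ⟨Λ, h1, h2⟩ := hb_pos (PointedCone.positive ℝ (C(S, ℝ) × C(S, ℝ))) (L1.prod L2) l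
    (by
      rintro ⟨p, α, β⟩ hp
      have hp' := (PointedCone.mem_positive _ _).1 hp
      have e1 : ∀ x : S, 0 ≤ (p.eval (x:ℂ)).re + α + β * g x := by
        intro x
        have := ContinuousMap.le_def.1 hp'.1 x
        simpa [L1, L2, reP, LinearMap.coprod_apply, hGx, add_assoc] using this
      have e2 : ∀ x : S, 0 ≤ -(p.eval (x:ℂ)).re + α - β * g x := by
        intro x
        have := ContinuousMap.le_def.1 hp'.2 x
        simp [L1, L2, reP, LinearMap.coprod_apply, hGx] at this
        linarith
      have el : l (p, α, β) = α + β * d := by simp [l, LinearMap.coprod_apply]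
      rw [el]
      obtain ⟨z, hz, hzd⟩ := h (-(((β⁻¹:ℝ):ℂ) • p))
      have a1 := e1 ⟨z, hz⟩
      have a2 := e2 ⟨z, hz⟩
      simp only at a1 a2
      rcases eq_or_ne β 0 with hb | hb
      · subst hb; simp at *; linarith
      · have : |β| * d < |β| * |((-(((β⁻¹:ℝ):ℂ) • p)).eval z).re - g z| := mul_lt_mul_of_pos_left hzd (abs_pos.2 hb)
        rw [← abs_mul] at this
        have e3 : β * (((-(((β⁻¹:ℝ):ℂ) • p)).eval z).re - g z) = -(p.eval z).re - β * g z := by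
          simp
          field_simp
        rw [e3] at this
        have e4 : |-(p.eval z).re - β * g z| ≤ α := abs_le.2 ⟨by linarith, by linarith⟩
        have := neg_abs_le β
        nlinarith)
    (by
      rintro ⟨y1, y2⟩
      refine ⟨(0, ‖y1‖ + ‖y2‖, 0), ?_⟩
      rw [PointedCone.mem_positive]
      refine ⟨?_, ?_⟩
      · rw [ContinuousMap.le_def]
        intro x
        have := neg_abs_le (y1 x)
        have hnx : |y1 x| ≤ ‖y1‖ := y1.norm_coe_le_norm x
        have hn2 : 0 ≤ ‖y2‖ := norm_nonneg y2
        simp [L1, LinearMap.coprod_apply]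
        linarith
      · rw [ContinuousMap.le_def]
        intro x
        have := neg_abs_le (y2 x)
        have hnx : |y2 x| ≤ ‖y2‖ := y2.norm_coe_le_norm x
        have hn1 : 0 ≤ ‖y1‖ := norm_nonneg y1
        simp [L2, LinearMap.coprod_apply]
        linarith)
  obtain ⟨μ₁, a1, a2, a3⟩ := rmk hS (Λ ∘ₗ LinearMap.inl ℝ _ _) (fun f hf => h2 _ ((PointedCone.mem_positive _ _).2 ⟨hf, le_rfl⟩))
  obtain ⟨μ₂, b1, b2, b3⟩ := rmk hS (Λ ∘ₗ LinearMap.inr ℝ _ _) (fun f hf => h2 _ ((PointedCone.mem_positive _ _).2 ⟨le_rfl, hf⟩))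
  have key : ∀ F : C(S, ℝ), Λ (LinearMap.inl ℝ _ _ F) - Λ (LinearMap.inr ℝ _ _ F) = Λ (F, -F) := by
    intro F
    rw [← map_sub]; congr 1; simp
  refine ⟨μ₁, μ₂, a1, b1, a2, b2, fun p => ?_, ?_⟩
  · have e := h1 (p, 0, 0)
    have e0 : (L1.prod L2) (p, 0, 0) = (reP S p, - reP S p) := by
      simp [L1, L2]
    rw [e0, ← key] at e
    have el : l (p, 0, 0) = 0 := by simp [l]
    rw [el] at e
    have q1 := a3 (fun z => (p.eval z).re) (by fun_prop)
    have q2 := b3 (fun z => (p.eval z).re) (by fun_prop)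
    have : ∫ z, (p.eval z).re ∂μ₁ - ∫ z, (p.eval z).re ∂μ₂ = 0 := by rw [q1, q2]; exact e
    linarith
  · have e := h1 (0, 0, 1)
    have e0 : (L1.prod L2) (0, 0, 1) = (G, - G) := by
      simp [L1, L2]
    rw [e0, ← key] at e
    have el : l (0, 0, 1) = d := by simp [l]
    rw [el] at e
    have q1 := a3 g hg
    have q2 := b3 g hg
    have : ∫ z, g z ∂μ₁ - ∫ z, g z ∂μ₂ = d := by rw [q1, q2, ← hG]; exact e
    intro h; linarith

end Bol

namespace Bol
open Set Filter Topology
open scoped Manifold ContDiff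

lemma ae_mem_of {μ : Measure ℂ} {K : Set ℂ} (h : μ Kᶜ = 0) : ∀ᵐ ζ ∂μ, ζ ∈ K := by
  rw [ae_iff]; exact h

noncomputable def reMul : ℂ →L[ℝ] (ℂ →L[ℝ] ℝ) := LinearMap.toContinuousLinearMap
    { toFun := fun c => Complex.reCLM ∘L (ContinuousLinearMap.mul ℝ ℂ c)
      map_add' := by intro a b; refine ContinuousLinearMap.ext fun v => ?_; simp
      map_smul' := by intro a b; refine ContinuousLinearMap.ext fun v => ?_; simp; ring }

lemma reMul_apply (c v : ℂ) : reMul c v = (c * v).re := rfl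

lemma hasFDerivAt_log_norm {u : ℂ} (hu : u ≠ 0) :
    HasFDerivAt (fun z : ℂ => log ‖z‖) (reMul u⁻¹) u := by
  have h1 : HasFDerivAt (fun z : ℂ => ‖z‖ ^ 2) (2 • (innerSL ℝ u)) u := by
    have := (hasFDerivAt_id (𝕜 := ℝ) u).norm_sq
    simpa using this
  have hp : ‖u‖ ^ 2 ≠ 0 := by simpa using hu
  have h2 := (h1.log hp).const_mul (1/2)
  have h3 : (fun z : ℂ => log ‖z‖) = fun z => 1/2 * log (‖z‖ ^ 2) := by
    ext z; rw [log_pow]; push_cast; ring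
  rw [h3]
  refine h2.congr_fderiv ?_
  refine ContinuousLinearMap.ext fun v => ?_
  rw [reMul_apply]
  simp [Complex.inner, Complex.inv_re, Complex.inv_im, ← Complex.normSq_eq_norm_sq]
  have : Complex.normSq u ≠ 0 := by simpa using hu
  field_simp
  ring

section
variable {μ : Measure ℂ} [IsFiniteMeasure μ] {K : Set ℂ}

lemma near_bound (hK : IsCompact K) {z₀ : ℂ} (hz : z₀ ∉ K) :
    ∃ r > 0, ∀ z ∈ Metric.ball z₀ r, ∀ ζ ∈ K, r ≤ ‖z - ζ‖ := by
  obtain ⟨r, hr, h⟩ := Metric.isOpen_iff.1 hK.isClosed.isOpen_compl z₀ hz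
  refine ⟨r/2, by positivity, fun z hz ζ hζ => ?_⟩
  have h1 : r ≤ dist ζ z₀ := by
    by_contra hh
    exact h (Metric.mem_ball.2 (not_le.1 hh)) hζ
  have h2 := Metric.mem_ball.1 hz
  have := dist_triangle ζ z z₀
  rw [← dist_eq_norm, dist_comm]; linarith

lemma integrable_log_off (hK : IsCompact K) (hμ : μ Kᶜ = 0) {z : ℂ} (hz : z ∉ K) :
    Integrable (fun ζ => log ‖z - ζ‖) μ := by
  obtain ⟨r, hr, h⟩ := near_bound hK hz
  obtain ⟨M, hM⟩ := (hK.image (f := fun ζ => ‖z - ζ‖) (by fun_prop)).bddAbove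
  refine Integrable.of_bound (C := r⁻¹ + M) (Measurable.aestronglyMeasurable (by fun_prop)) ?_
  filter_upwards [ae_mem_of hμ] with ζ hζ
  have h1 := h z (Metric.mem_ball_self hr) ζ hζ
  refine (abs_log_le (norm_nonneg _)).trans (add_le_add ?_ (hM ⟨ζ, hζ, rfl⟩))
  exact inv_anti₀ hr h1

lemma integrable_inv_off (hK : IsCompact K) (hμ : μ Kᶜ = 0) {z : ℂ} (hz : z ∉ K) :
    Integrable (fun ζ => (z - ζ)⁻¹) μ := by
  obtain ⟨r, hr, h⟩ := near_bound hK hz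
  refine Integrable.of_bound (C := r⁻¹) (Measurable.aestronglyMeasurable (by fun_prop)) ?_
  filter_upwards [ae_mem_of hμ] with ζ hζ
  have h1 := h z (Metric.mem_ball_self hr) ζ hζ
  rw [norm_inv]
  exact inv_anti₀ hr h1

lemma cauchy_diff (hK : IsCompact K) (hμ : μ Kᶜ = 0) {z : ℂ} (hz : z ∉ K) :
    DifferentiableAt ℂ (fun z => ∫ ζ, (z - ζ)⁻¹ ∂μ) z := by
  obtain ⟨r, hr, h⟩ := near_bound hK hz
  have := hasDerivAt_integral_of_dominated_loc_of_deriv_le (μ := μ) (𝕜 := ℂ) (F := fun z ζ => (z - ζ)⁻¹)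
    (F' := fun z ζ => -1 / (z - ζ)^2) (x₀ := z) (bound := fun _ => (r^2)⁻¹)
    (Metric.ball_mem_nhds z hr) (Eventually.of_forall fun z => Measurable.aestronglyMeasurable (by fun_prop))
    (integrable_inv_off hK hμ hz) (Measurable.aestronglyMeasurable (by fun_prop))
    (by
      filter_upwards [ae_mem_of hμ] with ζ hζ x hx
      have h1 := h x hx ζ hζ
      rw [norm_div, norm_neg, norm_one, norm_pow, one_div]
      gcongr)
    (integrable_const _)
    (by
      filter_upwards [ae_mem_of hμ] with ζ hζ x hx
      have h1 := h x hx ζ hζ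
      have h2 : x - ζ ≠ 0 := norm_pos_iff.1 (hr.trans_le h1)
      exact ((hasDerivAt_id x).sub_const ζ).fun_inv h2)
  exact this.2.differentiableAt

lemma pot_fderiv (hK : IsCompact K) (hμ : μ Kᶜ = 0) {z : ℂ} (hz : z ∉ K) :
    HasFDerivAt (fun z => ∫ ζ, log ‖z - ζ‖ ∂μ) (reMul (∫ ζ, (z - ζ)⁻¹ ∂μ)) z := by
  obtain ⟨r, hr, h⟩ := near_bound hK hz
  obtain ⟨F', hF'⟩ : ∃ F' : ℂ → ℂ → (ℂ →L[ℝ] ℝ), ∀ z ζ, F' z ζ = reMul ((z - ζ)⁻¹) := ⟨_, fun _ _ => rfl⟩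
  obtain ⟨A, hA⟩ : ∃ A, A = reMul := ⟨_, rfl⟩
  have hI : ∫ ζ, F' z ζ ∂μ = reMul (∫ ζ, (z - ζ)⁻¹ ∂μ) := by
    simp only [hF', ← hA]
    exact A.integral_comp_comm (integrable_inv_off hK hμ hz)
  rw [← hI]
  refine hasFDerivAt_integral_of_dominated_of_fderiv_le (μ := μ) (𝕜 := ℝ) (F := fun z ζ => log ‖z - ζ‖)
    (F' := F') (bound := fun _ => ‖A‖ * r⁻¹)
    (Metric.ball_mem_nhds z hr) (Eventually.of_forall fun z => Measurable.aestronglyMeasurable (by fun_prop))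
    (integrable_log_off hK hμ hz) ?_ ?_ (integrable_const _) ?_
  · have e : F' z = fun ζ => A ((z - ζ)⁻¹) := by
      funext ζ; rw [hF', hA]
    rw [e]
    exact A.continuous.comp_aestronglyMeasurable (Measurable.aestronglyMeasurable (by fun_prop))
  · filter_upwards [ae_mem_of hμ] with ζ hζ x hx
    have h1 := h x hx ζ hζ
    rw [hF', ← hA]
    refine (A.le_opNorm _).trans ?_
    rw [norm_inv]
    gcongr
  · filter_upwards [ae_mem_of hμ] with ζ hζ x hx
    have h1 := h x hx ζ hζ
    have h2 : x - ζ ≠ 0 := norm_pos_iff.1 (hr.trans_le h1)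
    rw [hF']
    have := (hasFDerivAt_log_norm h2).comp x ((hasFDerivAt_id (𝕜 := ℝ) x).sub_const ζ)
    simpa [Function.comp_def] using this

lemma pot_far (hK : IsCompact K) (hμ : μ Kᶜ = 0) {R : ℝ} (hR : 0 < R) (hKR : ∀ ζ ∈ K, ‖ζ‖ ≤ R) {z : ℂ} (hz : 2 * R < ‖z‖) :
    Tendsto (fun n : ℕ => ∫ ζ, ((Polynomial.C (log ‖z‖ : ℂ) - ∑ k ∈ Finset.range n, Polynomial.C ((z⁻¹)^k / k) * Polynomial.X ^ k).eval ζ).re ∂μ)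
      atTop (𝓝 (∫ ζ, log ‖z - ζ‖ ∂μ)) := by
  have hz0 : z ≠ 0 := norm_pos_iff.1 (by linarith)
  have hw : ∀ ζ ∈ K, ‖ζ * z⁻¹‖ ≤ 1/2 := by
    intro ζ hζ
    rw [norm_mul, norm_inv, ← div_eq_mul_inv, div_le_iff₀ (by linarith)]
    have := hKR ζ hζ
    linarith
  have hev : ∀ (n : ℕ) ζ, (Polynomial.C (log ‖z‖ : ℂ) - ∑ k ∈ Finset.range n, Polynomial.C ((z⁻¹)^k / k) * Polynomial.X ^ k).eval ζ
      = (log ‖z‖ : ℂ) - ∑ k ∈ Finset.range n, (ζ * z⁻¹)^k / k := by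
    intro n ζ
    rw [Polynomial.eval_sub, Polynomial.eval_C, Polynomial.eval_finset_sum]
    congr 1
    refine Finset.sum_congr rfl fun k _ => ?_
    simp [mul_pow]; ring
  simp only [hev]
  refine tendsto_integral_of_dominated_convergence (fun _ => |log ‖z‖| + 2) (fun n => Continuous.aestronglyMeasurable (by fun_prop)) (integrable_const _) (fun n => ?_) ?_
  · filter_upwards [ae_mem_of hμ] with ζ hζ
    refine (Complex.abs_re_le_norm _).trans ((norm_sub_le _ _).trans (add_le_add (le_of_eq (by rw [Complex.norm_real]; rfl)) ?_))
    refine (norm_sum_le _ _).trans ?_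
    refine le_trans (Finset.sum_le_sum (g := fun k => (1/2:ℝ)^k) fun k _ => ?_) (sum_geometric_two_le n)
    rw [norm_div, norm_pow]
    rcases Nat.eq_zero_or_pos k with h | h
    · subst h; simp
    · refine (div_le_self (by positivity) ?_).trans (pow_le_pow_left₀ (norm_nonneg _) (hw ζ hζ) k)
      simp; exact h
  · filter_upwards [ae_mem_of hμ] with ζ hζ
    have h1 : ‖ζ * z⁻¹‖ < 1 := (hw ζ hζ).trans_lt (by norm_num)
    have h2 := (Complex.hasSum_taylorSeries_neg_log h1).tendsto_sum_nat
    have h3 := (Complex.continuous_re.tendsto _).comp ((tendsto_const_nhds (x := (log ‖z‖ : ℂ))).sub h2)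
    convert h3 using 1
    congr 1
    rw [sub_neg_eq_add, Complex.add_re, Complex.ofReal_re, Complex.log_re, ← log_mul (by simpa using hz0), ← norm_mul]
    · congr 2; field_simp
    · intro h
      rw [norm_eq_zero, sub_eq_zero] at h
      rw [← h] at h1; simp at h1

end

/-- W2 -/
lemma pot_eq_off {μ₁ μ₂ : Measure ℂ} [IsFiniteMeasure μ₁] [IsFiniteMeasure μ₂] {K : Set ℂ} (hK : IsCompact K)
    (hR : IsConnected Kᶜ) (h1 : μ₁ Kᶜ = 0) (h2 : μ₂ Kᶜ = 0)
    (hp : ∀ p : Polynomial ℂ, ∫ z, (p.eval z).re ∂μ₁ = ∫ z, (p.eval z).re ∂μ₂) {z : ℂ} (hz : z ∉ K) :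
    ∫ ζ, log ‖z - ζ‖ ∂μ₁ = ∫ ζ, log ‖z - ζ‖ ∂μ₂ := by
  obtain ⟨R, hR0, hKR⟩ := hK.isBounded.exists_pos_norm_le
  have hfar : ∀ z : ℂ, 2 * R < ‖z‖ → ∫ ζ, log ‖z - ζ‖ ∂μ₁ = ∫ ζ, log ‖z - ζ‖ ∂μ₂ := by
    intro z hz
    have e1 := pot_far hK h1 hR0 hKR hz
    have e2 := pot_far hK h2 hR0 hKR hz
    simp only [hp] at e1
    exact tendsto_nhds_unique e1 e2
  have hfarK : ∀ z : ℂ, 2 * R < ‖z‖ → z ∉ K := fun z hz hzK => by have := hKR z hzK; linarith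
  have hopen : IsOpen {z : ℂ | 2 * R < ‖z‖} := isOpen_lt continuous_const continuous_norm
  obtain ⟨z₁, hz₁⟩ : ∃ z₁ : ℂ, 2 * R < ‖z₁‖ := ⟨((2 * R + 1 : ℝ) : ℂ), by rw [Complex.norm_real, Real.norm_eq_abs, abs_of_pos] <;> linarith⟩
  have hsubL : ∀ a b : ℂ, reMul a = reMul b → a = b := by
    intro a b hab
    have a1 := congrArg (fun L : ℂ →L[ℝ] ℝ => L 1) hab
    have a2 := congrArg (fun L : ℂ →L[ℝ] ℝ => L Complex.I) hab
    simp [reMul_apply] at a1 a2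
    exact Complex.ext a1 a2
  have hC : EqOn (fun z => ∫ ζ, (z - ζ)⁻¹ ∂μ₁) (fun z => ∫ ζ, (z - ζ)⁻¹ ∂μ₂) Kᶜ := by
    refine AnalyticOnNhd.eqOn_of_preconnected_of_eventuallyEq (𝕜 := ℂ) (z₀ := z₁) ?_ ?_ hR.isPreconnected (hfarK _ hz₁) ?_
    · exact DifferentiableOn.analyticOnNhd (fun z hz => (cauchy_diff hK h1 hz).differentiableWithinAt) hK.isClosed.isOpen_compl
    · exact DifferentiableOn.analyticOnNhd (fun z hz => (cauchy_diff hK h2 hz).differentiableWithinAt) hK.isClosed.isOpen_compl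
    · filter_upwards [hopen.mem_nhds hz₁] with z hz
      refine hsubL _ _ ?_
      have e1 := pot_fderiv hK h1 (hfarK z hz)
      have e2 := pot_fderiv hK h2 (hfarK z hz)
      refine e1.unique (e2.congr_of_eventuallyEq ?_)
      filter_upwards [hopen.mem_nhds hz] with w hw
      exact hfar w hw
  refine IsOpen.eqOn_of_fderiv_eq (𝕜 := ℝ) (f := fun z => ∫ ζ, log ‖z - ζ‖ ∂μ₁) (g := fun z => ∫ ζ, log ‖z - ζ‖ ∂μ₂) hK.isClosed.isOpen_compl hR.isPreconnected
    (fun z hz => (pot_fderiv hK h1 hz).differentiableAt.differentiableWithinAt)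
    (fun z hz => (pot_fderiv hK h2 hz).differentiableAt.differentiableWithinAt) (fun z hz => ?_) (hfarK _ hz₁) (hfar _ hz₁) hz
  rw [(pot_fderiv hK h1 hz).fderiv, (pot_fderiv hK h2 hz).fderiv]
  have := hC hz
  simp only at this
  rw [this]

end Bol

namespace Bol
open Set Filter Topology
open scoped Manifold ContDiff ENNReal

noncomputable def kk (t : ℝ) : ℝ≥0∞ := if t = 0 then ⊤ else ENNReal.ofReal (-log |t|)

lemma measurable_kk : Measurable kk := by
  unfold kk
  refine Measurable.ite (measurableSet_singleton 0) measurable_const ?_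
  fun_prop

lemma kk_fin : ∫⁻ t, kk t < ⊤ := by
  have h1 : ∫⁻ t, kk t = ∫⁻ t in Icc (-1:ℝ) 1, ENNReal.ofReal (-log |t|) := by
    rw [← lintegral_indicator measurableSet_Icc]
    refine lintegral_congr_ae ?_
    have : ∀ᵐ t : ℝ, t ≠ 0 := by simp [ae_iff]
    filter_upwards [this] with t ht
    unfold kk
    rw [if_neg ht]
    by_cases h : t ∈ Icc (-1:ℝ) 1
    · rw [indicator_of_mem h]
    · rw [indicator_of_notMem h]
      have : 1 ≤ |t| := by
        by_contra hh
        exact h (abs_le.1 (not_le.1 hh).le)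
      exact ENNReal.ofReal_of_nonpos (by have := log_nonneg this; linarith)
  rw [h1]
  have h2 : IntegrableOn (fun t : ℝ => -log |t|) (Icc (-1) 1) := by
    have : IntervalIntegrable (fun t : ℝ => -log t) volume (-1) 1 := (intervalIntegral.intervalIntegrable_log').neg
    rw [integrableOn_Icc_iff_integrableOn_Ioc]
    have := (intervalIntegrable_iff_integrableOn_Ioc_of_le (by norm_num)).1 this
    simpa [log_abs] using this
  exact (hasFiniteIntegral_iff_ofReal_le h2)
where
  hasFiniteIntegral_iff_ofReal_le {f : ℝ → ℝ} {s : Set ℝ} (h : IntegrableOn f s) : ∫⁻ t in s, ENNReal.ofReal (f t) < ⊤ := h.lintegral_lt_top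

/-- choice of a good radius -/
lemma good_radius {μ : Measure ℂ} [IsFiniteMeasure μ] (z₀ : ℂ) {r : ℝ} (hr : 0 < r) (B : Set ℂ) :
    ∃ t ∈ Icc (1/2:ℝ) 1, ∫⁻ ζ in B, kk (t - ‖z₀ - ζ‖ / r) ∂μ ≤ 2 * (∫⁻ t, kk t) * μ B := by
  obtain ⟨φ, hφ⟩ : ∃ φ : ℝ → ℝ≥0∞, ∀ t, φ t = ∫⁻ ζ in B, kk (t - ‖z₀ - ζ‖ / r) ∂μ := ⟨_, fun _ => rfl⟩
  have hm : Measurable (fun p : ℝ × ℂ => kk (p.1 - ‖z₀ - p.2‖ / r)) := measurable_kk.comp (by fun_prop)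
  have hφm : Measurable φ := by
    have : φ = fun t => ∫⁻ ζ in B, kk (t - ‖z₀ - ζ‖ / r) ∂μ := funext hφ
    rw [this]
    exact hm.lintegral_prod_right
  have hI : ∫⁻ t in Icc (1/2:ℝ) 1, φ t ≤ (∫⁻ t, kk t) * μ B := by
    calc ∫⁻ t in Icc (1/2:ℝ) 1, φ t = ∫⁻ t in Icc (1/2:ℝ) 1, ∫⁻ ζ in B, kk (t - ‖z₀ - ζ‖ / r) ∂μ := by simp only [hφ]
      _ = ∫⁻ ζ in B, ∫⁻ t in Icc (1/2:ℝ) 1, kk (t - ‖z₀ - ζ‖ / r) ∂volume ∂μ := lintegral_lintegral_swap hm.aemeasurable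
      _ ≤ ∫⁻ ζ in B, (∫⁻ t, kk t) ∂μ := by
        refine lintegral_mono fun ζ => ?_
        refine (setLIntegral_le_lintegral _ _).trans ?_
        rw [lintegral_sub_right_eq_self (fun t => kk t)]
      _ = (∫⁻ t, kk t) * μ B := by simp
  obtain ⟨t, ht, h⟩ := exists_le_setLAverage (μ := volume) (s := Icc (1/2:ℝ) 1) (f := φ) (by simp; norm_num) (by simp) hφm.aemeasurable
  refine ⟨t, ht, ?_⟩
  rw [← hφ]
  refine h.trans ?_
  rw [setLAverage_eq]
  have : volume (Icc (1/2:ℝ) 1) = (2:ℝ≥0∞)⁻¹ := by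
    rw [Real.volume_Icc, show (1:ℝ) - 1/2 = 2⁻¹ by norm_num, ENNReal.ofReal_inv_of_pos (by norm_num)]; simp
  rw [this, ENNReal.div_eq_inv_mul, inv_inv, mul_assoc]
  gcongr

/-- W3 core -/
lemma approach {μ : Measure ℂ} [IsFiniteMeasure μ] {R : Set ℂ} {z₀ : ℂ}
    (hR : ∀ ρ > 0, ρ ≤ 1 → ∃ z ∈ R, ‖z - z₀‖ = ρ) (h0 : μ {z₀} = 0)
    (hintg : Integrable (fun ζ => log ‖z₀ - ζ‖) μ) :
    ∃ z : ℕ → ℂ, (∀ n, z n ∈ R) ∧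
      Tendsto (fun n => ∫⁻ ζ, ENNReal.ofReal (|log ‖z n - ζ‖ - log ‖z₀ - ζ‖|) ∂μ) atTop (𝓝 0) := by
  obtain ⟨r, hrdef⟩ : ∃ r : ℕ → ℝ, ∀ n, r n = 1/((n:ℝ)+4) := ⟨_, fun _ => rfl⟩
  have hr0 : ∀ n, 0 < r n := fun n => by rw [hrdef]; positivity
  have hr1 : ∀ n, r n ≤ 1/4 := fun n => by
    rw [hrdef]; exact one_div_le_one_div_of_le (by norm_num) (by have := Nat.cast_nonneg (α := ℝ) n; linarith)
  have hrt : Tendsto r atTop (𝓝 0) := by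
    have : r = fun n : ℕ => 1/((n:ℝ)+4) := funext hrdef
    rw [this]
    exact (tendsto_const_nhds (x := (1:ℝ))).div_atTop (tendsto_natCast_atTop_atTop.atTop_add tendsto_const_nhds)
  obtain ⟨B, hB⟩ : ∃ B : ℕ → Set ℂ, ∀ n, B n = {ζ | ‖z₀ - ζ‖ < 2 * r n} := ⟨_, fun _ => rfl⟩
  have hBm : ∀ n, MeasurableSet (B n) := fun n => by
    rw [hB]; exact measurableSet_lt (by fun_prop) measurable_const
  choose t ht hgood using fun n => good_radius (μ := μ) z₀ (hr0 n) (B n)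
  have htp : ∀ n, 0 < t n := fun n => by have := (ht n).1; linarith
  choose z hzR hz using fun n => hR (r n * t n) (mul_pos (hr0 n) (htp n)) (by
    have := hr1 n; have := (ht n).2; have := htp n; have := hr0 n; nlinarith)
  have hzr : ∀ n, ‖z n - z₀‖ ≤ r n := fun n => by
    rw [hz]; have := (ht n).2; have := hr0 n; nlinarith
  refine ⟨z, hzR, ?_⟩
  have hzt : Tendsto z atTop (𝓝 z₀) := by
    rw [tendsto_iff_norm_sub_tendsto_zero]
    exact squeeze_zero (fun _ => norm_nonneg _) hzr hrt
  obtain ⟨c0, hc0⟩ : ∃ c0, c0 = ∫⁻ t, kk t := ⟨_, rfl⟩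
  have hc0t : c0 ≠ ⊤ := by rw [hc0]; exact kk_fin.ne
  have hae0 : ∀ᵐ ζ ∂μ, ζ ≠ z₀ := by rw [ae_iff]; simpa using h0
  -- Q
  obtain ⟨q, hq⟩ : ∃ q : ℂ → ℝ≥0∞, ∀ ζ, q ζ = ENNReal.ofReal (|log ‖z₀ - ζ‖| + 1) := ⟨_, fun _ => rfl⟩
  have hqm : Measurable q := by
    have : q = fun ζ => ENNReal.ofReal (|log ‖z₀ - ζ‖| + 1) := funext hq
    rw [this]; fun_prop
  have hqf : ∫⁻ ζ, q ζ ∂μ ≠ ⊤ := by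
    simp only [hq]
    exact (hintg.abs.add (integrable_const 1)).lintegral_lt_top.ne
  have hQ : Tendsto (fun n => ∫⁻ ζ in B n, q ζ ∂μ) atTop (𝓝 0) := by
    have e : ∀ n, ∫⁻ ζ in B n, q ζ ∂μ = ∫⁻ ζ, (B n).indicator q ζ ∂μ := fun n => (lintegral_indicator (hBm n) _).symm
    simp only [e]
    rw [show (0:ℝ≥0∞) = ∫⁻ ζ, 0 ∂μ by simp]
    refine tendsto_lintegral_of_dominated_convergence q (fun n => hqm.indicator (hBm n)) (fun n => ae_of_all _ fun ζ => indicator_le_self _ _ _) hqf ?_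
    filter_upwards [hae0] with ζ hζ
    refine tendsto_const_nhds.congr' ?_
    have hpos : 0 < ‖z₀ - ζ‖ := norm_pos_iff.2 (sub_ne_zero.2 hζ.symm)
    have : ∀ᶠ n in atTop, 2 * r n < ‖z₀ - ζ‖ := by
      have := hrt.const_mul 2
      rw [mul_zero] at this
      exact this.eventually_lt_const hpos
    filter_upwards [this] with n hn
    rw [indicator_of_notMem]
    rw [hB]; simpa using hn.le
  -- outside
  obtain ⟨w, hw⟩ : ∃ w : ℕ → ℂ → ℝ≥0∞, ∀ n ζ, w n ζ = ENNReal.ofReal (|log ‖z n - ζ‖ - log ‖z₀ - ζ‖|) := ⟨_, fun _ _ => rfl⟩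
  have hwm : ∀ n, Measurable (w n) := by
    intro n
    have : w n = fun ζ => ENNReal.ofReal (|log ‖z n - ζ‖ - log ‖z₀ - ζ‖|) := funext (hw n)
    rw [this]; fun_prop
  have hT : Tendsto (fun n => ∫⁻ ζ in (B n)ᶜ, w n ζ ∂μ) atTop (𝓝 0) := by
    have e : ∀ n, ∫⁻ ζ in (B n)ᶜ, w n ζ ∂μ = ∫⁻ ζ, (B n)ᶜ.indicator (w n) ζ ∂μ := fun n => (lintegral_indicator (hBm n).compl _).symm
    simp only [e]
    rw [show (0:ℝ≥0∞) = ∫⁻ ζ, 0 ∂μ by simp]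
    refine tendsto_lintegral_of_dominated_convergence (fun _ => 1) (fun n => (hwm n).indicator (hBm n).compl) (fun n => ?_) (by simp) ?_
    · filter_upwards [hae0] with ζ hζ
      have hpos : 0 < ‖z₀ - ζ‖ := norm_pos_iff.2 (sub_ne_zero.2 hζ.symm)
      by_cases h : ζ ∈ (B n)ᶜ
      · rw [indicator_of_mem h, hw]
        have h' : 2 * r n ≤ ‖z₀ - ζ‖ := by
          rw [hB] at h; simpa using h
        have a1 := hzr n
        have a2 : ‖z₀ - ζ‖ / 2 ≤ ‖z n - ζ‖ := by
          have := norm_sub_norm_le (z₀ - ζ) (z₀ - z n)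
          rw [show z₀ - ζ - (z₀ - z n) = z n - ζ by ring, norm_sub_rev z₀ (z n)] at this
          linarith
        have a3 : ‖z n - ζ‖ ≤ 2 * ‖z₀ - ζ‖ := by
          have := norm_add_le (z n - z₀) (z₀ - ζ)
          rw [show z n - z₀ + (z₀ - ζ) = z n - ζ by ring] at this
          have := hr0 n
          linarith
        have l2 : log 2 ≤ 1 := by have := log_two_lt_d9; linarith
        have b1 := log_le_log (by positivity) a2
        rw [log_div hpos.ne' (by norm_num)] at b1
        have b2 := log_le_log (by linarith) a3
        rw [log_mul (by norm_num) hpos.ne'] at b2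
        rw [ENNReal.ofReal_le_one, abs_le]
        constructor <;> linarith
      · rw [indicator_of_notMem h]; exact zero_le
    · filter_upwards [hae0] with ζ hζ
      have hpos : 0 < ‖z₀ - ζ‖ := norm_pos_iff.2 (sub_ne_zero.2 hζ.symm)
      have hlim : Tendsto (fun n => w n ζ) atTop (𝓝 0) := by
        simp only [hw]
        rw [show (0:ℝ≥0∞) = ENNReal.ofReal (|log ‖z₀ - ζ‖ - log ‖z₀ - ζ‖|) by simp]
        refine ENNReal.tendsto_ofReal ?_
        exact ((((hzt.sub_const ζ).norm).log hpos.ne').sub_const _).abs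
      exact tendsto_of_tendsto_of_tendsto_of_le_of_le tendsto_const_nhds hlim (fun _ => zero_le) (fun n => indicator_le_self _ _ _)
  -- inside
  have hin : ∀ n, ∫⁻ ζ in B n, w n ζ ∂μ ≤ (2 * c0 + 2) * ∫⁻ ζ in B n, q ζ ∂μ := by
    intro n
    have hfin : ∫⁻ ζ in B n, kk (t n - ‖z₀ - ζ‖ / r n) ∂μ ≠ ⊤ := by
      refine ((hgood n).trans_lt ?_).ne
      rw [← hc0]
      exact ENNReal.mul_lt_top (ENNReal.mul_lt_top (by simp) hc0t.lt_top) (measure_lt_top _ _)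
    have hkm : Measurable (fun ζ => kk (t n - ‖z₀ - ζ‖ / r n)) := measurable_kk.comp (by fun_prop)
    have hne : ∀ᵐ ζ ∂(μ.restrict (B n)), kk (t n - ‖z₀ - ζ‖ / r n) < ⊤ := ae_lt_top hkm hfin
    have hpt : ∀ᵐ ζ ∂(μ.restrict (B n)), w n ζ ≤ kk (t n - ‖z₀ - ζ‖ / r n) + 2 * q ζ := by
      filter_upwards [hne, ae_restrict_mem (hBm n), ae_restrict_of_ae hae0] with ζ h1 h2 h3
      have hpos : 0 < ‖z₀ - ζ‖ := norm_pos_iff.2 (sub_ne_zero.2 h3.symm)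
      have h2' : ‖z₀ - ζ‖ < 2 * r n := by rw [hB] at h2; exact h2
      have ht0 : t n - ‖z₀ - ζ‖ / r n ≠ 0 := by
        intro h; rw [h, kk, if_pos rfl] at h1; exact lt_irrefl _ h1
      rw [kk, if_neg ht0, hw, hq]
      have hr0n := hr0 n
      have a1 : r n * |t n - ‖z₀ - ζ‖ / r n| ≤ ‖z n - ζ‖ := by
        rw [← abs_of_pos hr0n, ← abs_mul, abs_of_pos hr0n, mul_sub, mul_div_cancel₀ _ hr0n.ne', ← hz n]
        have := abs_norm_sub_norm_le (z n - z₀) (ζ - z₀)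
        rw [show z n - z₀ - (ζ - z₀) = z n - ζ by ring, norm_sub_rev ζ z₀] at this
        exact this
      have a0 : 0 < |t n - ‖z₀ - ζ‖ / r n| := abs_pos.2 ht0
      have a2 : ‖z n - ζ‖ ≤ 1 := by
        have := norm_add_le (z n - z₀) (z₀ - ζ)
        rw [show z n - z₀ + (z₀ - ζ) = z n - ζ by ring] at this
        have := hr1 n
        have := hzr n
        linarith
      have b1 := log_le_log (mul_pos hr0n a0) a1
      rw [log_mul hr0n.ne' a0.ne'] at b1
      have b2 := log_nonpos (norm_nonneg _) a2
      have b3 := log_le_log hpos h2'.le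
      rw [log_mul (by norm_num) hr0n.ne'] at b3
      have l2 : log 2 ≤ 1 := by have := log_two_lt_d9; linarith
      have c1 : |log ‖z n - ζ‖ - log ‖z₀ - ζ‖| ≤ max (-log |t n - ‖z₀ - ζ‖ / r n|) 0 + 2 * (|log ‖z₀ - ζ‖| + 1) := by
        have m1 := le_max_left (-log |t n - ‖z₀ - ζ‖ / r n|) 0
        have m2 := le_max_right (-log |t n - ‖z₀ - ζ‖ / r n|) 0
        have m3 := le_abs_self (log ‖z₀ - ζ‖)
        have m4 := neg_abs_le (log ‖z₀ - ζ‖)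
        rw [abs_le]
        constructor <;> linarith
      refine (ENNReal.ofReal_le_ofReal c1).trans ?_
      rw [ENNReal.ofReal_add (le_max_right _ _) (by positivity), ENNReal.ofReal_mul (by norm_num)]
      refine add_le_add ?_ ?_
      · rcases max_cases (-log |t n - ‖z₀ - ζ‖ / r n|) 0 with h | h
        · rw [h.1]
        · rw [h.1]; simp
      · simp
    calc ∫⁻ ζ in B n, w n ζ ∂μ ≤ ∫⁻ ζ in B n, (kk (t n - ‖z₀ - ζ‖ / r n) + 2 * q ζ) ∂μ := lintegral_mono_ae hpt
      _ = ∫⁻ ζ in B n, kk (t n - ‖z₀ - ζ‖ / r n) ∂μ + 2 * ∫⁻ ζ in B n, q ζ ∂μ := by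
        rw [lintegral_add_left hkm, lintegral_const_mul _ hqm]
      _ ≤ 2 * c0 * μ (B n) + 2 * ∫⁻ ζ in B n, q ζ ∂μ := by
        gcongr; rw [hc0]; exact hgood n
      _ ≤ 2 * c0 * (∫⁻ ζ in B n, q ζ ∂μ) + 2 * ∫⁻ ζ in B n, q ζ ∂μ := by
        gcongr
        rw [← setLIntegral_one]
        refine lintegral_mono fun ζ => ?_
        rw [hq]
        exact ENNReal.one_le_ofReal.2 (by have := abs_nonneg (log ‖z₀ - ζ‖); linarith)
      _ = _ := by ring
  have hsum : Tendsto (fun n => (2 * c0 + 2) * (∫⁻ ζ in B n, q ζ ∂μ) + ∫⁻ ζ in (B n)ᶜ, w n ζ ∂μ) atTop (𝓝 0) := by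
    have hC : 2 * c0 + 2 ≠ ⊤ := ENNReal.add_ne_top.2 ⟨ENNReal.mul_ne_top (by simp) hc0t, by simp⟩
    have := (ENNReal.Tendsto.const_mul hQ (Or.inr hC)).add hT
    simpa using this
  refine tendsto_of_tendsto_of_tendsto_of_le_of_le tendsto_const_nhds hsum (fun _ => zero_le) (fun n => ?_)
  show ∫⁻ ζ, ENNReal.ofReal (|log ‖z n - ζ‖ - log ‖z₀ - ζ‖|) ∂μ ≤ _
  simp only [← hw]
  rw [← lintegral_add_compl _ (hBm n)]
  gcongr
  exact hin n

end Bol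

namespace Bol
open Set Filter Topology
open scoped Manifold ContDiff ENNReal

lemma radii {K : Set ℂ} (hK : IsCompact K) (hR : IsConnected Kᶜ) {z₀ : ℂ} (hz : z₀ ∈ frontier K) :
    ∀ ρ > 0, ρ ≤ 1 → ∃ z ∈ Kᶜ, ‖z - z₀‖ = ρ := by
  intro ρ hρ _
  have h1 : z₀ ∈ closure Kᶜ := (frontier_eq_closure_inter_closure (s := K) ▸ hz).2
  obtain ⟨z₁, hz₁, hd⟩ := Metric.mem_closure_iff.1 h1 ρ hρ
  obtain ⟨D, hD0, hD⟩ := hK.isBounded.exists_pos_norm_le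
  obtain ⟨z₂, hz₂⟩ : ∃ z₂ : ℂ, D + ‖z₀‖ + ρ < ‖z₂‖ := ⟨((D + ‖z₀‖ + ρ + 1 : ℝ) : ℂ), by
    have := norm_nonneg z₀
    rw [Complex.norm_real, Real.norm_eq_abs, abs_of_pos] <;> linarith⟩
  have h2 : z₂ ∈ Kᶜ := fun h => by have := hD z₂ h; have := norm_nonneg z₀; linarith
  have := hR.isPreconnected.intermediate_value hz₁ h2 (f := fun z => ‖z - z₀‖) (by fun_prop)
  have hm : ρ ∈ Icc ‖z₁ - z₀‖ ‖z₂ - z₀‖ := by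
    constructor
    · rw [← dist_eq_norm, dist_comm]; exact hd.le
    · have := norm_sub_norm_le z₂ z₀; linarith
  obtain ⟨z, hzz, h⟩ := this hm
  exact ⟨z, hzz, h⟩

/-- W3 -/
lemma pot_eq_bdry {μ₁ μ₂ : Measure ℂ} [IsFiniteMeasure μ₁] [IsFiniteMeasure μ₂] {K : Set ℂ} (hK : IsCompact K)
    (hR : IsConnected Kᶜ) (h1 : μ₁ Kᶜ = 0) (h2 : μ₂ Kᶜ = 0)
    (hp : ∀ p : Polynomial ℂ, ∫ z, (p.eval z).re ∂μ₁ = ∫ z, (p.eval z).re ∂μ₂) {z₀ : ℂ} (hz : z₀ ∈ frontier K)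
    (a1 : μ₁ {z₀} = 0) (a2 : μ₂ {z₀} = 0) (i1 : Integrable (fun ζ => log ‖z₀ - ζ‖) μ₁)
    (i2 : Integrable (fun ζ => log ‖z₀ - ζ‖) μ₂) :
    ∫ ζ, log ‖z₀ - ζ‖ ∂μ₁ = ∫ ζ, log ‖z₀ - ζ‖ ∂μ₂ := by
  obtain ⟨z, hzR, hlim⟩ := approach (μ := μ₁ + μ₂) (radii hK hR hz) (by simp [a1, a2]) (i1.add_measure i2)
  have key : ∀ μ : Measure ℂ, IsFiniteMeasure μ → μ ≤ μ₁ + μ₂ → μ Kᶜ = 0 → Integrable (fun ζ => log ‖z₀ - ζ‖) μ →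
      Tendsto (fun n => ∫ ζ, log ‖z n - ζ‖ ∂μ) atTop (𝓝 (∫ ζ, log ‖z₀ - ζ‖ ∂μ)) := by
    intro μ hμ hle h0 hi
    refine tendsto_integral_of_L1 _ hi.1 (Eventually.of_forall fun n => integrable_log_off hK h0 (hzR n)) ?_
    refine tendsto_of_tendsto_of_tendsto_of_le_of_le tendsto_const_nhds hlim (fun _ => zero_le) (fun n => ?_)
    simp only [← ofReal_norm_eq_enorm, Real.norm_eq_abs]
    exact lintegral_mono' hle le_rfl
  have e1 := key μ₁ inferInstance (Measure.le_add_right le_rfl) h1 i1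
  have e2 := key μ₂ inferInstance (Measure.le_add_left le_rfl) h2 i2
  have e3 : (fun n => ∫ ζ, log ‖z n - ζ‖ ∂μ₁) = fun n => ∫ ζ, log ‖z n - ζ‖ ∂μ₂ :=
    funext fun n => pot_eq_off hK hR h1 h2 hp (hzR n)
  rw [e3] at e1
  exact tendsto_nhds_unique e1 e2

lemma diam_bound {K : Set ℂ} (hK : IsCompact K) : ∃ M ≥ 1, ∀ x ∈ K, ∀ y ∈ K, ‖x - y‖ ≤ M := by
  obtain ⟨D, hD0, hD⟩ := hK.isBounded.exists_pos_norm_le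
  refine ⟨1 + 2 * D, by linarith, fun x hx y hy => ?_⟩
  have := norm_sub_le x y
  have := hD x hx
  have := hD y hy
  linarith

/-- potential of the balayage -/
lemma balayage_pot {K : Set ℂ} (hK : IsCompact K) (hR : IsConnected Kᶜ) {a : ℂ} (ha : a ∈ interior K)
    {η : Measure ℂ} [IsFiniteMeasure η] (hη : η (frontier K)ᶜ = 0)
    (hp : ∀ p : Polynomial ℂ, ∫ z, (p.eval z).re ∂η = (p.eval a).re) {z₀ : ℂ} (hz : z₀ ∈ frontier K) :
    η {z₀} = 0 ∧ Integrable (fun ζ => log ‖z₀ - ζ‖) η ∧ ∫ ζ, log ‖z₀ - ζ‖ ∂η = log ‖z₀ - a‖ := by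
  have hfK : frontier K ⊆ K := hK.isClosed.frontier_subset
  have hηK : η Kᶜ = 0 := measure_mono_null (compl_subset_compl.2 hfK) hη
  have haK : a ∈ K := interior_subset ha
  have hda : Measure.dirac a Kᶜ = 0 := by
    rw [Measure.dirac_apply' _ hK.measurableSet.compl]; simp [haK]
  have hp' : ∀ p : Polynomial ℂ, ∫ z, (p.eval z).re ∂η = ∫ z, (p.eval z).re ∂(Measure.dirac a) := by
    intro p; rw [hp, integral_dirac]
  have hoff : ∀ z ∉ K, ∫ ζ, log ‖z - ζ‖ ∂η = log ‖z - a‖ := by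
    intro z hz
    rw [pot_eq_off hK hR hηK hda hp' hz, integral_dirac]
  have hne : z₀ ≠ a := by
    rintro rfl; exact hz.2 ha
  have hcl : z₀ ∈ closure Kᶜ := (frontier_eq_closure_inter_closure (s := K) ▸ hz).2
  obtain ⟨z, hzK, hzt⟩ := mem_closure_iff_seq_limit.1 hcl
  obtain ⟨M, hM1, hM⟩ : ∃ M ≥ 1, ∀ n, ∀ ζ ∈ K, ‖z n - ζ‖ ≤ M := by
    obtain ⟨D, hD⟩ := hzt.norm.bddAbove_range
    obtain ⟨D', hD0, hD'⟩ := hK.isBounded.exists_pos_norm_le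
    refine ⟨|D| + D' + 1, by have := abs_nonneg D; linarith, fun n ζ hζ => ?_⟩
    have := norm_sub_le (z n) ζ
    have := hD' ζ hζ
    have := hD ⟨n, rfl⟩
    have := le_abs_self D
    simp only at *
    linarith
  obtain ⟨f, hf⟩ : ∃ f : ℕ → ℂ → ℝ≥0∞, ∀ n ζ, f n ζ = ENNReal.ofReal (log M - log ‖z n - ζ‖) := ⟨_, fun _ _ => rfl⟩
  have hfm : ∀ n, Measurable (f n) := by
    intro n
    have : f n = fun ζ => ENNReal.ofReal (log M - log ‖z n - ζ‖) := funext (hf n)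
    rw [this]; fun_prop
  obtain ⟨k, hk⟩ : ∃ k : ℂ → ℝ≥0∞, ∀ ζ, k ζ = if ζ = z₀ then ⊤ else ENNReal.ofReal (log M - log ‖z₀ - ζ‖) := ⟨_, fun _ => rfl⟩
  have hlim : ∀ ζ, Tendsto (fun n => f n ζ) atTop (𝓝 (k ζ)) := by
    intro ζ
    simp only [hf, hk]
    split_ifs with h
    · subst h
      refine ENNReal.tendsto_ofReal_nhds_top.2 ?_
      have h1 : Tendsto (fun n => ‖z n - ζ‖) atTop (𝓝[≠] 0) := by
        rw [tendsto_nhdsWithin_iff]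
        refine ⟨by simpa using (hzt.sub_const ζ).norm, Eventually.of_forall fun n => ?_⟩
        simp only [mem_compl_iff, mem_singleton_iff, norm_eq_zero, sub_eq_zero]
        intro h; exact hzK n (h ▸ hfK hz)
      have h2 := tendsto_log_nhdsNE_zero.comp h1
      exact tendsto_atTop_add_const_left _ (log M) (tendsto_neg_atBot_atTop.comp h2)
    · refine ENNReal.tendsto_ofReal ?_
      exact (((hzt.sub_const ζ).norm).log (by simpa [sub_eq_zero] using Ne.symm h)).const_sub _
  have hkm : Measurable k := measurable_of_tendsto_metrizable hfm (tendsto_pi_nhds.2 hlim)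
  have hintg : ∀ n, ∫⁻ ζ, f n ζ ∂η = ENNReal.ofReal (log M * η.real univ - log ‖z n - a‖) := by
    intro n
    simp only [hf]
    rw [← ofReal_integral_eq_lintegral_ofReal]
    · rw [integral_sub (integrable_const _) (integrable_log_off hK hηK (hzK n)), hoff _ (hzK n)]
      simp [mul_comm]
    · exact (integrable_const _).sub (integrable_log_off hK hηK (hzK n))
    · filter_upwards [ae_mem_of hηK] with ζ hζ
      have h1 := hM n ζ hζ
      have h0 : 0 < ‖z n - ζ‖ := norm_pos_iff.2 (sub_ne_zero.2 fun h => hzK n (h ▸ hζ))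
      have := log_le_log h0 h1
      simp only [Pi.zero_apply]; linarith
  have hfin : ∫⁻ ζ, k ζ ∂η ≠ ⊤ := by
    have h1 : ∫⁻ ζ, k ζ ∂η ≤ liminf (fun n => ∫⁻ ζ, f n ζ ∂η) atTop := by
      refine le_trans (le_of_eq ?_) (lintegral_liminf_le hfm)
      exact lintegral_congr fun ζ => (hlim ζ).liminf_eq.symm
    have h2 : Tendsto (fun n => ∫⁻ ζ, f n ζ ∂η) atTop (𝓝 (ENNReal.ofReal (log M * η.real univ - log ‖z₀ - a‖))) := by
      simp only [hintg]
      exact ENNReal.tendsto_ofReal ((((hzt.sub_const a).norm).log (by simpa [sub_eq_zero] using hne)).const_sub _)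
    rw [h2.liminf_eq] at h1
    exact (h1.trans_lt ENNReal.ofReal_lt_top).ne
  have hae : ∀ᵐ ζ ∂η, ζ ≠ z₀ := by
    filter_upwards [ae_lt_top hkm hfin] with ζ h1 h2
    rw [hk, if_pos h2] at h1; exact lt_irrefl _ h1
  have h0 : η {z₀} = 0 := by
    rw [ae_iff] at hae; simpa using hae
  have hInt : Integrable (fun ζ => log ‖z₀ - ζ‖) η := by
    obtain ⟨M', hM1', hM'⟩ := diam_bound hK
    have h1 : Integrable (fun ζ => (k ζ).toReal) η := integrable_toReal_of_lintegral_ne_top hkm.aemeasurable hfin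
    refine (h1.add (integrable_const (log M + 2 * log M'))).mono' (Measurable.aestronglyMeasurable (by fun_prop)) ?_
    filter_upwards [hae, ae_mem_of hηK] with ζ hζ hζK
    have hpos : 0 < ‖z₀ - ζ‖ := norm_pos_iff.2 (sub_ne_zero.2 hζ.symm)
    have a1 := log_le_log hpos (hM' z₀ (hfK hz) ζ hζK)
    have a2 := log_nonneg hM1
    have a3 := log_nonneg hM1'
    have a4 := le_max_left (log M - log ‖z₀ - ζ‖) 0
    simp only [Pi.add_apply, hk, if_neg hζ, ENNReal.toReal_ofReal', Real.norm_eq_abs]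
    rw [abs_le]
    have a5 := le_max_right (log M - log ‖z₀ - ζ‖) 0
    constructor <;> linarith
  refine ⟨h0, hInt, ?_⟩
  rw [pot_eq_bdry hK hR hηK hda hp' hz h0 ?_ hInt ?_, integral_dirac]
  · rw [Measure.dirac_apply' _ (measurableSet_singleton _)]; simp [hne.symm]
  · exact integrable_dirac (by simp)

lemma log_abs_bound {x M : ℝ} (hx : 0 < x) (hM : 1 ≤ M) (h : x ≤ M) : |log x| ≤ 2 * log M - log x := by
  have := log_le_log hx h
  have := log_nonneg hM
  rw [abs_le]; constructor <;> linarith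

/-- W4 -/
lemma pot_eq_int {μ₁ μ₂ : Measure ℂ} [IsFiniteMeasure μ₁] [IsFiniteMeasure μ₂] {K : Set ℂ} (hK : IsCompact K)
    (hR : IsConnected Kᶜ) (h1 : μ₁ (frontier K)ᶜ = 0) (h2 : μ₂ (frontier K)ᶜ = 0)
    (hp : ∀ p : Polynomial ℂ, ∫ z, (p.eval z).re ∂μ₁ = ∫ z, (p.eval z).re ∂μ₂) {a : ℂ} (ha : a ∈ interior K) :
    ∫ ζ, log ‖a - ζ‖ ∂μ₁ = ∫ ζ, log ‖a - ζ‖ ∂μ₂ := by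
  have hfK : frontier K ⊆ K := hK.isClosed.frontier_subset
  obtain ⟨η, hηf, hη, hηp⟩ := balayage hK (interior_subset ha)
  have hb := fun {z₀ : ℂ} (hz : z₀ ∈ frontier K) => balayage_pot hK hR ha hη hηp hz
  have hηK : η Kᶜ = 0 := measure_mono_null (compl_subset_compl.2 hfK) hη
  obtain ⟨M, hM1, hM⟩ := diam_bound hK
  obtain ⟨r, hr, hball⟩ := Metric.isOpen_iff.1 isOpen_interior a ha
  have hfar : ∀ ζ ∈ frontier K, r ≤ ‖ζ - a‖ := by
    intro ζ hζ
    by_contra hh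
    exact hζ.2 (hball (mem_ball_iff_norm.2 (not_le.1 hh)))
  have key : ∀ μ : Measure ℂ, IsFiniteMeasure μ → μ (frontier K)ᶜ = 0 →
      (∀ᵐ ζ' ∂η, μ {ζ'} = 0 ∧ Integrable (fun ζ => log ‖ζ' - ζ‖) μ) ∧
      ∫ ζ, log ‖a - ζ‖ ∂μ = ∫ ζ', ∫ ζ, log ‖ζ' - ζ‖ ∂μ ∂η := by
    intro μ hμf hμ
    have hm : AEStronglyMeasurable (fun p : ℂ × ℂ => log ‖p.1 - p.2‖) (μ.prod η) :=
      Measurable.aestronglyMeasurable (by fun_prop)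
    have hI : Integrable (fun p : ℂ × ℂ => log ‖p.1 - p.2‖) (μ.prod η) := by
      rw [integrable_prod_iff hm]
      refine ⟨?_, ?_⟩
      · filter_upwards [ae_mem_of hμ] with ζ hζ
        exact (hb hζ).2.1
      · refine Integrable.of_bound (C := 2 * log M * η.real univ - log r) hm.norm.integral_prod_right' ?_
        filter_upwards [ae_mem_of hμ] with ζ hζ
        rw [Real.norm_of_nonneg (integral_nonneg fun _ => norm_nonneg _)]
        have e1 : ∫ ζ', ‖log ‖ζ - ζ'‖‖ ∂η ≤ ∫ ζ', (2 * log M - log ‖ζ - ζ'‖) ∂η := by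
          refine integral_mono_ae (hb hζ).2.1.norm ((integrable_const _).sub (hb hζ).2.1) ?_
          have hae : ∀ᵐ ζ' ∂η, ζ' ≠ ζ := by rw [ae_iff]; simpa using (hb hζ).1
          filter_upwards [ae_mem_of hηK, hae] with ζ' hζ' hne
          exact log_abs_bound (norm_pos_iff.2 (sub_ne_zero.2 hne.symm)) hM1 (hM _ (hfK hζ) _ hζ')
        refine e1.trans ?_
        rw [integral_sub (integrable_const _) (hb hζ).2.1, (hb hζ).2.2]
        have := log_le_log hr (hfar ζ hζ)
        simp [mul_comm]
        linarith
    have hdiag : ∀ᵐ p ∂(μ.prod η), p.1 ≠ p.2 := by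
      have hms : MeasurableSet {p : ℂ × ℂ | p.1 ≠ p.2} := (measurableSet_eq_fun measurable_fst measurable_snd).compl
      rw [Measure.ae_prod_iff_ae_ae hms]
      filter_upwards [ae_mem_of hμ] with ζ hζ
      rw [ae_iff]
      have := (hb hζ).1
      simpa using this
    have hIs := hI.swap
    have hds : ∀ᵐ p ∂(η.prod μ), p.2 ≠ p.1 := by
      have := (Measure.measurePreserving_swap (μ := η) (ν := μ)).quasiMeasurePreserving.ae hdiag
      exact this
    refine ⟨?_, ?_⟩
    · filter_upwards [hIs.prod_right_ae, Measure.ae_ae_of_ae_prod hds] with ζ' q1 q2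
      refine ⟨?_, ?_⟩
      · rw [ae_iff] at q2; simpa using q2
      · refine q1.congr (ae_of_all _ fun ζ => ?_)
        simp only [Function.comp, Prod.swap]
        rw [norm_sub_rev]
    · calc ∫ ζ, log ‖a - ζ‖ ∂μ = ∫ ζ, ∫ ζ', log ‖ζ - ζ'‖ ∂η ∂μ := by
            refine integral_congr_ae ?_
            filter_upwards [ae_mem_of hμ] with ζ hζ
            rw [(hb hζ).2.2, norm_sub_rev]
        _ = ∫ ζ', ∫ ζ, log ‖ζ - ζ'‖ ∂μ ∂η := integral_integral_swap hI
        _ = _ := by simp only [norm_sub_rev]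
  obtain ⟨a1, b1⟩ := key μ₁ inferInstance h1
  obtain ⟨a2, b2⟩ := key μ₂ inferInstance h2
  rw [b1, b2]
  refine integral_congr_ae ?_
  filter_upwards [a1, a2, ae_mem_of hη] with ζ' c1 c2 c3
  exact pot_eq_bdry hK hR (measure_mono_null (compl_subset_compl.2 hfK) h1)
    (measure_mono_null (compl_subset_compl.2 hfK) h2) hp c3 c1.1 c2.1 c1.2 c2.2

end Bol

namespace Bol
open Set Filter Topology
open scoped Manifold ContDiff ENNReal

lemma abs_log_int_bound {T : Set ℂ} (hT : IsCompact T) {K : Set ℂ} (hK : IsCompact K) :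
    ∃ C, ∀ w ∈ K, IntegrableOn (fun y => log ‖y - w‖) T ∧ ∫ y in T, |log ‖y - w‖| ≤ C := by
  obtain ⟨M, hM1, hM⟩ := diam_bound (hT.union hK)
  have hv : volume T ≠ ⊤ := hT.measure_lt_top.ne
  refine ⟨(volume T + ENNReal.ofReal (2 * π)).toReal + M * volume.real T, fun w hw => ?_⟩
  have hi : IntegrableOn (fun y => ‖w - y‖⁻¹) T := integrableOn_norm_inv hT.measurableSet hv w
  have hi2 : IntegrableOn (fun y => ‖w - y‖⁻¹ + M) T := hi.add (integrableOn_const hv)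
  have hb : ∀ y ∈ T, |log ‖y - w‖| ≤ ‖w - y‖⁻¹ + M := by
    intro y hy
    refine (abs_log_le (norm_nonneg _)).trans ?_
    rw [norm_sub_rev w y]
    have := hM y (Or.inl hy) w (Or.inr hw)
    linarith
  have hl : IntegrableOn (fun y => log ‖y - w‖) T := by
    refine Integrable.mono' hi2 (Measurable.aestronglyMeasurable (by fun_prop)) ?_
    filter_upwards [ae_restrict_mem hT.measurableSet] with y hy
    exact hb y hy
  refine ⟨hl, ?_⟩
  calc ∫ y in T, |log ‖y - w‖| ≤ ∫ y in T, (‖w - y‖⁻¹ + M) :=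
        setIntegral_mono_on hl.abs hi2 hT.measurableSet hb
    _ = (∫ y in T, ‖w - y‖⁻¹) + M * volume.real T := by
        rw [integral_add hi (integrableOn_const hv)]
        simp [mul_comm]
    _ ≤ _ := by
        gcongr
        rw [integral_eq_lintegral_of_nonneg_ae (ae_of_all _ fun _ => by positivity)
          (Measurable.aestronglyMeasurable (by fun_prop))]
        refine ENNReal.toReal_mono (ENNReal.add_ne_top.2 ⟨hv, ENNReal.ofReal_ne_top⟩) (lint_norm_inv T hT.measurableSet w)

lemma green_pot {g : ℂ → ℝ} (hg : ContDiff ℝ 2 g) (hc : HasCompactSupport g) {K : Set ℂ} (hK : IsCompact K)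
    {μ : Measure ℂ} [IsFiniteMeasure μ] (hμ : μ Kᶜ = 0) :
    2 * π * ∫ w, g w ∂μ = ∫ y, lap g y * ∫ w, log ‖y - w‖ ∂μ ∧
    ∀ᵐ y : ℂ, μ {y} = 0 ∧ (lap g y ≠ 0 → Integrable (fun w => log ‖y - w‖) μ) := by
  have hlc : Continuous (lap g) := continuous_lap hg
  have hls : HasCompactSupport (lap g) := lap_compact hc
  have hTc : IsCompact (tsupport (lap g)) := hls
  obtain ⟨C, hC⟩ := hls.exists_bound_of_continuous hlc
  obtain ⟨D, hD⟩ := abs_log_int_bound hTc hK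
  have hm : AEStronglyMeasurable (fun p : ℂ × ℂ => lap g p.2 * log ‖p.2 - p.1‖) (μ.prod volume) := by
    have := hlc.measurable
    exact Measurable.aestronglyMeasurable (by fun_prop)
  have hI : Integrable (fun p : ℂ × ℂ => lap g p.2 * log ‖p.2 - p.1‖) (μ.prod volume) := by
    rw [integrable_prod_iff hm]
    refine ⟨ae_of_all _ fun w => integrable_mul_log hlc hls w, ?_⟩
    refine Integrable.of_bound (C := C * D) hm.norm.integral_prod_right' ?_
    filter_upwards [ae_mem_of hμ] with w hw
    rw [Real.norm_of_nonneg (integral_nonneg fun _ => norm_nonneg _)]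
    have hC0 : 0 ≤ C := (norm_nonneg _).trans (hC 0)
    have e1 : ∫ y, ‖lap g y * log ‖y - w‖‖ = ∫ y in tsupport (lap g), ‖lap g y * log ‖y - w‖‖ := by
      rw [setIntegral_eq_integral_of_forall_compl_eq_zero]
      intro y hy
      simp [image_eq_zero_of_notMem_tsupport hy]
    rw [e1]
    calc ∫ y in tsupport (lap g), ‖lap g y * log ‖y - w‖‖ ≤ ∫ y in tsupport (lap g), C * |log ‖y - w‖| := by
          refine integral_mono (integrable_mul_log hlc hls w).norm.integrableOn ((hD w hw).1.abs.const_mul C) ?_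
          intro y
          simp only [norm_mul, Real.norm_eq_abs]
          gcongr
          exact hC y
      _ = C * ∫ y in tsupport (lap g), |log ‖y - w‖| := integral_const_mul _ _
      _ ≤ C * D := by gcongr; exact (hD w hw).2
  refine ⟨?_, ?_⟩
  · calc 2 * π * ∫ w, g w ∂μ = ∫ w, (∫ y, lap g y * log ‖y - w‖) ∂μ := by
          rw [← integral_const_mul]
          exact integral_congr_ae (ae_of_all _ fun w => (log_rep hg hc w).symm)
      _ = ∫ y, ∫ w, lap g y * log ‖y - w‖ ∂μ := integral_integral_swap hI
      _ = _ := by simp only [integral_const_mul]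
  · have hdiag : ∀ᵐ p ∂(μ.prod (volume : Measure ℂ)), p.1 ≠ p.2 := by
      have hms : MeasurableSet {p : ℂ × ℂ | p.1 ≠ p.2} := (measurableSet_eq_fun measurable_fst measurable_snd).compl
      rw [Measure.ae_prod_iff_ae_ae hms]
      refine ae_of_all _ fun ζ => ?_
      rw [ae_iff]
      simp
    have hds : ∀ᵐ p ∂((volume : Measure ℂ).prod μ), p.2 ≠ p.1 := by
      have := (Measure.measurePreserving_swap (μ := (volume : Measure ℂ)) (ν := μ)).quasiMeasurePreserving.ae hdiag
      exact this
    filter_upwards [hI.swap.prod_right_ae, Measure.ae_ae_of_ae_prod hds] with y q1 q2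
    refine ⟨?_, fun h => ?_⟩
    · rw [ae_iff] at q2; simpa using q2
    · simp only [Function.comp, Prod.swap] at q1
      exact (integrable_const_mul_iff (isUnit_iff_ne_zero.2 h) _).1 q1

/-- Walsh-Lebesgue theorem for smooth functions -/
theorem WL {K : Set ℂ} (hK : IsCompact K) (hR : IsConnected Kᶜ) {g : ℂ → ℝ} (hg : ContDiff ℝ 2 g)
    (hc : HasCompactSupport g) {ε : ℝ} (hε : 0 < ε) :
    ∃ P : Polynomial ℂ, ∀ z ∈ frontier K, |(P.eval z).re - g z| ≤ ε := by
  by_contra! hcon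
  have hfK : frontier K ⊆ K := hK.isClosed.frontier_subset
  have hF : IsCompact (frontier K) := hK.of_isClosed_subset isClosed_frontier hfK
  obtain ⟨μ₁, μ₂, f1, f2, h1, h2, hp, hne⟩ := duality hF hg.continuous hε hcon
  have k1 : μ₁ Kᶜ = 0 := measure_mono_null (compl_subset_compl.2 hfK) h1
  have k2 : μ₂ Kᶜ = 0 := measure_mono_null (compl_subset_compl.2 hfK) h2
  obtain ⟨e1, a1⟩ := green_pot hg hc hK k1
  obtain ⟨e2, a2⟩ := green_pot hg hc hK k2
  apply hne
  have : 2 * π * ∫ w, g w ∂μ₁ = 2 * π * ∫ w, g w ∂μ₂ := by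
    rw [e1, e2]
    refine integral_congr_ae ?_
    filter_upwards [a1, a2] with y b1 b2
    by_cases h0 : lap g y = 0
    · simp [h0]
    congr 1
    by_cases hy : y ∈ K
    · by_cases hyi : y ∈ interior K
      · exact pot_eq_int hK hR h1 h2 hp hyi
      · exact pot_eq_bdry hK hR k1 k2 hp ⟨subset_closure hy, hyi⟩ b1.1 b2.1 (b1.2 h0) (b2.2 h0)
    · exact pot_eq_off hK hR k1 k2 hp hy
  exact mul_left_cancel₀ (by positivity) this

end Bol

namespace Bol
open Set Filter Topology
open scoped Manifold ContDiff ENNReal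

set_option maxHeartbeats 400000 in
/-- one-dimensional part of the Bol inequality -/
lemma phi_nonneg {m μ : ℝ → ℝ} {a₀ A : ℝ} (hA : a₀ < A) (hm0 : ∀ a, 0 ≤ m a) (hμ0 : ∀ a, 0 ≤ μ a)
    (hmA : m A = 0) (hμA : μ A = 0) (hm : Antitone m) (hμ : Antitone μ)
    (h1 : ∀ a b, a₀ ≤ a → a < b → 4 * π * μ b * (b - a) ≤ m a * (μ a - μ b))
    (h2 : ∀ a b, a₀ ≤ a → a < b → exp a * (μ a - μ b) ≤ m a - m b)
    (h3 : ∀ a b, a₀ ≤ a → a < b → m a - m b ≤ exp b * (μ a - μ b)) :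
    0 ≤ m a₀ ^ 2 / 2 - 4 * π * m a₀ + 4 * π * exp a₀ * μ a₀ := by
  obtain ⟨Φ, hΦ⟩ : ∃ Φ : ℝ → ℝ, ∀ a, Φ a = m a ^ 2 / 2 - 4 * π * m a + 4 * π * exp a * μ a := ⟨_, fun _ => rfl⟩
  have hπ := pi_pos
  obtain ⟨M, hM⟩ : ∃ M, M = m a₀ := ⟨_, rfl⟩
  have hM0 : 0 ≤ M := hM ▸ hm0 _
  obtain ⟨C, hC⟩ : ∃ C, C = 2 * M + 4 * π := ⟨_, rfl⟩
  obtain ⟨C', hC'⟩ : ∃ C', C' = exp A * (4 * π * μ a₀) := ⟨_, rfl⟩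
  have hC'0 : 0 ≤ C' := by rw [hC']; have := hμ0 a₀; positivity
  have hC0 : 0 < C := by rw [hC]; positivity
  have step : ∀ a b, a₀ ≤ a → a < b → b ≤ A → b - a ≤ 1 →
      - ((m a - m b) * (C * (b - a) + (m a - m b) / 2)) ≤ Φ a - Φ b ∧
      (m a - m b) ^ 2 / 2 - C' * (b - a) - C * (b - a) * M ≤ Φ a - Φ b := by
    intro a b ha hab hb ht
    have k1 := h1 a b ha hab
    have k2 := h2 a b ha hab
    have k3 := h3 a b ha hab
    have d1 := hm hab.le
    have d2 := hμ hab.le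
    have hmaM : m a ≤ M := hM ▸ hm ha
    have hmbM : m b ≤ M := d1.trans hmaM
    obtain ⟨t, ht'⟩ : ∃ t, t = b - a := ⟨_, rfl⟩
    have hbe : b = a + t := by linarith
    have ht0 : 0 < t := by linarith
    rw [← ht'] at ht k1 ⊢
    -- exp estimates
    have e1 : exp t ≤ 1 + 2 * t := by
      have := Real.abs_exp_sub_one_le (x := t) (by rw [abs_of_pos ht0]; exact ht)
      rw [abs_of_pos ht0] at this
      have := le_abs_self (exp t - 1)
      linarith
    have e2 : 1 - t ≤ exp (-t) := by have := add_one_le_exp (-t); linarith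
    have e3 : exp b - exp a ≤ exp b * t := by
      have : exp a = exp b * exp (-t) := by rw [← exp_add]; congr 1; linarith
      rw [this]; nlinarith [exp_pos b]
    have e4 : exp b = exp a * exp t := by rw [← exp_add, hbe]
    obtain ⟨Δ, hΔ⟩ : ∃ Δ, Δ = m a - m b := ⟨_, rfl⟩
    obtain ⟨δ, hδ⟩ : ∃ δ, δ = μ a - μ b := ⟨_, rfl⟩
    rw [← hΔ] at k2 k3 ⊢
    rw [← hδ] at k1 k2 k3
    have hΔ0 : 0 ≤ Δ := by linarith
    have hδ0 : 0 ≤ δ := by linarith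
    have hΔM : Δ ≤ m a := by have := hm0 b; linarith
    have q1 : (1 - t) * Δ ≤ exp a * δ := by
      have : exp (-t) * Δ ≤ exp a * δ := by
        calc exp (-t) * Δ ≤ exp (-t) * (exp b * δ) := by gcongr
          _ = exp a * δ := by rw [← mul_assoc, ← exp_add, hbe]; congr 2; ring
      nlinarith
    have hX : Φ a - Φ b = Δ * (m a - Δ / 2) - 4 * π * Δ + 4 * π * (exp a * δ) - 4 * π * μ b * (exp b - exp a) := by
      rw [hΦ, hΦ, hΔ, hδ]; ring
    have hμb := hμ0 b
    have q2 : 4 * π * μ b * (exp b - exp a) ≤ m a * ((1 + 2 * t) * Δ) := by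
      calc 4 * π * μ b * (exp b - exp a) ≤ 4 * π * μ b * (exp b * t) := by gcongr
        _ = exp b * (4 * π * μ b * t) := by ring
        _ ≤ exp b * (m a * δ) := by gcongr
        _ = m a * (exp t * (exp a * δ)) := by rw [e4]; ring
        _ ≤ m a * ((1 + 2 * t) * Δ) := by
          have := hm0 a
          gcongr
    have q3 : 4 * π * μ b * (exp b - exp a) ≤ C' * t := by
      calc 4 * π * μ b * (exp b - exp a) ≤ 4 * π * μ a₀ * (exp A * t) := by
            have := hμ (ha.trans hab.le)
            have h4 : exp b ≤ exp A := exp_le_exp.2 hb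
            have h5 : exp b - exp a ≤ exp A * t := e3.trans (by gcongr)
            have h6 : 0 ≤ exp b - exp a := by have := exp_le_exp.2 hab.le; linarith
            have h7 := hμ0 a₀
            gcongr
        _ = C' * t := by rw [hC']; ring
    rw [hX]
    have q4 : 4 * π * ((1 - t) * Δ) ≤ 4 * π * (exp a * δ) := by gcongr
    constructor
    · have : m a * (t * Δ) ≤ M * (t * Δ) := by gcongr
      rw [hC]; nlinarith
    · have : 4 * π * (t * Δ) ≤ 4 * π * (t * M) := by
        have : Δ ≤ M := hΔM.trans hmaM
        gcongr
      have z1 : 0 ≤ M * (t * M) := by positivity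
      have z2 : Δ * Δ ≤ Δ * m a := by gcongr
      rw [hC]; nlinarith
  have hmain : ∀ κ > 0, 0 ≤ Φ a₀ + κ * m a₀ := by
    intro κ hκ
    obtain ⟨τ₀, hτ0, hτ1, hτ2, hτ3⟩ : ∃ τ₀ > 0, τ₀ ≤ 1 ∧ C * τ₀ ≤ κ / 2 ∧ (C' + C * M) * τ₀ ≤ κ ^ 2 / 2 := by
      refine ⟨min 1 (min (κ / 2 / C) (κ ^ 2 / 2 / (C' + C * M + 1))), by positivity, min_le_left _ _, ?_, ?_⟩
      · have : min 1 (min (κ / 2 / C) (κ ^ 2 / 2 / (C' + C * M + 1))) ≤ κ / 2 / C :=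
          (min_le_right _ _).trans (min_le_left _ _)
        calc _ ≤ C * (κ / 2 / C) := by gcongr
          _ = κ / 2 := by field_simp
      · have : min 1 (min (κ / 2 / C) (κ ^ 2 / 2 / (C' + C * M + 1))) ≤ κ ^ 2 / 2 / (C' + C * M + 1) :=
          (min_le_right _ _).trans (min_le_right _ _)
        calc _ ≤ (C' + C * M + 1) * (κ ^ 2 / 2 / (C' + C * M + 1)) :=
              mul_le_mul (by linarith) this (by positivity) (by positivity)
          _ = κ ^ 2 / 2 := by field_simp
    have st : ∀ a b, a₀ ≤ a → a < b → b ≤ A → b - a ≤ τ₀ → Φ b + κ * m b ≤ Φ a + κ * m a := by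
      intro a b ha hab hb hτ
      obtain ⟨s1, s2⟩ := step a b ha hab hb (hτ.trans hτ1)
      have d1 := hm hab.le
      have w1 : C * (b - a) ≤ κ / 2 := le_trans (by gcongr) hτ2
      have w2 : (C' + C * M) * (b - a) ≤ κ ^ 2 / 2 := le_trans (by gcongr) hτ3
      by_cases hh : m a - m b ≤ κ
      · have w3 := mul_le_mul_of_nonneg_left (show C * (b - a) + (m a - m b) / 2 ≤ κ by linarith) (sub_nonneg.2 d1)
        linarith
      · push Not at hh
        have w3 : κ ^ 2 ≤ (m a - m b) ^ 2 := by gcongr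
        have w4 : 0 ≤ κ * (m a - m b) := mul_nonneg hκ.le (sub_nonneg.2 d1)
        linarith
    obtain ⟨n, hn⟩ := exists_nat_gt ((A - a₀) / τ₀)
    have hn0 : (0:ℝ) < n := lt_of_le_of_lt (by have : 0 < A - a₀ := by linarith
                                               positivity) hn
    obtain ⟨τ, hτ⟩ : ∃ τ, τ = (A - a₀) / n := ⟨_, rfl⟩
    have hτpos : 0 < τ := by rw [hτ]; have : 0 < A - a₀ := by linarith
                             positivity
    have hττ : τ ≤ τ₀ := by
      rw [hτ, div_le_iff₀ hn0]
      rw [div_lt_iff₀ hτ0] at hn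
      linarith
    have hnτ : n * τ = A - a₀ := by rw [hτ]; field_simp
    have ind : ∀ i : ℕ, i ≤ n → Φ (a₀ + i * τ) + κ * m (a₀ + i * τ) ≤ Φ a₀ + κ * m a₀ := by
      intro i
      induction i with
      | zero => intro; simp
      | succ k ih =>
        intro hk
        refine le_trans ?_ (ih (by omega))
        have hk' : ((k + 1 : ℕ) : ℝ) ≤ n := by exact_mod_cast hk
        have : ((k + 1 : ℕ) : ℝ) * τ ≤ n * τ := by gcongr
        push_cast at this ⊢
        refine st _ _ ?_ ?_ ?_ ?_
        · have : 0 ≤ (k:ℝ) * τ := by positivity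
          linarith
        · nlinarith
        · linarith
        · nlinarith
    have := ind n le_rfl
    rw [hnτ] at this
    have e : a₀ + (A - a₀) = A := by ring
    rw [e, hmA, hΦ A, hmA, hμA] at this
    simpa using this
  rw [← hΦ]
  refine le_of_forall_pos_le_add fun κ hκ => ?_
  have h4 : 0 < κ / (M + 1) := by positivity
  have h5 := hmain _ h4
  have : κ / (M + 1) * m a₀ ≤ κ := by
    rw [← hM, div_mul_eq_mul_div, div_le_iff₀ (by positivity)]; nlinarith
  linarith

/-- smooth clamp -/
lemma clamp {a b η : ℝ} (hab : a < b) (hη : 0 < η) : ∃ χ : ℝ → ℝ, ContDiff ℝ 1 χ ∧ (∀ x ≤ a, χ x = 0) ∧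
    (∀ x, b ≤ x → χ x = 1) ∧ (∀ x, 0 ≤ deriv χ x) ∧ (∀ x, deriv χ x ≤ (1 + η) / (b - a)) ∧
    (∀ x, x ≤ a ∨ b ≤ x → deriv χ x = 0) ∧ (∀ x, 0 ≤ χ x) ∧ (∀ x, χ x ≤ 1) := by
  -- lengths
  have hba : 0 < b - a := by linarith
  obtain ⟨s, hs⟩ : ∃ s, s = η / (1 + η) * (b - a) / 2 := ⟨_, rfl⟩
  have hs0 : 0 < s := by rw [hs]; positivity
  obtain ⟨ρ, hρ⟩ : ∃ ρ : ℝ → ℝ, ∀ t, ρ t = max 0 (min 1 (min ((t - a) / s) ((b - t) / s))) := ⟨_, fun _ => rfl⟩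
  have hρc : Continuous ρ := by
    have : ρ = fun t => max 0 (min 1 (min ((t - a) / s) ((b - t) / s))) := funext hρ
    rw [this]; fun_prop
  have hρ0 : ∀ t, 0 ≤ ρ t := fun t => by rw [hρ]; exact le_max_left _ _
  have hρ1 : ∀ t, ρ t ≤ 1 := fun t => by
    rw [hρ]; exact max_le zero_le_one (min_le_left _ _)
  have hρa : ∀ t, t ≤ a ∨ b ≤ t → ρ t = 0 := by
    intro t ht
    rw [hρ, max_eq_left]
    rcases ht with h | h
    · exact (min_le_right _ _).trans ((min_le_left _ _).trans (div_nonpos_of_nonpos_of_nonneg (by linarith) hs0.le))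
    · exact (min_le_right _ _).trans ((min_le_right _ _).trans (div_nonpos_of_nonpos_of_nonneg (by linarith) hs0.le))
  have hρm : ∀ t, a + s ≤ t → t ≤ b - s → ρ t = 1 := by
    intro t h1 h2
    rw [hρ, min_eq_left, max_eq_right zero_le_one]
    refine le_min ?_ ?_ <;> rw [le_div_iff₀ hs0] <;> linarith
  have hI : ∀ u w, IntervalIntegrable ρ volume u w := fun u w => hρc.intervalIntegrable u w
  obtain ⟨T, hT⟩ : ∃ T, T = ∫ t in a..b, ρ t := ⟨_, rfl⟩
  have h2s : 2 * s = η / (1 + η) * (b - a) := by rw [hs]; ring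
  have h3s : b - a - 2 * s = (b - a) / (1 + η) := by rw [h2s]; field_simp; ring
  have hTl : (b - a) / (1 + η) ≤ T := by
    have hpos : 0 < (b - a) / (1 + η) := by positivity
    have e1 : T = (∫ t in a..(a+s), ρ t) + (∫ t in (a+s)..(b-s), ρ t) + ∫ t in (b-s)..b, ρ t := by
      rw [intervalIntegral.integral_add_adjacent_intervals (hI _ _) (hI _ _),
        intervalIntegral.integral_add_adjacent_intervals (hI _ _) (hI _ _), hT]
    have e2 : ∫ t in (a+s)..(b-s), ρ t = b - a - 2 * s := by
      have : ∫ t in (a+s)..(b-s), ρ t = ∫ t in (a+s)..(b-s), (1:ℝ) := by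
        refine intervalIntegral.integral_congr fun t ht => ?_
        rw [uIcc_of_le (by linarith)] at ht
        exact hρm t ht.1 ht.2
      rw [this]; simp; ring
    have e3 : 0 ≤ ∫ t in a..(a+s), ρ t := intervalIntegral.integral_nonneg (by linarith) fun t _ => hρ0 t
    have e4 : 0 ≤ ∫ t in (b-s)..b, ρ t := intervalIntegral.integral_nonneg (by linarith) fun t _ => hρ0 t
    rw [e1, e2, ← h3s]; linarith
  have hT0 : 0 < T := lt_of_lt_of_le (by positivity) hTl
  obtain ⟨χ, hχ⟩ : ∃ χ : ℝ → ℝ, ∀ x, χ x = (∫ t in a..x, ρ t) / T := ⟨_, fun _ => rfl⟩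
  have hd : ∀ x, HasDerivAt χ (ρ x / T) x := by
    intro x
    have : χ = fun x => (∫ t in a..x, ρ t) / T := funext hχ
    rw [this]
    exact (intervalIntegral.integral_hasDerivAt_right (hI _ _) hρc.stronglyMeasurable.stronglyMeasurableAtFilter hρc.continuousAt).div_const T
  have hdd : deriv χ = fun x => ρ x / T := funext fun x => (hd x).deriv
  have hle : ∀ x ≤ a, χ x = 0 := by
    intro x hx
    have : ∫ t in a..x, ρ t = ∫ t in a..x, (0:ℝ) := by
      refine intervalIntegral.integral_congr fun t ht => ?_
      rw [uIcc_of_ge hx] at ht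
      exact hρa t (Or.inl ht.2)
    rw [hχ, this]; simp
  have hge : ∀ x, b ≤ x → χ x = 1 := by
    intro x hx
    have : ∫ t in b..x, ρ t = ∫ t in b..x, (0:ℝ) := by
      refine intervalIntegral.integral_congr fun t ht => ?_
      rw [uIcc_of_le hx] at ht
      exact hρa t (Or.inr ht.1)
    rw [hχ, ← intervalIntegral.integral_add_adjacent_intervals (hI a b) (hI b x), this, ← hT]
    simp [hT0.ne']
  have hmono : Monotone χ := monotone_of_deriv_nonneg (fun x => (hd x).differentiableAt) (fun x => by
    rw [hdd]; exact div_nonneg (hρ0 x) hT0.le)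
  refine ⟨χ, ?_, hle, hge, ?_, ?_, ?_, ?_, ?_⟩
  · rw [contDiff_one_iff_deriv]
    exact ⟨fun x => (hd x).differentiableAt, by rw [hdd]; fun_prop⟩
  · intro x; rw [hdd]; exact div_nonneg (hρ0 x) hT0.le
  · intro x; rw [hdd]
    simp only
    rw [div_le_div_iff₀ hT0 hba]
    rw [div_le_iff₀ (by positivity)] at hTl
    have := hρ1 x
    nlinarith
  · intro x hx; rw [hdd]; simp [hρa x hx]
  · intro x
    rcases le_total x a with h | h
    · rw [hle x h]
    · have := hmono h; rw [hle a le_rfl] at this; exact this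
  · intro x
    rcases le_total b x with h | h
    · rw [hge x h]
    · have := hmono h; rw [hge b le_rfl] at this; exact this

end Bol

namespace Bol
open Set Filter Topology
open scoped Manifold ContDiff ENNReal

lemma contDiff_of_cover {n : WithTop ℕ∞} {F : ℂ → ℝ} {A B : Set ℂ} (hA : IsOpen A) (hB : IsOpen B) (hAB : ∀ x, x ∈ A ∨ x ∈ B)
    (h1 : ContDiffOn ℝ n F A) (h2 : ContDiffOn ℝ n F B) : ContDiff ℝ n F := by
  rw [contDiff_iff_contDiffAt]
  intro x
  rcases hAB x with h | h
  · exact h1.contDiffAt (hA.mem_nhds h)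
  · exact h2.contDiffAt (hB.mem_nhds h)

lemma cs {α : Type*} [MeasurableSpace α] {μ : Measure α} {w f g : α → ℝ} (hw : ∀ x, 0 ≤ w x)
    (h1 : Integrable (fun x => w x * f x ^ 2) μ) (h2 : Integrable (fun x => w x * g x ^ 2) μ)
    (h3 : Integrable (fun x => w x * (f x * g x)) μ) :
    (∫ x, w x * (f x * g x) ∂μ) ^ 2 ≤ (∫ x, w x * f x ^ 2 ∂μ) * ∫ x, w x * g x ^ 2 ∂μ := by
  have key : ∀ l : ℝ, 0 ≤ (∫ x, w x * f x ^ 2 ∂μ) * (l * l) + (-2 * ∫ x, w x * (f x * g x) ∂μ) * l + ∫ x, w x * g x ^ 2 ∂μ := by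
    intro l
    have e : ∫ x, w x * (l * f x - g x) ^ 2 ∂μ = (∫ x, w x * f x ^ 2 ∂μ) * (l * l) + (-2 * ∫ x, w x * (f x * g x) ∂μ) * l + ∫ x, w x * g x ^ 2 ∂μ := by
      have : (fun x => w x * (l * f x - g x) ^ 2) = fun x => ((l * l) * (w x * f x ^ 2) + (-2 * l) * (w x * (f x * g x))) + w x * g x ^ 2 := by
        funext x; ring
      have h13 : Integrable (fun x => (l * l) * (w x * f x ^ 2) + (-2 * l) * (w x * (f x * g x))) μ :=
        (h1.const_mul _).add (h3.const_mul _)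
      rw [this, integral_add h13 h2, integral_add (h1.const_mul _) (h3.const_mul _),
        integral_const_mul, integral_const_mul]
      ring
    rw [← e]
    exact integral_nonneg fun x => mul_nonneg (hw x) (sq_nonneg _)
  have := discrim_le_zero key
  rw [discrim] at this
  nlinarith

lemma bol_step {K : Set ℂ} (hK : IsCompact K) {P : ℂ → ℂ} (hP : Differentiable ℂ P) {v : ℂ → ℝ} (hv : ContDiff ℝ 2 v)
    {a b η : ℝ} (hfr : ∀ z ∈ frontier K, v z < a) (hlap : ∀ z ∈ interior K, 0 ≤ lap v z + exp (v z + (P z).re))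
    (hab : a < b) (hη : 0 < η) :
    4 * π * (∫ z in K ∩ {z | b < v z}, exp (P z).re) * (b - a) ≤ (1 + η) * ((∫ z in K ∩ {z | a < v z}, exp (v z + (P z).re)) *
      ((∫ z in K ∩ {z | a < v z}, exp (P z).re) - ∫ z in K ∩ {z | b < v z}, exp (P z).re)) := by
  classical
  obtain ⟨χ, hχ, hχa, hχb, hd0, hd1, hdz, hχ0, hχ1⟩ := clamp hab hη
  have hba : 0 < b - a := by linarith
  have hvc := hv.continuous
  have hPc : Continuous P := hP.continuous
  have hDv : Continuous (fderiv ℝ v) := hv.continuous_fderiv (by norm_num)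
  have hχd : Continuous (deriv χ) := (contDiff_one_iff_deriv.1 hχ).2
  have hχc := hχ.continuous
  have hχdiff : ∀ x, HasDerivAt χ (deriv χ x) x := fun x => ((contDiff_one_iff_deriv.1 hχ).1 x).hasDerivAt
  have hKm := hK.measurableSet
  obtain ⟨F, hF⟩ : ∃ F : ℂ → ℝ, ∀ x, F x = if x ∈ K then χ (v x) else 0 := ⟨_, fun _ => rfl⟩
  have hBo : IsOpen (K ∩ {z | a ≤ v z})ᶜ := (hK.isClosed.inter (isClosed_le continuous_const hvc)).isOpen_compl
  have hcov : ∀ x, x ∈ interior K ∨ x ∈ (K ∩ {z | a ≤ v z})ᶜ := by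
    intro x
    by_cases h : x ∈ interior K
    · exact Or.inl h
    · right
      rintro ⟨h1, h2⟩
      exact absurd (hfr x ⟨subset_closure h1, h⟩) (not_lt.2 h2)
  have hFA : ∀ x ∈ interior K, F x = χ (v x) := fun x hx => by rw [hF, if_pos (interior_subset hx)]
  have hFB : ∀ x ∈ (K ∩ {z | a ≤ v z})ᶜ, F x = 0 := by
    intro x hx
    rw [hF]
    split_ifs with h
    · refine hχa _ (not_lt.1 fun h' => hx ⟨h, h'.le⟩)
    · rfl
  have hFd : ContDiff ℝ 1 F := by
    refine contDiff_of_cover isOpen_interior hBo hcov ?_ ?_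
    · exact ((hχ.comp (hv.of_le (by norm_num))).contDiffOn).congr hFA
    · exact contDiffOn_const.congr hFB
  have hFs : HasCompactSupport F := by
    refine HasCompactSupport.intro hK fun x hx => ?_
    rw [hF, if_neg hx]
  have hDF : ∀ x, fderiv ℝ F x = if x ∈ K then deriv χ (v x) • fderiv ℝ v x else 0 := by
    intro x
    rcases hcov x with h | h
    · rw [if_pos (interior_subset h)]
      have h1 : F =ᶠ[𝓝 x] fun y => χ (v y) := by
        filter_upwards [isOpen_interior.mem_nhds h] with y hy using hFA y hy
      rw [h1.fderiv_eq]
      exact ((hχdiff (v x)).comp_hasFDerivAt x (hv.differentiable (by norm_num) x).hasFDerivAt).fderiv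
    · have h1 : F =ᶠ[𝓝 x] fun y => 0 := by
        filter_upwards [hBo.mem_nhds h] with y hy using hFB y hy
      rw [h1.fderiv_eq]
      simp only [fderiv_fun_const, Pi.zero_apply]
      split_ifs with hxK
      · rw [hdz _ (Or.inl (not_lt.1 fun h' => h ⟨hxK, h'.le⟩))]; simp
      · rfl
  -- abbreviations
  have icK : ∀ {f : ℂ → ℝ}, Continuous f → IntegrableOn f K := fun hf => hf.continuousOn.integrableOn_compact hK
  have mS : ∀ c, MeasurableSet (K ∩ {z | c < v z}) := fun c => hKm.inter (measurableSet_lt measurable_const hvc.measurable)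
  have chalf : Continuous fun z => exp ((P z).re / 2) := by fun_prop
  have ch : Continuous fun z => exp ((P z).re) := by fun_prop
  have cg : Continuous fun z => exp (v z + (P z).re) := by fun_prop
  have cn : Continuous fun z => ‖fderiv ℝ v z‖ := hDv.norm
  have cw : Continuous fun z => deriv χ (v z) := hχd.comp hvc
  have hSc : IsCompact (K ∩ {z | b ≤ v z}) := hK.inter_right (isClosed_le continuous_const hvc)
  have k1 := kernel_exp hP hFd hFs (fun z => by rw [hF]; split_ifs; exacts [hχ0 _, le_rfl]) hSc
    (fun z hz => by rw [hF, if_pos hz.1, hχb _ hz.2])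
  have hX : ∫ y, ‖fderiv ℝ F y‖ * exp ((P y).re / 2) = ∫ y in K, deriv χ (v y) * (‖fderiv ℝ v y‖ * exp ((P y).re / 2)) := by
    rw [← integral_indicator hKm]
    refine integral_congr_ae (ae_of_all _ fun y => ?_)
    simp only [hDF, indicator]
    split_ifs
    · rw [norm_smul, Real.norm_of_nonneg (hd0 _)]; ring
    · simp
  have k2 := cs (μ := volume.restrict K) (w := fun y => deriv χ (v y)) (f := fun y => ‖fderiv ℝ v y‖) (g := fun y => exp ((P y).re / 2)) (fun x => hd0 _)
    (icK (cw.mul (cn.pow 2))) (icK (cw.mul (chalf.pow 2))) (icK (cw.mul (cn.mul chalf)))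
  have hS1 : (∫ z in K ∩ {z | b < v z}, exp (P z).re) ≤ ∫ z in K ∩ {z | b ≤ v z}, exp (P z).re := by
    refine setIntegral_mono_set ((icK ch).mono_set inter_subset_left) (ae_of_all _ fun z => (exp_pos _).le) ?_
    exact HasSubset.Subset.eventuallyLE (inter_subset_inter_right _ fun z (hz : b < v z) => hz.le)
  have hSn : 0 ≤ ∫ z in K ∩ {z | b ≤ v z}, exp (P z).re := integral_nonneg fun z => (exp_pos _).le
  have k3 : 4 * π * (∫ z in K ∩ {z | b < v z}, exp (P z).re) ≤ (∫ y in K, deriv χ (v y) * (‖fderiv ℝ v y‖ * exp ((P y).re / 2))) ^ 2 := by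
    rw [← hX]
    have h0 : (0:ℝ) ≤ 2 * √(π * ∫ z in K ∩ {z | b ≤ v z}, exp (P z).re) := by positivity
    have := pow_le_pow_left₀ h0 k1 2
    rw [mul_pow, sq_sqrt (by positivity)] at this
    have hm : 4 * π * (∫ z in K ∩ {z | b < v z}, exp (P z).re) ≤ 4 * π * (∫ z in K ∩ {z | b ≤ v z}, exp (P z).re) := by gcongr
    linarith
  -- Y
  have hY : ∫ y in K, deriv χ (v y) * ‖fderiv ℝ v y‖ ^ 2 = - ∫ y, F y * lap v y := by
    have c1 : ContDiff ℝ 1 fun z => fderiv ℝ v z 1 := contDiff_fderiv_apply hv 1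
    have c2 : ContDiff ℝ 1 fun z => fderiv ℝ v z Complex.I := contDiff_fderiv_apply hv _
    have i1 := ibp hFd hFs c1 1
    have i2 := ibp hFd hFs c2 Complex.I
    have hDFc := hFd.continuous_fderiv (by norm_num)
    have s1 : Integrable fun y => fderiv ℝ F y 1 * fderiv ℝ v y 1 :=
      ((hDFc.clm_apply continuous_const).mul c1.continuous).integrable_of_hasCompactSupport (fderiv_apply_compact hFs 1).mul_right
    have s2 : Integrable fun y => fderiv ℝ F y Complex.I * fderiv ℝ v y Complex.I :=
      ((hDFc.clm_apply continuous_const).mul c2.continuous).integrable_of_hasCompactSupport (fderiv_apply_compact hFs _).mul_right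
    have s3 : Integrable fun y => F y * fderiv ℝ (fun z => fderiv ℝ v z 1) y 1 :=
      (hFd.continuous.mul ((c1.continuous_fderiv (by norm_num)).clm_apply continuous_const)).integrable_of_hasCompactSupport hFs.mul_right
    have s4 : Integrable fun y => F y * fderiv ℝ (fun z => fderiv ℝ v z Complex.I) y Complex.I :=
      (hFd.continuous.mul ((c2.continuous_fderiv (by norm_num)).clm_apply continuous_const)).integrable_of_hasCompactSupport hFs.mul_right
    have e1 : ∫ y, F y * lap v y = (∫ y, F y * fderiv ℝ (fun z => fderiv ℝ v z 1) y 1) + ∫ y, F y * fderiv ℝ (fun z => fderiv ℝ v z Complex.I) y Complex.I := by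
      rw [← integral_add s3 s4]
      exact integral_congr_ae (ae_of_all _ fun y => by simp only [lap]; ring)
    rw [e1, neg_add, ← i1, ← i2, ← integral_add s1 s2, ← integral_indicator hKm]
    refine integral_congr_ae (ae_of_all _ fun y => ?_)
    simp only [hDF, indicator]
    split_ifs
    · rw [norm_sq_L]
      simp only [ContinuousLinearMap.smul_apply, smul_eq_mul]; ring
    · simp
  have hYm : ∫ y in K, deriv χ (v y) * ‖fderiv ℝ v y‖ ^ 2 ≤ ∫ z in K ∩ {z | a < v z}, exp (v z + (P z).re) := by
    rw [hY, ← integral_neg, ← integral_indicator (mS a)]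
    have hlc := continuous_lap hv
    refine integral_mono ?_ ?_ fun y => ?_
    · exact ((hFd.continuous.mul hlc).integrable_of_hasCompactSupport hFs.mul_right).neg
    · rw [integrable_indicator_iff (mS a)]
      exact (icK cg).mono_set inter_subset_left
    · simp only [indicator, mem_inter_iff, mem_setOf_eq]
      split_ifs with h
      · rcases hcov y with h' | h'
        · have q1 := hlap y h'
          have q2 : F y ≤ 1 := by rw [hFA y h']; exact hχ1 _
          have q3 : 0 ≤ F y := by rw [hFA y h']; exact hχ0 _
          have q4 := exp_pos (v y + (P y).re)
          nlinarith
        · rw [hFB y h']; simpa using (exp_pos _).le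
      · have : F y = 0 := by
          rw [hF]
          split_ifs with hy
          · exact hχa _ (not_lt.1 fun h' => h ⟨hy, h'⟩)
          · rfl
        rw [this]; simp
  have hZ : ∫ y in K, deriv χ (v y) * exp ((P y).re / 2) ^ 2 ≤ (1 + η) / (b - a) *
      ((∫ z in K ∩ {z | a < v z}, exp (P z).re) - ∫ z in K ∩ {z | b < v z}, exp (P z).re) := by
    have hsub : K ∩ {z | b < v z} ⊆ K ∩ {z | a < v z} := inter_subset_inter_right _ fun z hz => hab.trans hz
    rw [← setIntegral_sdiff (mS b) ((icK ch).mono_set inter_subset_left) hsub, ← integral_const_mul, ← integral_indicator hKm, ← integral_indicator ((mS a).diff (mS b))]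
    refine integral_mono ?_ ?_ fun y => ?_
    · rw [integrable_indicator_iff hKm]; exact icK (cw.mul (chalf.pow 2))
    · rw [integrable_indicator_iff ((mS a).diff (mS b))]
      exact ((icK ch).mono_set (diff_subset.trans inter_subset_left)).const_mul _
    · have e2 : exp ((P y).re / 2) ^ 2 = exp (P y).re := by
        rw [← exp_nat_mul]; congr 1; push_cast; ring
      simp only [indicator, mem_inter_iff, mem_setOf_eq, mem_diff, e2]
      by_cases hy : y ∈ K
      · by_cases h1 : a < v y
        · by_cases h2 : b < v y
          · simp [hy, h1, h2, hdz _ (Or.inr h2.le)]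
          · simp only [hy, h1, h2]
            simpa using mul_le_mul_of_nonneg_right (hd1 (v y)) (exp_pos (P y).re).le
        · simp [hy, h1, hdz _ (Or.inl (not_lt.1 h1))]
      · simp [hy]
  have hYn : 0 ≤ ∫ z in K ∩ {z | a < v z}, exp (v z + (P z).re) := integral_nonneg fun z => (exp_pos _).le
  have hZn : 0 ≤ ∫ y in K, deriv χ (v y) * exp ((P y).re / 2) ^ 2 := integral_nonneg fun z => mul_nonneg (hd0 _) (by positivity)
  have fin := (k3.trans k2).trans (mul_le_mul hYm hZ hZn hYn)
  calc _ ≤ _ := mul_le_mul_of_nonneg_right fin hba.le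
    _ = _ := by field_simp

end Bol

namespace Bol
open Set Filter Topology
open scoped Manifold ContDiff

noncomputable def pp (x : ℝ) : ℝ := √(x * (8 * π - x) / 2)

lemma bol_core {K : Set ℂ} (hK : IsCompact K) {P : ℂ → ℂ} (hP : Differentiable ℂ P) {v : ℂ → ℝ} (hv : ContDiff ℝ 2 v)
    {a₀ : ℝ} (hfr : ∀ z ∈ frontier K, v z < a₀) (hlap : ∀ z ∈ interior K, 0 ≤ lap v z + exp (v z + (P z).re)) :
    (∫ z in K, exp (v z + (P z).re)) * (8 * π - ∫ z in K, exp (v z + (P z).re)) / 2 ≤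
      4 * π * exp a₀ * ∫ z in K, exp (P z).re := by
  have hvc := hv.continuous
  have hPc : Continuous P := hP.continuous
  have hKm := hK.measurableSet
  have icK : ∀ {f : ℂ → ℝ}, Continuous f → IntegrableOn f K := fun hf => hf.continuousOn.integrableOn_compact hK
  have mS : ∀ c, MeasurableSet (K ∩ {z | c < v z}) := fun c => hKm.inter (measurableSet_lt measurable_const hvc.measurable)
  have ch : Continuous fun z => exp ((P z).re) := by fun_prop
  have cg : Continuous fun z => exp (v z + (P z).re) := by fun_prop
  obtain ⟨m, hm⟩ : ∃ m : ℝ → ℝ, ∀ a, m a = ∫ z in K ∩ {z | a < v z}, exp (v z + (P z).re) := ⟨_, fun _ => rfl⟩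
  obtain ⟨μ, hμ⟩ : ∃ μ : ℝ → ℝ, ∀ a, μ a = ∫ z in K ∩ {z | a < v z}, exp ((P z).re) := ⟨_, fun _ => rfl⟩
  obtain ⟨B, hB⟩ : ∃ B, ∀ z ∈ K, v z ≤ B := by
    obtain ⟨B, hB⟩ := (hK.image hvc).bddAbove
    exact ⟨B, fun z hz => hB ⟨z, hz, rfl⟩⟩
  obtain ⟨A, hA1, hA2⟩ : ∃ A, a₀ < A ∧ B ≤ A := ⟨max B (a₀ + 1), lt_max_of_lt_right (by linarith), le_max_left _ _⟩
  have hempty : K ∩ {z | A < v z} = ∅ := by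
    ext z; simp only [mem_inter_iff, mem_setOf_eq, mem_empty_iff_false, iff_false, not_and, not_lt]
    exact fun hz => (hB z hz).trans hA2
  have hsub : ∀ a b, a ≤ b → K ∩ {z | b < v z} ⊆ K ∩ {z | a < v z} := fun a b hab =>
    inter_subset_inter_right _ fun z (hz : b < v z) => lt_of_le_of_lt hab hz
  have key := phi_nonneg (m := m) (μ := μ) hA1 (fun a => by rw [hm]; exact integral_nonneg fun z => (exp_pos _).le)
    (fun a => by rw [hμ]; exact integral_nonneg fun z => (exp_pos _).le) (by rw [hm, hempty]; simp) (by rw [hμ, hempty]; simp)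
    (fun a b hab => by
      rw [hm, hm]
      exact setIntegral_mono_set ((icK cg).mono_set inter_subset_left) (ae_of_all _ fun z => (exp_pos _).le) (hsub a b hab).eventuallyLE)
    (fun a b hab => by
      rw [hμ, hμ]
      exact setIntegral_mono_set ((icK ch).mono_set inter_subset_left) (ae_of_all _ fun z => (exp_pos _).le) (hsub a b hab).eventuallyLE)
    (fun a b ha hab => by
      have h := fun η (hη : 0 < η) => bol_step hK hP hv (a := a) (b := b) (η := η) (fun z hz => (hfr z hz).trans_le ha) hlap hab hη
      simp only [← hμ, ← hm] at h
      have ht : Tendsto (fun η : ℝ => (1 + η) * (m a * (μ a - μ b))) (𝓝[>] 0) (𝓝 ((1 + 0) * (m a * (μ a - μ b)))) := by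
        apply Tendsto.mono_left _ nhdsWithin_le_nhds
        exact (Continuous.tendsto (by fun_prop) 0)
      have := ge_of_tendsto ht (eventually_mem_nhdsWithin.mono fun η hη => h η hη)
      simpa using this)
    (fun a b ha hab => by
      rw [hμ, hμ, hm, hm, ← setIntegral_sdiff (mS b) ((icK ch).mono_set inter_subset_left) (hsub a b hab.le),
        ← setIntegral_sdiff (mS b) ((icK cg).mono_set inter_subset_left) (hsub a b hab.le), ← integral_const_mul]
      refine setIntegral_mono_on (((icK ch).mono_set (diff_subset.trans inter_subset_left)).const_mul _)
        ((icK cg).mono_set (diff_subset.trans inter_subset_left)) ((mS a).diff (mS b)) fun z hz => ?_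
      rw [exp_add]
      have : exp a ≤ exp (v z) := exp_le_exp.2 (le_of_lt hz.1.2)
      gcongr)
    (fun a b ha hab => by
      rw [hμ, hμ, hm, hm, ← setIntegral_sdiff (mS b) ((icK ch).mono_set inter_subset_left) (hsub a b hab.le),
        ← setIntegral_sdiff (mS b) ((icK cg).mono_set inter_subset_left) (hsub a b hab.le), ← integral_const_mul]
      refine setIntegral_mono_on ((icK cg).mono_set (diff_subset.trans inter_subset_left))
        (((icK ch).mono_set (diff_subset.trans inter_subset_left)).const_mul _) ((mS a).diff (mS b)) fun z hz => ?_
      rw [exp_add]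
      have : exp (v z) ≤ exp b := exp_le_exp.2 (not_lt.1 fun h => hz.2 ⟨hz.1.1, h⟩)
      gcongr)
  have last : (∫ z in K, exp (v z + (P z).re)) - m a₀ ≤ exp a₀ * ((∫ z in K, exp (P z).re) - μ a₀) := by
    rw [hμ, hm, ← setIntegral_sdiff (mS a₀) (icK ch) inter_subset_left,
        ← setIntegral_sdiff (mS a₀) (icK cg) inter_subset_left, ← integral_const_mul]
    refine setIntegral_mono_on ((icK cg).mono_set diff_subset)
        (((icK ch).mono_set diff_subset).const_mul _) (hKm.diff (mS _)) fun z hz => ?_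
    rw [exp_add]
    have : exp (v z) ≤ exp a₀ := exp_le_exp.2 (not_lt.1 fun h => hz.2 ⟨hz.1, h⟩)
    gcongr
  have hle : m a₀ ≤ ∫ z in K, exp (v z + (P z).re) := by
    rw [hm]
    exact setIntegral_mono_set (icK cg) (ae_of_all _ fun z => (exp_pos _).le) inter_subset_left.eventuallyLE
  have h0 : 0 ≤ m a₀ := by rw [hm]; exact integral_nonneg fun z => (exp_pos _).le
  have hπ := pi_pos
  obtain ⟨M, hM⟩ : ∃ M, M = ∫ z in K, exp (v z + (P z).re) := ⟨_, rfl⟩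
  rw [← hM] at last hle ⊢
  have q := mul_le_mul_of_nonneg_left last (show 0 ≤ 4 * π by positivity)
  nlinarith [mul_self_le_mul_self h0 hle]

lemma cutoff {K Ω : Set ℂ} (hK : IsCompact K) (hΩ : IsOpen Ω) (hKΩ : K ⊆ Ω) : ∃ (χ : ℂ → ℝ) (O T : Set ℂ),
    ContDiff ℝ ∞ χ ∧ IsOpen O ∧ IsCompact T ∧ K ⊆ O ∧ O ⊆ T ∧ T ⊆ Ω ∧ (∀ z ∈ O, χ z = 1) ∧ (∀ z ∉ T, χ z = 0) ∧
    (∀ z, 0 ≤ χ z) ∧ (∀ z, χ z ≤ 1) := by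
  obtain ⟨T, hT, h1, h2⟩ := exists_compact_between hK hΩ hKΩ
  obtain ⟨f, f1, f2, f3⟩ := exists_contMDiffMap_one_nhds_of_subset_interior 𝓘(ℝ, ℂ) (n := ⊤) hK.isClosed h1
  obtain ⟨O, hO, hKO, hOf⟩ := (eventually_nhdsSet_iff_exists.1 f1)
  refine ⟨f, O ∩ interior T, T, contMDiff_iff_contDiff.1 f.contMDiff, hO.inter isOpen_interior, hT, subset_inter hKO h1,
    inter_subset_right.trans interior_subset, h2, fun z hz => hOf z hz.1, f2, fun z => (f3 z).1, fun z => (f3 z).2⟩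

lemma extend {K Ω : Set ℂ} (hK : IsCompact K) (hΩ : IsOpen Ω) (hKΩ : K ⊆ Ω) {g : ℂ → ℝ} (hg : ContDiffOn ℝ 2 g Ω) :
    ∃ (G : ℂ → ℝ) (O : Set ℂ), ContDiff ℝ 2 G ∧ HasCompactSupport G ∧ IsOpen O ∧ K ⊆ O ∧ O ⊆ Ω ∧ ∀ z ∈ O, G z = g z := by
  obtain ⟨χ, O, T, hχ, hO, hT, hKO, hOT, hTΩ, h1, h0, -, -⟩ := cutoff hK hΩ hKΩ
  refine ⟨fun z => χ z * g z, O, ?_, ?_, hO, hKO, hOT.trans hTΩ, fun z hz => by simp [h1 z hz]⟩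
  · refine contDiff_of_cover hΩ hT.isClosed.isOpen_compl ?_ ?_ ?_
    · intro x; by_cases h : x ∈ T
      · exact Or.inl (hTΩ h)
      · exact Or.inr h
    · exact (((contDiff_infty.1 hχ 2)).contDiffOn).mul hg
    · exact contDiffOn_const (c := (0:ℝ)) |>.congr fun z hz => by simp [h0 z hz]
  · exact HasCompactSupport.intro hT fun z hz => by simp [h0 z hz]

lemma lap_congr {f g : ℂ → ℝ} {z : ℂ} (h : f =ᶠ[𝓝 z] g) : lap f z = lap g z := by
  have h1 : ∀ v, (fun y => fderiv ℝ f y v) =ᶠ[𝓝 z] fun y => fderiv ℝ g y v := fun v =>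
    (h.fderiv (𝕜 := ℝ)).mono fun y hy => by simp [hy]
  unfold lap
  rw [(h1 1).fderiv_eq, (h1 Complex.I).fderiv_eq]

lemma hasFDerivAt_re {Q : ℂ → ℂ} {q z : ℂ} (h : HasDerivAt Q q z) (v : ℂ) :
    HasFDerivAt (fun y => (Q y * v).re) (Complex.reCLM.comp ((ContinuousLinearMap.mul ℝ ℂ (q * v)))) z := by
  have h1 : HasFDerivAt (fun y => Q y * v) ((ContinuousLinearMap.mul ℝ ℂ (q * v))) z := by
    have := (h.mul_const v).hasFDerivAt.restrictScalars ℝ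
    refine this.congr_fderiv (ContinuousLinearMap.ext fun u => ?_)
    simp [mul_comm]
  exact Complex.reCLM.hasFDerivAt.comp z h1

lemma lap_sub_re {P : Polynomial ℂ} {f : ℂ → ℝ} (hf : ContDiff ℝ 2 f) (z : ℂ) :
    lap (fun y => f y - (P.eval y).re) z = lap f z := by
  have h1 : ∀ y v, fderiv ℝ (fun y => f y - (P.eval y).re) y v = fderiv ℝ f y v - (P.derivative.eval y * v).re := by
    intro y v
    have := hasFDerivAt_re (P.hasDerivAt y) 1
    simp only [mul_one] at this
    rw [((hf.differentiable (by norm_num) y).hasFDerivAt.fun_sub this).fderiv]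
    simp
  have h2 : ∀ v, fderiv ℝ (fun y => fderiv ℝ f y v - (P.derivative.eval y * v).re) z v =
      fderiv ℝ (fun y => fderiv ℝ f y v) z v - (P.derivative.derivative.eval z * v * v).re := by
    intro v
    have := hasFDerivAt_re (P.derivative.hasDerivAt z) v
    have h3 := ((contDiff_fderiv_apply hf v).differentiable (by norm_num) z).hasFDerivAt
    rw [(h3.fun_sub this).fderiv]
    simp
  unfold lap
  simp only [h1]
  rw [h2, h2]
  have : (P.derivative.derivative.eval z * Complex.I * Complex.I) = - P.derivative.derivative.eval z := by
    rw [mul_assoc, Complex.I_mul_I]; ring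
  rw [this]; simp

/-- the Bol isoperimetric inequality, relaxed form -/
theorem BOL {Ω : Set ℂ} (hΩ : IsOpen Ω) {g : ℂ → ℝ} (hg : ContDiffOn ℝ 2 g Ω) (hlap : ∀ z ∈ Ω, 0 ≤ lap g z + exp (g z))
    {K : Set ℂ} (hK : IsCompact K) (hKΩ : K ⊆ Ω) (hR : IsConnected Kᶜ) {ε : ℝ} (hε : 0 < ε) :
    ∃ N, IsOpen N ∧ frontier K ⊆ N ∧ N ⊆ Ω ∧ ∀ f : ℂ → ℝ, ContDiff ℝ 1 f → HasCompactSupport f → (∀ z, 0 ≤ f z) → (∀ z, f z ≤ 1) →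
      (∀ z ∈ K, f z = 1) → (∀ z, z ∉ K → z ∉ N → f z = 0) →
      exp (-ε) * pp (∫ z in K, exp (g z)) ≤ ∫ z, ‖fderiv ℝ f z‖ * exp (g z / 2) := by
  have hfK : frontier K ⊆ K := hK.isClosed.frontier_subset
  obtain ⟨G, O, hG, hGs, hO, hKO, hOΩ, hGg⟩ := extend hK hΩ hKΩ hg
  obtain ⟨P, hP⟩ := WL hK hR hG hGs (show 0 < ε / 4 by linarith)
  obtain ⟨v, hv⟩ : ∃ v : ℂ → ℝ, ∀ z, v z = G z - (P.eval z).re := ⟨_, fun _ => rfl⟩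
  have hve : v = fun z => G z - (P.eval z).re := funext hv
  have hPd : Differentiable ℂ (fun z => P.eval z) := P.differentiable
  have hPr : ContDiff ℝ 2 (fun z => (P.eval z).re) := by
    exact Complex.reCLM.contDiff.comp ((hPd.contDiff (n := 2)).restrict_scalars ℝ)
  have hvC : ContDiff ℝ 2 v := by rw [hve]; exact hG.sub hPr
  have hGv : ∀ z, v z + (P.eval z).re = G z := fun z => by rw [hv]; ring
  have core := bol_core (P := fun z => P.eval z) hK hPd hvC (a₀ := ε) (fun z hz => by
      have := hP z hz
      rw [abs_le] at this
      rw [hv]; linarith)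
    (fun z hz => by
      have hzO := hKO (interior_subset hz)
      rw [hGv, hve, lap_sub_re hG, lap_congr (g := g), hGg z hzO]
      · exact hlap z (hOΩ hzO)
      · filter_upwards [hO.mem_nhds hzO] with y hy using hGg y hy)
  simp only [hGv] at core
  have hmK : ∫ z in K, exp (G z) = ∫ z in K, exp (g z) :=
    setIntegral_congr_fun hK.measurableSet fun z hz => by simp only [hGg z (hKO hz)]
  rw [hmK] at core
  refine ⟨O ∩ {z | |v z| < ε}, hO.inter (isOpen_lt (by have := hvC.continuous; fun_prop) continuous_const), ?_, inter_subset_left.trans hOΩ, ?_⟩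
  · intro z hz
    refine ⟨hKO (hfK hz), ?_⟩
    have := hP z hz
    rw [abs_sub_comm, ← hv] at this
    simp only [mem_setOf_eq]; linarith
  intro f hf hfs hf0 hf1 hfK1 hfN
  have hD : ∀ z, z ∉ O ∩ {z | |v z| < ε} → fderiv ℝ f z = 0 := by
    intro z hz
    by_cases hzK : z ∈ K
    · refine IsLocalMax.fderiv_eq_zero (Eventually.of_forall fun y => ?_)
      rw [hfK1 z hzK]; exact hf1 y
    · refine IsLocalMin.fderiv_eq_zero (Eventually.of_forall fun y => ?_)
      rw [hfN z hzK hz]; exact hf0 y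
  have k1 := kernel_exp hPd hf hfs hf0 hK (fun z hz => (hfK1 z hz).ge)
  have hDc := hf.continuous_fderiv (by norm_num)
  have e1 : ∫ z, ‖fderiv ℝ f z‖ * exp (g z / 2) = ∫ z, ‖fderiv ℝ f z‖ * exp (G z / 2) := by
    refine integral_congr_ae (ae_of_all _ fun z => ?_)
    by_cases hz : z ∈ O ∩ {z | |v z| < ε}
    · simp only [hGg z hz.1]
    · simp [hD z hz]
  have e2 : exp (-(ε / 2)) * ∫ z, ‖fderiv ℝ f z‖ * exp ((P.eval z).re / 2) ≤ ∫ z, ‖fderiv ℝ f z‖ * exp (G z / 2) := by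
    rw [← integral_const_mul]
    have hcs : HasCompactSupport (fun z => ‖fderiv ℝ f z‖) := (hfs.fderiv (𝕜 := ℝ)).norm
    have cP : Continuous fun z => exp ((P.eval z).re / 2) := by have := hPr.continuous; fun_prop
    have cG : Continuous fun z => exp (G z / 2) := by have := hG.continuous; fun_prop
    refine integral_mono ?_ ?_ fun z => ?_
    · exact ((hDc.norm.mul cP).integrable_of_hasCompactSupport hcs.mul_right).const_mul _
    · exact (hDc.norm.mul cG).integrable_of_hasCompactSupport hcs.mul_right
    · by_cases hz : z ∈ O ∩ {z | |v z| < ε}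
      · have hz2 : |v z| < ε := hz.2
        have h1 := (abs_lt.1 hz2).1
        rw [hv] at h1
        have h2 : exp (-(ε / 2)) * exp ((P.eval z).re / 2) ≤ exp (G z / 2) := by
          rw [← exp_add, exp_le_exp]; linarith
        calc exp (-(ε / 2)) * (‖fderiv ℝ f z‖ * exp ((P.eval z).re / 2)) = ‖fderiv ℝ f z‖ * (exp (-(ε / 2)) * exp ((P.eval z).re / 2)) := by ring
          _ ≤ _ := by gcongr
      · simp [hD z hz]
  rw [e1]
  refine le_trans ?_ e2
  have e3 : pp (∫ z in K, exp (g z)) ≤ exp (ε / 2) * (2 * √(π * ∫ z in K, exp ((P.eval z).re))) := by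
    have hn : 0 ≤ ∫ z in K, exp ((P.eval z).re) := integral_nonneg fun z => (exp_pos _).le
    rw [pp, sqrt_le_left (by positivity), mul_pow, mul_pow, sq_sqrt (by positivity), ← exp_nat_mul]
    push_cast
    rw [show 2 * (ε / 2) = ε by ring]
    linarith
  calc exp (-ε) * pp (∫ z in K, exp (g z)) ≤ exp (-ε) * (exp (ε / 2) * (2 * √(π * ∫ z in K, exp ((P.eval z).re)))) := by gcongr
    _ = exp (-(ε / 2)) * (2 * √(π * ∫ z in K, exp ((P.eval z).re))) := by
      rw [← mul_assoc, ← exp_add]; congr 2; ring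
    _ ≤ _ := by gcongr

end Bol

namespace Bol
open Set Filter Topology
open scoped Manifold ContDiff

/-- the unbounded component of the complement -/
def ub (K : Set ℂ) : Set ℂ := {z | z ∉ K ∧ ¬ Bornology.IsBounded (connectedComponentIn Kᶜ z)}

/-- hull -/
def hull (K : Set ℂ) : Set ℂ := (ub K)ᶜ

lemma ext_connected {R : ℝ} (hR : 0 < R) : IsConnected {z : ℂ | R < ‖z‖} := by
  have h : {z : ℂ | R < ‖z‖} = Complex.exp '' {w : ℂ | log R < w.re} := by
    ext z
    simp only [mem_setOf_eq, mem_image]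
    constructor
    · intro hz
      have hz0 : z ≠ 0 := by rintro rfl; simp at hz; linarith
      exact ⟨Complex.log z, by rw [Complex.log_re]; exact log_lt_log hR hz, Complex.exp_log hz0⟩
    · rintro ⟨w, hw, rfl⟩
      rw [Complex.norm_exp]
      exact (log_lt_iff_lt_exp hR).1 hw
  rw [h]
  refine IsConnected.image ⟨⟨((log R + 1 : ℝ) : ℂ), ?_⟩, ?_⟩ _ Complex.continuous_exp.continuousOn
  · simp [-Complex.ofReal_add, -Complex.ofReal_log]
  · exact (convex_halfSpace_re_gt (log R)).isPreconnected

lemma exists_ext {K : Set ℂ} (hK : IsCompact K) : ∃ R > 0, ∀ z : ℂ, R < ‖z‖ → z ∉ K := by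
  obtain ⟨D, hD0, hD⟩ := hK.isBounded.exists_pos_norm_le
  exact ⟨D, hD0, fun z hz h => absurd (hD z h) (not_le.2 hz)⟩

lemma unbounded_ext {S : Set ℂ} (hS : ¬ Bornology.IsBounded S) (R : ℝ) : ∃ z ∈ S, R < ‖z‖ := by
  by_contra! h
  exact hS (isBounded_iff_forall_norm_le.2 ⟨R, h⟩)

lemma ext_unbounded (R : ℝ) : ¬ Bornology.IsBounded {z : ℂ | R < ‖z‖} := by
  intro h
  obtain ⟨C, hC⟩ := isBounded_iff_forall_norm_le.1 h
  have hm : ‖((max R C + 1 : ℝ) : ℂ)‖ ≥ max R C + 1 := by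
    rw [Complex.norm_real]; exact le_abs_self _
  have h1 := hC ((max R C + 1 : ℝ) : ℂ) (by
    have := le_max_left R C
    simp only [mem_setOf_eq]; linarith)
  have := le_max_right R C
  linarith

lemma subset_ub {K S : Set ℂ} (hS : IsPreconnected S) (hu : ¬ Bornology.IsBounded S) (hd : S ⊆ Kᶜ) : S ⊆ ub K := by
  intro z hz
  refine ⟨hd hz, fun h => hu (h.subset (hS.subset_connectedComponentIn hz hd))⟩

lemma ub_eq {K : Set ℂ} (hK : IsCompact K) {R : ℝ} (hR0 : 0 < R) (hR : ∀ z : ℂ, R < ‖z‖ → z ∉ K) {w : ℂ} (hw : R < ‖w‖) :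
    ub K = connectedComponentIn Kᶜ w := by
  have hE : {z : ℂ | R < ‖z‖} ⊆ connectedComponentIn Kᶜ w :=
    (ext_connected hR0).isPreconnected.subset_connectedComponentIn hw fun z hz => hR z hz
  apply Subset.antisymm
  · intro z hz
    obtain ⟨y, hy, hyR⟩ := unbounded_ext hz.2 R
    have h1 := connectedComponentIn_eq hy
    have h2 := connectedComponentIn_eq (hE hyR)
    rw [h2, ← h1]
    exact mem_connectedComponentIn hz.1
  · exact subset_ub isPreconnected_connectedComponentIn (fun h => ext_unbounded R (h.subset hE)) (connectedComponentIn_subset _ _)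

lemma ub_nonempty_ext {K : Set ℂ} (hK : IsCompact K) {R : ℝ} (hR0 : 0 < R) (hR : ∀ z : ℂ, R < ‖z‖ → z ∉ K) {w : ℂ} (hw : R < ‖w‖) : w ∈ ub K := by
  rw [ub_eq hK hR0 hR hw]; exact mem_connectedComponentIn (hR w hw)

lemma ub_open {K : Set ℂ} (hK : IsCompact K) : IsOpen (ub K) := by
  obtain ⟨R, hR0, hR⟩ := exists_ext hK
  obtain ⟨w, -, hw⟩ := unbounded_ext (ext_unbounded R) R
  rw [ub_eq hK hR0 hR hw]
  exact hK.isClosed.isOpen_compl.connectedComponentIn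

lemma ub_connected {K : Set ℂ} (hK : IsCompact K) : IsConnected (ub K) := by
  obtain ⟨R, hR0, hR⟩ := exists_ext hK
  obtain ⟨w, -, hw⟩ := unbounded_ext (ext_unbounded R) R
  rw [ub_eq hK hR0 hR hw]
  exact isConnected_connectedComponentIn_iff.2 (hR w hw)

lemma ub_unbounded {K : Set ℂ} (hK : IsCompact K) : ¬ Bornology.IsBounded (ub K) := by
  obtain ⟨R, hR0, hR⟩ := exists_ext hK
  intro h
  exact ext_unbounded R (h.subset fun w hw => ub_nonempty_ext hK hR0 hR hw)

lemma ub_subset (K : Set ℂ) : ub K ⊆ Kᶜ := fun z hz => hz.1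

lemma ub_anti {K L : Set ℂ} (hL : IsCompact L) (h : K ⊆ L) : ub L ⊆ ub K :=
  subset_ub (ub_connected hL).isPreconnected (ub_unbounded hL) ((ub_subset L).trans (compl_subset_compl.2 h))

lemma subset_hull (K : Set ℂ) : K ⊆ hull K := fun z hz h => h.1 hz

lemma hull_mono {K L : Set ℂ} (hL : IsCompact L) (h : K ⊆ L) : hull K ⊆ hull L := compl_subset_compl.2 (ub_anti hL h)

lemma hull_compact {K : Set ℂ} (hK : IsCompact K) : IsCompact (hull K) := by
  obtain ⟨R, hR0, hR⟩ := exists_ext hK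
  refine (isCompact_closedBall (0:ℂ) R).of_isClosed_subset (ub_open hK).isClosed_compl fun z hz => ?_
  rw [mem_closedBall_zero_iff]
  exact not_lt.1 fun h => hz (ub_nonempty_ext hK hR0 hR h)

lemma hull_compl (K : Set ℂ) : (hull K)ᶜ = ub K := compl_compl _

lemma component_frontier {K : Set ℂ} (hK : IsCompact K) {p z : ℂ} (hz : z ∈ closure (connectedComponentIn Kᶜ p)) (hzK : z ∉ K) :
    z ∈ connectedComponentIn Kᶜ p := by
  have ho : IsOpen (connectedComponentIn Kᶜ z) := hK.isClosed.isOpen_compl.connectedComponentIn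
  obtain ⟨y, hy1, hy2⟩ := mem_closure_iff.1 hz _ ho (mem_connectedComponentIn hzK)
  rw [connectedComponentIn_eq hy2, ← connectedComponentIn_eq hy1]
  exact mem_connectedComponentIn hzK

lemma ub_closure {K : Set ℂ} (hK : IsCompact K) {z : ℂ} (hz : z ∈ closure (ub K)) (hzK : z ∉ K) : z ∈ ub K := by
  obtain ⟨R, hR0, hR⟩ := exists_ext hK
  obtain ⟨w, -, hw⟩ := unbounded_ext (ext_unbounded R) R
  rw [ub_eq hK hR0 hR hw] at hz ⊢
  exact component_frontier hK hz hzK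

lemma frontier_hull {K : Set ℂ} (hK : IsCompact K) : frontier (hull K) ⊆ K := by
  intro z hz
  rw [hull, frontier_compl] at hz
  by_contra h
  have := ub_closure hK hz.1 h
  rw [(ub_open hK).frontier_eq] at hz
  exact hz.2 this

/-- holes of compact subsets of a simply connected domain lie in the domain -/
lemma fill {Ω : Set ℂ} (hΩ : IsOpen Ω) (hs : IsSimplyConnected Ω) {K : Set ℂ} (hK : IsCompact K) (hKΩ : K ⊆ Ω) : hull K ⊆ Ω := by
  intro p hp
  by_contra hpΩ
  have hpK : p ∉ K := fun h => hpΩ (hKΩ h)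
  have hYb : Bornology.IsBounded (connectedComponentIn Kᶜ p) := by
    by_contra h; exact hp ⟨hpK, h⟩
  have hYo : IsOpen (connectedComponentIn Kᶜ p) := hK.isClosed.isOpen_compl.connectedComponentIn
  obtain ⟨Y, hY⟩ : ∃ Y, Y = connectedComponentIn Kᶜ p := ⟨_, rfl⟩
  have hpY : p ∈ Y := hY ▸ mem_connectedComponentIn hpK
  have hcl : ∀ z ∈ closure Y, z ∉ Ω → z ∈ Y := by
    intro z hz hzΩ
    rw [hY] at hz ⊢
    exact component_frontier hK hz fun h => hzΩ (hKΩ h)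
  rw [← hY] at hYb hYo
  have hC : IsCompact (closure Y \ Ω) := hYb.isCompact_closure.diff hΩ
  obtain ⟨f, O, T, hf, hO, hT, hKO, hOT, hTY, h1, h0, -, -⟩ := cutoff hC hYo fun z hz => hcl z hz.1 hz.2
  have hfs : HasCompactSupport f := HasCompactSupport.intro hT h0
  have hf2 : ContDiff ℝ 2 f := contDiff_infty.1 hf 2
  have hf1 : ContDiff ℝ 1 f := contDiff_infty.1 hf 1
  have ki := KI hf1 hfs p
  rw [h1 p (hKO ⟨subset_closure hpY, hpΩ⟩)] at ki
  obtain ⟨l, hlc, hl⟩ := Complex.exists_continuousOn_eqOn_exp_comp hs hΩ (g := fun z => z - p) (by fun_prop)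
    (by rintro ⟨z, hz, h⟩; exact hpΩ (by rwa [← sub_eq_zero.1 h]))
  have hld : ∀ z ∈ Ω, HasDerivAt l (z - p)⁻¹ z := by
    intro z hz
    have e : Complex.exp (l z) = z - p := hl hz
    rw [← e]
    refine HasDerivAt.of_local_left_inverse (f := fun w => Complex.exp w + p) (hlc.continuousAt (hΩ.mem_nhds hz))
      ((Complex.hasDerivAt_exp (l z)).add_const p) (Complex.exp_ne_zero _) ?_
    filter_upwards [hΩ.mem_nhds hz] with y hy
    have : Complex.exp (l y) = y - p := hl hy
    rw [this]; ring
  have hθC : ContDiffOn ℝ 2 (fun z => (l z).im) Ω := by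
    have h2 : DifferentiableOn ℂ l Ω := fun z hz => (hld z hz).differentiableAt.differentiableWithinAt
    exact Complex.imCLM.contDiff.comp_contDiffOn ((h2.contDiffOn hΩ (n := 2)).restrict_scalars ℝ)
  have hTO : IsCompact (T \ O) := hT.diff hO
  have hTOΩ : T \ O ⊆ Ω := by
    intro z hz
    by_contra h
    exact hz.2 (hKO ⟨subset_closure (hTY hz.1), h⟩)
  obtain ⟨θ, U, hθ, hθs, hU, hTU, hUΩ, hθe⟩ := extend hTO hΩ hTOΩ hθC
  have hDθ : ∀ z ∈ T \ O, ∀ v, fderiv ℝ θ z v = ((z - p)⁻¹ * v).im := by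
    intro z hz v
    have e1 : θ =ᶠ[𝓝 z] fun z => (l z).im := by
      filter_upwards [hU.mem_nhds (hTU hz)] with y hy using hθe y hy
    rw [e1.fderiv_eq]
    have h3 : HasFDerivAt (fun y => (l y).im) _ z := Complex.imCLM.hasFDerivAt.comp z ((hld z (hTOΩ hz)).hasFDerivAt.restrictScalars ℝ)
    rw [h3.fderiv]
    simp [mul_comm]
  have hDf : ∀ z, z ∉ T \ O → fderiv ℝ f z = 0 := by
    intro z hz
    by_cases hzO : z ∈ O
    · have : f =ᶠ[𝓝 z] fun _ => 1 := by
        filter_upwards [hO.mem_nhds hzO] with y hy using h1 y hy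
      rw [this.fderiv_eq]; simp
    · have hzT : z ∉ T := fun h => hz ⟨h, hzO⟩
      have : f =ᶠ[𝓝 z] fun _ => 0 := by
        filter_upwards [hT.isClosed.isOpen_compl.mem_nhds hzT] with y hy using h0 y hy
      rw [this.fderiv_eq]; simp
  have e2 : ∀ z, fderiv ℝ f z (ker (z - p)) = fderiv ℝ f z 1 * fderiv ℝ θ z Complex.I - fderiv ℝ f z Complex.I * fderiv ℝ θ z 1 := by
    intro z
    by_cases hz : z ∈ T \ O
    · rw [hDθ z hz, hDθ z hz, apply_eq (fderiv ℝ f z) (ker (z - p))]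
      obtain ⟨q, hq⟩ : ∃ q, q = (z-p)⁻¹ := ⟨_, rfl⟩
      rw [ker, ← hq]
      simp
      ring
    · rw [hDf z hz]; simp
  simp only [e2] at ki
  have hθ1 : ContDiff ℝ 1 θ := hθ.of_le (by norm_num)
  have d1 := contDiff_fderiv_apply hf2 1
  have d2 := contDiff_fderiv_apply hf2 Complex.I
  have i1 := ibp d1 (fderiv_apply_compact hfs 1) hθ1 Complex.I
  have i2 := ibp d2 (fderiv_apply_compact hfs Complex.I) hθ1 1
  have hθD := hθ1.continuous_fderiv (by norm_num)
  have s1 : Integrable fun z => fderiv ℝ f z 1 * fderiv ℝ θ z Complex.I :=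
    (d1.continuous.mul (hθD.clm_apply continuous_const)).integrable_of_hasCompactSupport (fderiv_apply_compact hfs 1).mul_right
  have s2 : Integrable fun z => fderiv ℝ f z Complex.I * fderiv ℝ θ z 1 :=
    (d2.continuous.mul (hθD.clm_apply continuous_const)).integrable_of_hasCompactSupport (fderiv_apply_compact hfs _).mul_right
  rw [integral_sub s1 s2] at ki
  have sym : ∀ z, fderiv ℝ (fun z => fderiv ℝ f z 1) z Complex.I = fderiv ℝ (fun z => fderiv ℝ f z Complex.I) z 1 := by
    intro z
    have hs := (hf2.contDiffAt (x := z)).isSymmSndFDerivAt (by simp)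
    have hd : DifferentiableAt ℝ (fderiv ℝ f) z := (hf2.fderiv_right (m := 1) (by norm_num)).differentiable (by norm_num) z
    rw [fderiv_clm_apply hd (by fun_prop), fderiv_clm_apply hd (by fun_prop)]
    simpa using hs Complex.I 1
  simp only [sym] at i1
  have hπ := pi_pos
  linarith

end Bol

namespace Bol
open Set Filter Topology
open scoped Manifold ContDiff

lemma dini {E : ℝ → ℝ} {a b c : ℝ} (hab : a ≤ b) (hE : MonotoneOn E (Icc a b))
    (h : ∀ s ∈ Ico a b, ∃ t ∈ Ioc s b, c * (t - s) ≤ E t - E s) : c * (b - a) ≤ E b - E a := by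
  rcases lt_or_ge c 0 with hc | hc
  · have := hE (left_mem_Icc.2 hab) (right_mem_Icc.2 hab) hab
    nlinarith
  obtain ⟨S, hS⟩ : ∃ S, S = {x | x ∈ Icc a b ∧ c * (x - a) ≤ E x - E a} := ⟨_, rfl⟩
  have haS : a ∈ S := by rw [hS]; exact ⟨left_mem_Icc.2 hab, by simp⟩
  have hbd : BddAbove S := ⟨b, fun x hx => by rw [hS] at hx; exact hx.1.2⟩
  obtain ⟨M, hM⟩ : ∃ M, M = sSup S := ⟨_, rfl⟩
  have hlub : IsLUB S M := hM ▸ isLUB_csSup ⟨a, haS⟩ hbd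
  have hMI : M ∈ Icc a b := ⟨hlub.1 haS, hlub.2 fun x hx => by rw [hS] at hx; exact hx.1.2⟩
  have hMS : c * (M - a) ≤ E M - E a := by
    refine le_of_forall_pos_lt_add fun ε hε => ?_
    obtain ⟨x, hx, hx2, hx3⟩ := hlub.exists_between (b := M - ε / (c + 1)) (by have : 0 < ε / (c+1) := by positivity
                                                                               linarith)
    rw [hS] at hx
    have h1 := hE hx.1 hMI hx3
    have h2 := hx.2
    have h3 : c * (M - x) ≤ c * (ε / (c+1)) := mul_le_mul_of_nonneg_left (by linarith) hc
    have h4 : c * (ε / (c+1)) < ε := by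
      rw [← mul_div_assoc, div_lt_iff₀ (by linarith)]; nlinarith
    nlinarith
  rcases eq_or_lt_of_le hMI.2 with h0 | h0
  · rwa [h0] at hMS
  · obtain ⟨t, ht, h1⟩ := h M ⟨hMI.1, h0⟩
    have : t ∈ S := by rw [hS]; exact ⟨⟨hMI.1.trans ht.1.le, ht.2⟩, by linarith⟩
    exact absurd (hlub.1 this) (not_le.2 ht.1)

lemma dini_left {E : ℝ → ℝ} {a b c : ℝ} (hab : a ≤ b) (hE : MonotoneOn E (Icc a b))
    (h : ∀ s ∈ Ioc a b, ∃ t ∈ Ico a s, c * (s - t) ≤ E s - E t) : c * (b - a) ≤ E b - E a := by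
  have := dini (E := fun x => - E (-x)) (a := -b) (b := -a) (c := c) (by linarith) ?_ ?_
  · simp only [neg_neg] at this; linarith
  · intro x hx y hy hxy
    have := hE (a := -y) ⟨by linarith [hy.2], by linarith [hy.1]⟩ (b := -x) ⟨by linarith [hx.2], by linarith [hx.1]⟩ (by linarith)
    simp only; linarith
  · intro s hs
    obtain ⟨t, ht, h1⟩ := h (-s) ⟨by linarith [hs.2], by linarith [hs.1]⟩
    refine ⟨-t, ⟨by linarith [ht.2], by linarith [ht.1]⟩, ?_⟩
    simp only [neg_neg]; linarith

lemma fderiv_off {f : ℂ → ℝ} {T : Set ℂ} (hT : IsCompact T) (h0 : ∀ z, z ∉ T → f z = 0) {z : ℂ} (hz : z ∉ T) : fderiv ℝ f z = 0 := by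
  have : f =ᶠ[𝓝 z] fun _ => 0 := by
    filter_upwards [hT.isClosed.isOpen_compl.mem_nhds hz] with y hy using h0 y hy
  rw [this.fderiv_eq]; simp

lemma grad_int {Ω : Set ℂ} {g f : ℂ → ℝ} {T : Set ℂ} (hg : ContinuousOn g Ω) (hf : ContDiff ℝ 1 f)
    (hT : IsCompact T) (hTΩ : T ⊆ Ω) (h0 : ∀ z, z ∉ T → f z = 0) :
    Integrable fun z => ‖fderiv ℝ f z‖ * exp (g z / 2) := by
  have h1 : IntegrableOn (fun z => ‖fderiv ℝ f z‖ * exp (g z / 2)) T := by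
    refine ContinuousOn.integrableOn_compact hT ?_
    refine ((hf.continuous_fderiv (by norm_num)).norm.continuousOn).mul ?_
    exact continuous_exp.comp_continuousOn ((hg.mono hTΩ).div_const 2)
  refine h1.integrable_of_forall_notMem_eq_zero fun z hz => ?_
  rw [fderiv_off hT h0 hz]; simp

/-- left germ -/
lemma germ {Ω : Set ℂ} {g : ℂ → ℝ} (hΩ : IsOpen Ω) (hsc : IsSimplyConnected Ω) (hg : ContDiffOn ℝ 2 g Ω)
    (hlap : ∀ z ∈ Ω, 0 ≤ lap g z + exp (g z)) {f : ℂ → ℝ} (hf : ContDiff ℝ 1 f) {T : Set ℂ}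
    (hT : IsCompact T) (hTΩ : T ⊆ Ω) (h0 : ∀ z, z ∉ T → f z = 0) {s ε : ℝ} (hs : 0 < s) (hε : 0 < ε) (hε1 : ε < 1) :
    ∃ δ₀ > 0, ∀ δ, 0 < δ → δ < δ₀ → exp (-ε) * ((1 - ε) / (1 + ε)) * pp (∫ z in hull {z | s ≤ f z}, exp (g z)) * δ ≤
      (∫ z in ub {z | s ≤ f z}, ‖fderiv ℝ f z‖ * exp (g z / 2)) - ∫ z in ub {z | s - δ ≤ f z}, ‖fderiv ℝ f z‖ * exp (g z / 2) := by
  have hKc : ∀ r > 0, IsCompact {z | r ≤ f z} := by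
    intro r hr
    refine hT.of_isClosed_subset (isClosed_le continuous_const hf.continuous) fun z hz => ?_
    by_contra h
    have : r ≤ f z := hz
    rw [h0 z h] at this; linarith
  have hKT : ∀ r > 0, {z | r ≤ f z} ⊆ T := by
    intro r hr z hz
    by_contra h
    have : r ≤ f z := hz
    rw [h0 z h] at this; linarith
  have hK := hKc s hs
  obtain ⟨K, hKe⟩ : ∃ K, K = {z | s ≤ f z} := ⟨_, rfl⟩
  rw [← hKe] at hK ⊢
  have hKΩ : K ⊆ Ω := by rw [hKe]; exact (hKT s hs).trans hTΩ
  have hH := hull_compact hK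
  have hHΩ := fill hΩ hsc hK hKΩ
  obtain ⟨N, hNo, hfN, hNΩ, hB⟩ := BOL hΩ hg hlap hH hHΩ (by rw [hull_compl]; exact ub_connected hK) hε
  have hfr := frontier_hull hK
  -- the compact set
  obtain ⟨M, hMs, hMz⟩ : ∃ M < s, ∀ z ∈ ub K, M < f z → z ∈ N := by
    have hC : IsCompact ((closure (ub K) ∩ {z | s / 2 ≤ f z}) \ N) :=
      ((hKc (s/2) (by linarith)).inter_left isClosed_closure).diff hNo
    have hlt : ∀ z ∈ (closure (ub K) ∩ {z | s / 2 ≤ f z}) \ N, f z < s := by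
      intro z hz
      by_contra h
      have hzK : z ∈ K := by rw [hKe]; exact not_lt.1 h
      apply hz.2
      apply hfN
      rw [← frontier_compl, hull_compl, (ub_open hK).frontier_eq]
      exact ⟨hz.1.1, fun h' => ub_subset K h' hzK⟩
    rcases ((closure (ub K) ∩ {z | s / 2 ≤ f z}) \ N).eq_empty_or_nonempty with he | hne
    · refine ⟨s/2, by linarith, fun z hz h1 => ?_⟩
      by_contra h
      have : z ∈ (closure (ub K) ∩ {z | s / 2 ≤ f z}) \ N := ⟨⟨subset_closure hz, h1.le⟩, h⟩
      rw [he] at this; exact this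
    · obtain ⟨y, hy, hm⟩ := hC.exists_isMaxOn hne hf.continuous.continuousOn
      refine ⟨max (s/2) (f y), max_lt (by linarith) (hlt y hy), fun z hz h1 => ?_⟩
      by_contra h
      have hz' : z ∈ (closure (ub K) ∩ {z | s / 2 ≤ f z}) \ N := ⟨⟨subset_closure hz, (le_max_left _ _).trans h1.le⟩, h⟩
      have : f z ≤ f y := hm hz'
      exact absurd ((le_max_right _ _).trans_lt h1) (not_lt.2 this)
  refine ⟨min (s/2) (s - M), lt_min (by linarith) (by linarith), fun δ hδ hδ2 => ?_⟩
  have hδs : δ < s / 2 := hδ2.trans_le (min_le_left _ _)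
  have hδM : δ < s - M := hδ2.trans_le (min_le_right _ _)
  have hεδ : 0 < ε * δ := mul_pos hε hδ
  have hεδ2 : ε * δ < δ := by nlinarith
  obtain ⟨χ, hχ, hχ0, hχ1, hχp, hχd, hχz, hχn, hχl⟩ := clamp (a := s - δ) (b := s - ε * δ) (η := ε) (by linarith) hε
  classical
  obtain ⟨F, hF⟩ : ∃ F : ℂ → ℝ, ∀ z, F z = if z ∈ ub K then χ (f z) else 1 := ⟨_, fun _ => rfl⟩
  have hF1 : ∀ z ∈ ub K, F z = χ (f z) := fun z hz => by rw [hF, if_pos hz]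
  have hF2 : ∀ z, z ∉ ub K → F z = 1 := fun z hz => by rw [hF, if_neg hz]
  have hoB : IsOpen (interior (hull K) ∪ {z | s - ε * δ < f z}) := isOpen_interior.union (isOpen_lt continuous_const hf.continuous)
  have hFB : ∀ z ∈ interior (hull K) ∪ {z | s - ε * δ < f z}, F z = 1 := by
    rintro z (hz | hz)
    · exact hF2 z (interior_subset hz)
    · by_cases h : z ∈ ub K
      · rw [hF1 z h, hχ1 _ (le_of_lt hz)]
      · exact hF2 z h
  have hcov : ∀ z, z ∈ ub K ∨ z ∈ interior (hull K) ∪ {z | s - ε * δ < f z} := by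
    intro z
    by_cases h : z ∈ ub K
    · exact Or.inl h
    · right
      have hzH : z ∈ hull K := h
      by_cases hi : z ∈ interior (hull K)
      · exact Or.inl hi
      · right
        have : z ∈ K := hfr ⟨subset_closure hzH, hi⟩
        rw [hKe] at this
        have : s ≤ f z := this
        show s - ε * δ < f z
        linarith
  have hFC : ContDiff ℝ 1 F := by
    refine contDiff_of_cover (ub_open hK) hoB hcov ?_ ?_
    · exact (hχ.comp hf).contDiffOn.congr fun z hz => hF1 z hz
    · exact contDiffOn_const.congr fun z hz => hFB z hz
  have hFs : ∀ z, z ∉ hull K ∪ T → F z = 0 := by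
    intro z hz
    have h1 : z ∈ ub K := by by_contra h; exact hz (Or.inl h)
    rw [hF1 z h1, h0 z (fun h => hz (Or.inr h)), hχ0 _ (by linarith)]
  have key := hB F hFC (HasCompactSupport.intro (hH.union hT) hFs)
    (fun z => by rw [hF]; split_ifs <;> simp [hχn]) (fun z => by rw [hF]; split_ifs <;> simp [hχl])
    (fun z hz => hF2 z hz) (fun z hz hzN => by
      have h1 : z ∈ ub K := by by_contra h; exact hz h
      rw [hF1 z h1]
      apply hχ0
      by_contra h
      exact hzN (hMz z h1 (by linarith)))
  have hgc := hg.continuousOn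
  have hI := grad_int hgc hf hT hTΩ h0
  have hKa : IsCompact {z | s - δ ≤ f z} := hKc _ (by linarith)
  have hsub : ub {z | s - δ ≤ f z} ⊆ ub K := by
    apply ub_anti hKa
    rw [hKe]; intro z hz
    have : s ≤ f z := hz
    show s - δ ≤ f z
    linarith
  rw [← setIntegral_sdiff (ub_open hKa).measurableSet hI.integrableOn hsub]
  have hms : MeasurableSet (ub K \ ub {z | s - δ ≤ f z}) := (ub_open hK).measurableSet.diff (ub_open hKa).measurableSet
  have hQ : 0 < (1 - ε) * δ := by nlinarith
  have hle : ∫ z, ‖fderiv ℝ F z‖ * exp (g z / 2) ≤ ∫ z, (ub K \ ub {z | s - δ ≤ f z}).indicator (fun z => (1 + ε) / ((1 - ε) * δ) * (‖fderiv ℝ f z‖ * exp (g z / 2))) z := by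
    refine integral_mono_of_nonneg (ae_of_all _ fun z => by positivity) ((hI.const_mul _).indicator hms) (ae_of_all _ fun z => ?_)
    simp only
    by_cases h : z ∈ ub K
    · have e1 : F =ᶠ[𝓝 z] fun z => χ (f z) := by
        filter_upwards [(ub_open hK).mem_nhds h] with y hy using hF1 y hy
      have hd : HasFDerivAt (fun z => χ (f z)) (deriv χ (f z) • fderiv ℝ f z) z :=
        ((hχ.differentiable (by norm_num) (f z)).hasDerivAt).comp_hasFDerivAt z (hf.differentiable (by norm_num) z).hasFDerivAt
      rw [e1.fderiv_eq, hd.fderiv, norm_smul, Real.norm_of_nonneg (hχp _)]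
      by_cases h2 : f z ≤ s - δ
      · rw [hχz _ (Or.inl h2)]
        simp only [zero_mul]
        exact indicator_nonneg (fun y _ => by have : 0 < 1 - ε := by linarith
                                              positivity) _
      · rw [indicator_of_mem]
        · rw [mul_assoc]
          refine mul_le_mul_of_nonneg_right ?_ (by positivity)
          have := hχd (f z)
          rwa [show s - ε * δ - (s - δ) = (1 - ε) * δ by ring] at this
        · exact ⟨h, fun h' => ub_subset _ h' (not_le.1 h2).le⟩
    · have e1 : F =ᶠ[𝓝 z] fun z => 1 := by
        filter_upwards [hoB.mem_nhds ((hcov z).resolve_left h)] with y hy using hFB y hy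
      rw [e1.fderiv_eq]
      simp only [fderiv_fun_const, Pi.zero_apply, norm_zero, zero_mul]
      exact indicator_nonneg (fun y _ => by have : 0 < 1 - ε := by linarith
                                            positivity) _
  rw [integral_indicator hms, integral_const_mul] at hle
  have h3 := key.trans hle
  rw [div_mul_eq_mul_div, le_div_iff₀ hQ] at h3
  rw [show exp (-ε) * ((1 - ε) / (1 + ε)) * pp (∫ z in hull K, exp (g z)) * δ = (exp (-ε) * pp (∫ z in hull K, exp (g z)) * ((1 - ε) * δ)) / (1 + ε) by ring,
    div_le_iff₀ (by linarith)]
  linarith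

lemma TOL {Ω : Set ℂ} {g : ℂ → ℝ} (hΩ : IsOpen Ω) (hsc : IsSimplyConnected Ω) (hg : ContDiffOn ℝ 2 g Ω)
    (hlap : ∀ z ∈ Ω, 0 ≤ lap g z + exp (g z)) {f : ℂ → ℝ} (hf : ContDiff ℝ 1 f) {T : Set ℂ}
    (hT : IsCompact T) (hTΩ : T ⊆ Ω) (h0 : ∀ z, z ∉ T → f z = 0) {c : ℝ} (hc0 : 0 ≤ c)
    (hc : ∀ s, 0 < s → s < 1 → c ≤ pp (∫ z in hull {z | s ≤ f z}, exp (g z))) :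
    c ≤ ∫ z, ‖fderiv ℝ f z‖ * exp (g z / 2) := by
  have hI := grad_int hg.continuousOn hf hT hTΩ h0
  have hKc : ∀ r > 0, IsCompact {z | r ≤ f z} := by
    intro r hr
    refine hT.of_isClosed_subset (isClosed_le continuous_const hf.continuous) fun z hz => ?_
    by_contra h
    have : r ≤ f z := hz
    rw [h0 z h] at this; linarith
  obtain ⟨E, hE⟩ : ∃ E : ℝ → ℝ, ∀ s, E s = ∫ z in ub {z | s ≤ f z}, ‖fderiv ℝ f z‖ * exp (g z / 2) := ⟨_, fun _ => rfl⟩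
  have main : ∀ ε : ℝ, 0 < ε → ε < 1/2 → exp (-ε) * ((1 - ε) / (1 + ε)) * c * (1 - 2 * ε) ≤ ∫ z, ‖fderiv ℝ f z‖ * exp (g z / 2) := by
    intro ε hε hε2
    have hθ : 0 ≤ exp (-ε) * ((1 - ε) / (1 + ε)) := by
      have : 0 < 1 - ε := by linarith
      positivity
    have := dini_left (E := E) (a := ε) (b := 1 - ε) (c := exp (-ε) * ((1 - ε) / (1 + ε)) * c) (by linarith) ?_ ?_
    · have h1 : 0 ≤ E ε := by rw [hE]; exact integral_nonneg fun z => by positivity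
      have h2 : E (1 - ε) ≤ ∫ z, ‖fderiv ℝ f z‖ * exp (g z / 2) := by
        rw [hE]; exact setIntegral_le_integral hI (ae_of_all _ fun z => by positivity)
      rw [show 1 - 2 * ε = 1 - ε - ε by ring]
      linarith
    · intro x hx y hy hxy
      rw [hE, hE]
      refine setIntegral_mono_set hI.integrableOn (ae_of_all _ fun z => by positivity) (Eventually.of_forall ?_)
      apply ub_anti (hKc x (by linarith [hx.1]))
      intro z hz
      exact hxy.trans hz
    · intro s hs
      obtain ⟨δ₀, hδ₀, h⟩ := germ hΩ hsc hg hlap hf hT hTΩ h0 (s := s) (ε := ε) (by linarith [hs.1]) hε (by linarith)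
      have hδ : 0 < min (δ₀ / 2) (s - ε) := lt_min (by linarith) (by linarith [hs.1])
      have h1 := h _ hδ ((min_le_left _ _).trans_lt (by linarith))
      refine ⟨s - min (δ₀ / 2) (s - ε), ⟨by linarith [min_le_right (δ₀ / 2) (s - ε)], by linarith⟩, ?_⟩
      rw [hE, hE]
      refine le_trans ?_ h1
      rw [sub_sub_cancel]
      refine mul_le_mul_of_nonneg_right ?_ hδ.le
      exact mul_le_mul_of_nonneg_left (hc s (by linarith [hs.1]) (by linarith [hs.2])) hθ
  have hlim : Tendsto (fun ε : ℝ => exp (-ε) * ((1 - ε) / (1 + ε)) * c * (1 - 2 * ε)) (𝓝[>] 0) (𝓝 (exp (-0) * ((1 - 0) / (1 + 0)) * c * (1 - 2 * 0))) := by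
    refine Tendsto.mono_left ?_ nhdsWithin_le_nhds
    have : ContinuousAt (fun ε : ℝ => exp (-ε) * ((1 - ε) / (1 + ε)) * c * (1 - 2 * ε)) 0 := by
      have h1 : ContinuousAt (fun ε : ℝ => (1 - ε) / (1 + ε)) 0 := ContinuousAt.div (by fun_prop) (by fun_prop) (by norm_num)
      have h2 : ContinuousAt (fun ε : ℝ => exp (-ε)) 0 := by fun_prop
      exact ((h2.mul h1).mul continuousAt_const).mul (by fun_prop)
    exact this
  simp only [neg_zero, exp_zero, sub_zero, add_zero, mul_zero, mul_one, div_one, one_mul] at hlim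
  refine le_of_tendsto hlim ?_
  filter_upwards [Ioo_mem_nhdsGT (show (0:ℝ) < 1/2 by norm_num)] with ε hε using main ε hε.1 hε.2

end Bol

namespace Bol
open Set Filter Topology
open scoped Manifold ContDiff

/-- weighted area -/
noncomputable def ms (g : ℂ → ℝ) (S : Set ℂ) : ℝ := ∫ z in S, exp (g z)

lemma ms_nonneg (g : ℂ → ℝ) (S : Set ℂ) : 0 ≤ ms g S := integral_nonneg fun z => (exp_pos _).le

lemma ms_mono {g : ℂ → ℝ} {Ω S S' : Set ℂ} (hi : IntegrableOn (fun z => exp (g z)) Ω) (h : S ⊆ S') (h' : S' ⊆ Ω) : ms g S ≤ ms g S' :=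
  setIntegral_mono_set (hi.mono_set h') (ae_of_all _ fun z => (exp_pos _).le) (Eventually.of_forall h)

lemma ms_diff {g : ℂ → ℝ} {Ω S S' : Set ℂ} (hi : IntegrableOn (fun z => exp (g z)) Ω) (hS : MeasurableSet S) (h : S ⊆ S') (h' : S' ⊆ Ω) : ms g (S' \ S) = ms g S' - ms g S :=
  setIntegral_sdiff hS (hi.mono_set h') h

lemma pp_nonneg (x : ℝ) : 0 ≤ pp x := Real.sqrt_nonneg _

lemma pp_cont : Continuous pp := by unfold pp; fun_prop

lemma pp_mono {x y : ℝ} (hx : 0 ≤ x) (hxy : x ≤ y) (hy : y ≤ 4 * π) : pp x ≤ pp y := by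
  unfold pp
  apply Real.sqrt_le_sqrt
  nlinarith

lemma sqrt_add_le' {a b : ℝ} (ha : 0 ≤ a) (hb : 0 ≤ b) : √(a + b) ≤ √a + √b := by
  rw [Real.sqrt_le_left (by positivity)]
  nlinarith [Real.sq_sqrt ha, Real.sq_sqrt hb, Real.sqrt_nonneg a, Real.sqrt_nonneg b, mul_nonneg (Real.sqrt_nonneg a) (Real.sqrt_nonneg b)]

lemma pp_sub {x y a : ℝ} (hy : 0 ≤ y) (hyx : y ≤ x) (hx : x ≤ 8 * π) (ha : 0 ≤ a) (h1 : a ≤ x - y) (h2 : x - y ≤ 4 * π) : pp a ≤ pp x + pp y := by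
  refine (pp_mono ha h1 h2).trans ?_
  have q1 : 0 ≤ x * (8 * π - x) / 2 := by nlinarith
  have q2 : 0 ≤ y * (8 * π - y) / 2 := by nlinarith
  refine le_trans ?_ (sqrt_add_le' q1 q2)
  unfold pp
  apply Real.sqrt_le_sqrt
  nlinarith

lemma pp_add {x y : ℝ} (hx : 0 ≤ x) (hy : 0 ≤ y) (h : x + y ≤ 8 * π) : pp (x + y) ≤ pp x + pp y := by
  have q1 : 0 ≤ x * (8 * π - x) / 2 := by nlinarith
  have q2 : 0 ≤ y * (8 * π - y) / 2 := by nlinarith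
  refine le_trans ?_ (sqrt_add_le' q1 q2)
  unfold pp
  apply Real.sqrt_le_sqrt
  nlinarith

lemma frontier_hull_nonempty {C : Set ℂ} (hC : IsCompact C) (hne : C.Nonempty) : (frontier (ub C)).Nonempty := by
  rw [← hull_compl, frontier_compl]
  apply nonempty_frontier_iff.2
  refine ⟨hne.mono (subset_hull C), fun h => ?_⟩
  have h1 := hull_compl C
  rw [h, compl_univ] at h1
  have := (ub_connected hC).nonempty
  rw [← h1] at this
  exact not_nonempty_empty this

lemma ub_union_connected {C : Set ℂ} (hC : IsCompact C) (hc : IsConnected C) : IsPreconnected (ub C ∪ C) := by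
  obtain ⟨p, hp⟩ := frontier_hull_nonempty hC hc.nonempty
  have hpC : p ∈ C := by
    apply frontier_hull hC
    rwa [← frontier_compl, hull_compl]
  have h1 : IsPreconnected (insert p (ub C)) :=
    (ub_connected hC).isPreconnected.subset_closure (subset_insert _ _) (insert_subset hp.1 subset_closure)
  have := h1.union p (mem_insert _ _) hpC hc.isPreconnected
  convert this using 1
  ext z; simp only [mem_union, mem_insert_iff]
  constructor
  · tauto
  · rintro ((rfl | h) | h) <;> tauto

lemma split {Ω : Set ℂ} {g : ℂ → ℝ} (hΩ : IsOpen Ω) (hsc : IsSimplyConnected Ω) (hg : ContDiffOn ℝ 2 g Ω)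
    (hlap : ∀ z ∈ Ω, 0 ≤ lap g z + exp (g z)) (hi : IntegrableOn (fun z => exp (g z)) Ω) (hb : ms g Ω ≤ 8 * π)
    {U C O D : Set ℂ} (hUo : IsOpen U) (hUΩ : U ⊆ Ω) (hC : IsCompact C) (hCc : IsConnected C) {F : ℂ → ℝ} (hF : ContDiff ℝ 1 F)
    (hF1 : ∀ z, F z ≤ 1) (hO : IsOpen O) (hCO : C ⊆ O) (hFO : ∀ z ∈ O, F z = 1) (hD : IsCompact D) (hDU : D ⊆ U)
    (hFD : ∀ z, z ∉ D → F z = 0) (hM : ms g (hull (hull C ∪ D)) - ms g (hull C) + ms g U ≤ 4 * π) :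
    pp (ms g C) ≤ ∫ z, ‖fderiv ℝ F z‖ * exp (g z / 2) := by
  have hCU : C ⊆ U := fun z hz => hDU (by by_contra h; have := hFO z (hCO hz); rw [hFD z h] at this; norm_num at this)
  have hH := hull_compact hC
  have hHΩ := fill hΩ hsc hC (hCU.trans hUΩ)
  have hfr := frontier_hull hC
  have hYo := ub_open hC
  classical
  obtain ⟨f0, hf0⟩ : ∃ f : ℂ → ℝ, ∀ z, f z = if z ∈ ub C then F z else 1 := ⟨_, fun _ => rfl⟩
  obtain ⟨f1, hf1⟩ : ∃ f : ℂ → ℝ, ∀ z, f z = if z ∈ ub C then 0 else 1 - F z := ⟨_, fun _ => rfl⟩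
  have hcov : ∀ z, z ∈ ub C ∨ z ∈ interior (hull C) ∪ O := by
    intro z
    by_cases h : z ∈ ub C
    · exact Or.inl h
    · right
      have hzH : z ∈ hull C := h
      by_cases hi : z ∈ interior (hull C)
      · exact Or.inl hi
      · exact Or.inr (hCO (hfr ⟨subset_closure hzH, hi⟩))
  have hf0B : ∀ z ∈ interior (hull C) ∪ O, f0 z = 1 := by
    rintro z (hz | hz)
    · rw [hf0, if_neg (interior_subset hz)]
    · rw [hf0]; split_ifs
      · exact hFO z hz
      · rfl
  have hf1B : ∀ z ∈ ub C ∪ O, f1 z = 0 := by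
    rintro z (hz | hz)
    · rw [hf1, if_pos hz]
    · rw [hf1]; split_ifs
      · rfl
      · rw [hFO z hz]; simp
  have hf0A : ∀ z ∈ ub C, f0 z = F z := fun z hz => by rw [hf0, if_pos hz]
  have hf1A : ∀ z ∈ interior (hull C), f1 z = 1 - F z := fun z hz => by rw [hf1, if_neg (interior_subset hz)]
  have hcov2 : ∀ z, z ∈ interior (hull C) ∨ z ∈ ub C ∪ O := by
    intro z
    rcases hcov z with h | h | h
    · exact Or.inr (Or.inl h)
    · exact Or.inl h
    · exact Or.inr (Or.inr h)
  have hf0C : ContDiff ℝ 1 f0 :=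
    contDiff_of_cover hYo (isOpen_interior.union hO) hcov (hF.contDiffOn.congr hf0A) (contDiffOn_const.congr hf0B)
  have hf1C : ContDiff ℝ 1 f1 :=
    contDiff_of_cover isOpen_interior (hYo.union hO) hcov2 ((contDiff_const.sub hF).contDiffOn.congr hf1A) (contDiffOn_const.congr hf1B)
  have hgc := hg.continuousOn
  have hDΩ := hDU.trans hUΩ
  have hT0 := hH.union hD
  have hT0Ω : hull C ∪ D ⊆ Ω := union_subset hHΩ hDΩ
  have hs0 : ∀ z, z ∉ hull C ∪ D → f0 z = 0 := by
    intro z hz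
    have h1 : z ∈ ub C := by by_contra h; exact hz (Or.inl h)
    rw [hf0A z h1, hFD z fun h => hz (Or.inr h)]
  have hs1 : ∀ z, z ∉ hull C → f1 z = 0 := by
    intro z hz
    have h1 : z ∈ ub C := by by_contra h; exact hz h
    exact hf1B z (Or.inl h1)
  have i0 := grad_int hgc hf0C hT0 hT0Ω hs0
  have i1 := grad_int hgc hf1C hH hHΩ hs1
  have iF := grad_int hgc hF hD hDΩ hFD
  have hsum : (∫ z, ‖fderiv ℝ f0 z‖ * exp (g z / 2)) + (∫ z, ‖fderiv ℝ f1 z‖ * exp (g z / 2)) ≤ ∫ z, ‖fderiv ℝ F z‖ * exp (g z / 2) := by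
    rw [← integral_add i0 i1]
    refine integral_mono (i0.add i1) iF fun z => ?_
    simp only [Pi.add_apply]
    rw [← add_mul]
    refine mul_le_mul_of_nonneg_right ?_ (exp_pos _).le
    rcases hcov z with h | h | h
    · have e0 : f0 =ᶠ[𝓝 z] F := by filter_upwards [hYo.mem_nhds h] with y hy using hf0A y hy
      have e1 : f1 =ᶠ[𝓝 z] fun _ => 0 := by filter_upwards [hYo.mem_nhds h] with y hy using hf1B y (Or.inl hy)
      rw [e0.fderiv_eq, e1.fderiv_eq]; simp
    · have e0 : f0 =ᶠ[𝓝 z] fun _ => 1 := by filter_upwards [isOpen_interior.mem_nhds h] with y hy using hf0B y (Or.inl hy)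
      have e1 : f1 =ᶠ[𝓝 z] fun y => 1 - F y := by filter_upwards [isOpen_interior.mem_nhds h] with y hy using hf1A y hy
      rw [e0.fderiv_eq, e1.fderiv_eq, fderiv_const_sub]; simp
    · have e0 : f0 =ᶠ[𝓝 z] fun _ => 1 := by filter_upwards [hO.mem_nhds h] with y hy using hf0B y (Or.inr hy)
      have e1 : f1 =ᶠ[𝓝 z] fun _ => 0 := by filter_upwards [hO.mem_nhds h] with y hy using hf1B y (Or.inr hy)
      rw [e0.fderiv_eq, e1.fderiv_eq]; simp
  -- mass ranges
  have hx : ∀ s, 0 < s → s < 1 → ms g (hull {z | s ≤ f0 z}) ∈ Icc (ms g (hull C)) (ms g (hull (hull C ∪ D))) := by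
    intro s hs hs1
    have hsub : {z | s ≤ f0 z} ⊆ hull C ∪ D := by
      intro z hz
      by_contra h
      have : s ≤ f0 z := hz
      rw [hs0 z h] at this; linarith
    have hKc : IsCompact {z | s ≤ f0 z} := hT0.of_isClosed_subset (isClosed_le continuous_const hf0C.continuous) hsub
    refine ⟨ms_mono hi ?_ (fill hΩ hsc hKc (hsub.trans hT0Ω)), ms_mono hi (hull_mono hT0 hsub) (fill hΩ hsc hT0 hT0Ω)⟩
    refine Subset.trans ?_ (subset_hull _)
    intro z hz
    show s ≤ f0 z
    rw [hf0, if_neg hz]; exact hs1.le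
  have hy : ∀ s, 0 < s → s < 1 → ms g (hull {z | s ≤ f1 z}) ∈ Icc (ms g (hull C \ U)) (ms g (hull C \ C)) := by
    intro s hs hs2
    have hsub : {z | s ≤ f1 z} ⊆ hull C := by
      intro z hz
      by_contra h
      have : s ≤ f1 z := hz
      rw [hs1 z h] at this; linarith
    have hKc : IsCompact {z | s ≤ f1 z} := hH.of_isClosed_subset (isClosed_le continuous_const hf1C.continuous) hsub
    refine ⟨ms_mono hi ?_ (fill hΩ hsc hKc (hsub.trans hHΩ)), ms_mono hi ?_ (diff_subset.trans hHΩ)⟩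
    · refine Subset.trans ?_ (subset_hull _)
      intro z hz
      show s ≤ f1 z
      rw [hf1, if_neg hz.1, hFD z fun h => hz.2 (hDU h)]; linarith
    · have h1 : ub C ∪ C ⊆ ub {z | s ≤ f1 z} := by
        refine subset_ub (ub_union_connected hC hCc) (fun h => ub_unbounded hC (h.subset subset_union_left)) ?_
        rintro z hz h
        have h : s ≤ f1 z := h
        rw [hf1B z (hz.imp id fun h => hCO h)] at h; linarith
      intro z hz
      have : z ∉ ub C ∪ C := fun h => hz (h1 h)
      exact ⟨fun h => this (Or.inl h), fun h => this (Or.inr h)⟩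
  have hne0 := hx (1/2) (by norm_num) (by norm_num)
  have hne1 := hy (1/2) (by norm_num) (by norm_num)
  obtain ⟨x, hxI, hxm⟩ := isCompact_Icc.exists_isMinOn ⟨_, hne0⟩ pp_cont.continuousOn
  obtain ⟨y, hyI, hym⟩ := isCompact_Icc.exists_isMinOn ⟨_, hne1⟩ pp_cont.continuousOn
  have t0 := TOL hΩ hsc hg hlap hf0C hT0 hT0Ω hs0 (pp_nonneg x) (fun s hs hs1 => hxm (hx s hs hs1))
  have t1 := TOL hΩ hsc hg hlap hf1C hH hHΩ hs1 (pp_nonneg y) (fun s hs hs1 => hym (hy s hs hs1))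
  refine le_trans ?_ ((add_le_add t0 t1).trans hsum)
  have d1 : ms g (hull C \ C) = ms g (hull C) - ms g C := ms_diff hi hC.isClosed.measurableSet (subset_hull C) hHΩ
  have d2 : ms g (hull C) - ms g U ≤ ms g (hull C \ U) := by
    have e1 := ms_diff (S := hull C ∩ U) hi (hH.isClosed.measurableSet.inter hUo.measurableSet) inter_subset_left hHΩ
    rw [diff_self_inter] at e1
    have e2 := ms_mono (S := hull C ∩ U) hi inter_subset_right hUΩ
    linarith
  have d3 := ms_mono (S := hull (hull C ∪ D)) hi (fill hΩ hsc hT0 hT0Ω) le_rfl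
  have d4 := ms_nonneg g C
  have d5 := ms_nonneg g (hull C \ U)
  refine pp_sub ?_ ?_ ?_ d4 ?_ ?_
  · linarith [hyI.1]
  · linarith [hyI.2, hxI.1]
  · linarith [hxI.2]
  · linarith [hyI.2, hxI.1]
  · linarith [hyI.1, hxI.2]

lemma exhaust {φ : ℂ → ℝ} (hφ : Continuous φ) {t : ℝ} {x₀ : ℂ} (hx : t < φ x₀) :
    ∃ (V : ℕ → Set ℂ) (r : ℕ → ℝ), (∀ n, 0 < r n) ∧ (∀ n, IsOpen (V n)) ∧ Monotone V ∧ (∀ n, IsConnected (V n)) ∧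
      (∀ n, ∀ z ∈ closure (V n), t + r n ≤ φ z) ∧ (∀ n, closure (V n) ⊆ connectedComponentIn {z | t < φ z} x₀) ∧
      ∀ D ⊆ connectedComponentIn {z | t < φ z} x₀, IsCompact D → ∃ n, D ⊆ V n := by
  obtain ⟨r, hr⟩ : ∃ r : ℕ → ℝ, ∀ n, r n = (φ x₀ - t) / (n + 2) := ⟨_, fun _ => rfl⟩
  have hr0 : ∀ n, 0 < r n := fun n => by rw [hr]; have : 0 < φ x₀ - t := by linarith
                                         positivity
  have hrm : ∀ n m, n ≤ m → r m ≤ r n := by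
    intro n m h
    rw [hr, hr]
    have h1 : (n : ℝ) ≤ m := by exact_mod_cast h
    have h2 : 0 ≤ φ x₀ - t := by linarith
    gcongr
  have hx0 : ∀ n, x₀ ∈ {z | t + r n < φ z} := by
    intro n
    show t + r n < φ x₀
    rw [hr]
    have : (φ x₀ - t) / ((n:ℝ) + 2) < φ x₀ - t := by
      rw [div_lt_iff₀ (by positivity)]
      have : (0:ℝ) ≤ n := by positivity
      nlinarith
    linarith
  have hcl : ∀ n, ∀ z ∈ closure (connectedComponentIn {z | t + r n < φ z} x₀), t + r n ≤ φ z := by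
    intro n z hz
    have h1 : closure (connectedComponentIn {z | t + r n < φ z} x₀) ⊆ {z | t + r n ≤ φ z} :=
      closure_minimal ((connectedComponentIn_subset _ _).trans fun z (hz : t + r n < φ z) => hz.le) (isClosed_le continuous_const hφ)
    exact h1 hz
  have ho : ∀ n, IsOpen (connectedComponentIn {z | t + r n < φ z} x₀) := fun n => (isOpen_lt continuous_const hφ).connectedComponentIn
  have hmono : Monotone fun n => connectedComponentIn {z | t + r n < φ z} x₀ := by
    intro n m h
    refine connectedComponentIn_mono _ fun z (hz : t + r n < φ z) => ?_
    show t + r m < φ z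
    linarith [hrm n m h]
  refine ⟨fun n => connectedComponentIn {z | t + r n < φ z} x₀, r, hr0, ho, hmono,
    fun n => isConnected_connectedComponentIn_iff.2 (hx0 n), hcl, ?_, ?_⟩
  · intro n
    refine (isPreconnected_connectedComponentIn.closure).subset_connectedComponentIn (subset_closure (mem_connectedComponentIn (hx0 n))) ?_
    intro z hz
    show t < φ z
    linarith [hcl n z hz, hr0 n]
  · intro D hD hDc
    refine hDc.elim_directed_cover _ ho ?_ (directed_of_isDirected_le hmono)
    intro z hz
    have hUo : IsOpen (connectedComponentIn {z | t < φ z} x₀) := (isOpen_lt continuous_const hφ).connectedComponentIn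
    have hUc : IsConnected (connectedComponentIn {z | t < φ z} x₀) := isConnected_connectedComponentIn_iff.2 hx
    have hp := (hUo.isConnected_iff_isPathConnected.1 hUc).joinedIn x₀ (mem_connectedComponentIn hx) z (hD hz)
    obtain ⟨γ, hγ⟩ := hp
    have hcomp : IsCompact (range γ) := isCompact_range γ.continuous
    obtain ⟨y, hy, hm⟩ := hcomp.exists_isMinOn ⟨_, mem_range_self 0⟩ hφ.continuousOn
    have hyt : t < φ y := by
      obtain ⟨u, rfl⟩ := hy
      have h1 : γ u ∈ {z | t < φ z} := connectedComponentIn_subset _ _ (hγ u)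
      exact h1
    have hlim : Tendsto r atTop (𝓝 0) := by
      have : r = fun n : ℕ => (φ x₀ - t) / (n + 2) := funext hr
      rw [this]
      exact tendsto_const_nhds.div_atTop (tendsto_natCast_atTop_atTop.atTop_add tendsto_const_nhds)
    obtain ⟨n, hn⟩ := (hlim.eventually (gt_mem_nhds (show 0 < φ y - t by linarith))).exists
    refine mem_iUnion.2 ⟨n, ?_⟩
    have hsub : range γ ⊆ connectedComponentIn {z | t + r n < φ z} x₀ := by
      refine (isPreconnected_range γ.continuous).subset_connectedComponentIn ⟨0, by simp⟩ ?_
      intro w hw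
      have : φ y ≤ φ w := hm hw
      show t + r n < φ w
      linarith
    exact hsub ⟨1, by simp⟩

end Bol

namespace Bol
open Set Filter Topology
open scoped Manifold ContDiff

lemma hull_hull {C D : Set ℂ} (hC : IsCompact C) (h : D ⊆ hull C) (hD : IsCompact D) : hull D ⊆ hull C := by
  apply compl_subset_compl.2
  refine subset_ub (ub_connected hC).isPreconnected (ub_unbounded hC) ?_
  intro z hz hzD
  exact h hzD hz

lemma eps_exists {c p : ℝ} (h : c < p) : ∃ ε : ℝ, 0 < ε ∧ ε < 1 ∧ c * (1 + ε) / (1 - ε) ≤ p := by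
  have hc : ContinuousAt (fun ε : ℝ => c * (1 + ε) / (1 - ε)) 0 := ContinuousAt.div (by fun_prop) (by fun_prop) (by norm_num)
  have h1 : Tendsto (fun ε : ℝ => c * (1 + ε) / (1 - ε)) (𝓝[>] 0) (𝓝 c) := by
    have := hc.tendsto
    simp only [add_zero, mul_one, sub_zero, div_one] at this
    exact this.mono_left nhdsWithin_le_nhds
  obtain ⟨ε, h2, h3⟩ := ((h1.eventually (gt_mem_nhds h)).and (Ioo_mem_nhdsGT (show (0:ℝ) < 1 by norm_num))).exists
  exact ⟨ε, h3.1, h3.2, h2.le⟩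

lemma comp_germ {Ω : Set ℂ} {g : ℂ → ℝ} (hΩ : IsOpen Ω) (hsc : IsSimplyConnected Ω) (hg : ContDiffOn ℝ 2 g Ω)
    (hlap : ∀ z ∈ Ω, 0 ≤ lap g z + exp (g z)) (hi : IntegrableOn (fun z => exp (g z)) Ω) (hb : ms g Ω ≤ 8 * π)
    {φ : ℂ → ℝ} (hφ : ContDiff ℝ 1 φ) {K : Set ℂ} (hK : IsCompact K) (hKΩ : K ⊆ Ω) (hφ0 : ∀ z, z ∉ K → φ z = 0)
    {t : ℝ} (ht : 0 < t) {x₀ : ℂ} (hx : t < φ x₀) {U : Set ℂ} (hU : U = connectedComponentIn {z | t < φ z} x₀)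
    (hU4 : ms g U < 4 * π) {c : ℝ} (hc : c < pp (ms g U)) :
    ∃ δ₀ > 0, ∀ δ, 0 < δ → δ < δ₀ → c * δ ≤ ∫ z in U ∩ {z | φ z ≤ t + δ}, ‖fderiv ℝ φ z‖ * exp (g z / 2) := by
  obtain ⟨V, r, hr, hVo, hVm, hVc, hVr, hVU, hVD⟩ := exhaust hφ.continuous hx
  rw [← hU] at hVU hVD
  have hUo : IsOpen U := by rw [hU]; exact (isOpen_lt continuous_const hφ.continuous).connectedComponentIn
  have hUt : ∀ z ∈ U, t < φ z := by
    intro z hz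
    rw [hU] at hz
    have h1 : z ∈ {z | t < φ z} := connectedComponentIn_subset _ _ hz
    exact h1
  have hUK : U ⊆ K := by
    intro z hz
    by_contra h
    have := hUt z hz
    rw [hφ0 z h] at this; linarith
  have hUΩ := hUK.trans hKΩ
  have hUcl : ∀ z ∈ closure U, t < φ z → z ∈ U := by
    intro z hz hzt
    have ho : IsOpen (connectedComponentIn {z | t < φ z} z) := (isOpen_lt continuous_const hφ.continuous).connectedComponentIn
    obtain ⟨y, hy1, hy2⟩ := mem_closure_iff.1 hz _ ho (mem_connectedComponentIn hzt)
    rw [hU] at hy2 ⊢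
    have e1 := connectedComponentIn_eq hy1
    have e2 := connectedComponentIn_eq hy2
    rw [e2, ← e1]
    exact mem_connectedComponentIn hzt
  have hCc : ∀ n, IsCompact (closure (V n)) := fun n => hK.of_isClosed_subset isClosed_closure ((hVU n).trans hUK)
  have hHΩ : ∀ n, hull (closure (V n)) ⊆ Ω := fun n => fill hΩ hsc (hCc n) ((hVU n).trans hUΩ)
  have hUV : (⋃ n, V n) = U := by
    refine subset_antisymm (iUnion_subset fun n => subset_closure.trans (hVU n)) fun z hz => ?_
    obtain ⟨n, hn⟩ := hVD {z} (by simpa using hz) isCompact_singleton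
    exact mem_iUnion.2 ⟨n, hn rfl⟩
  have l1 : Tendsto (fun n => ms g (V n)) atTop (𝓝 (ms g U)) := by
    rw [← hUV]
    exact tendsto_setIntegral_of_monotone (fun n => (hVo n).measurableSet) hVm (by rw [hUV]; exact hi.mono_set hUΩ)
  have l2 : Tendsto (fun n => ms g (closure (V n))) atTop (𝓝 (ms g U)) :=
    tendsto_of_tendsto_of_tendsto_of_le_of_le l1 tendsto_const_nhds (fun n => ms_mono hi subset_closure ((hVU n).trans hUΩ))
      (fun n => ms_mono hi (hVU n) hUΩ)
  have hHm : Monotone fun n => hull (closure (V n)) := fun n m h => hull_mono (hCc m) (closure_mono (hVm h))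
  have hHU : (⋃ n, hull (closure (V n))) ⊆ Ω := iUnion_subset hHΩ
  have l3 : Tendsto (fun n => ms g (hull (closure (V n)))) atTop (𝓝 (ms g (⋃ n, hull (closure (V n))))) :=
    tendsto_setIntegral_of_monotone (fun n => (hull_compact (hCc n)).isClosed.measurableSet) hHm (hi.mono_set hHU)
  have l4 : ∀ᶠ n in atTop, c < pp (ms g (closure (V n))) := ((pp_cont.tendsto _).comp l2).eventually (lt_mem_nhds hc)
  have l5 : ∀ᶠ n in atTop, ms g (⋃ n, hull (closure (V n))) - (4 * π - ms g U) < ms g (hull (closure (V n))) :=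
    l3.eventually (lt_mem_nhds (by linarith))
  obtain ⟨n, hn1, hn2⟩ := (l4.and l5).exists
  obtain ⟨C, hC⟩ : ∃ C, C = closure (V n) := ⟨_, rfl⟩
  have hCcon : IsConnected C := hC ▸ (hVc n).closure
  have hCU := hVU n
  have hCcomp := hCc n
  have hCr := hVr n
  rw [← hC] at hn1 hn2 hCU hCcomp hCr
  obtain ⟨ε, hε, hε1, hcε⟩ := eps_exists hn1
  refine ⟨r n, hr n, fun δ hδ hδr => ?_⟩
  have hεδ : 0 < ε * δ := mul_pos hε hδ
  have hεδ2 : ε * δ < δ := by nlinarith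
  obtain ⟨χ, hχ, hχ0, hχ1, hχp, hχd, hχz, hχn, hχl⟩ := clamp (a := t + ε * δ) (b := t + δ) (η := ε) (by linarith) hε
  classical
  obtain ⟨F, hF⟩ : ∃ F : ℂ → ℝ, ∀ z, F z = if z ∈ U then χ (φ z) else 0 := ⟨_, fun _ => rfl⟩
  have hFA : ∀ z ∈ U, F z = χ (φ z) := fun z hz => by rw [hF, if_pos hz]
  have hBo : IsOpen ((closure U)ᶜ ∪ {z | φ z < t + ε * δ}) := isClosed_closure.isOpen_compl.union (isOpen_lt hφ.continuous continuous_const)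
  have hFB : ∀ z ∈ (closure U)ᶜ ∪ {z | φ z < t + ε * δ}, F z = 0 := by
    rintro z (hz | hz)
    · rw [hF, if_neg fun h => hz (subset_closure h)]
    · rw [hF]; split_ifs
      · exact hχ0 _ (le_of_lt hz)
      · rfl
  have hcov : ∀ z, z ∈ U ∨ z ∈ (closure U)ᶜ ∪ {z | φ z < t + ε * δ} := by
    intro z
    by_cases h : z ∈ U
    · exact Or.inl h
    · right
      by_cases h2 : z ∈ closure U
      · right
        show φ z < t + ε * δ
        by_contra h3
        exact h (hUcl z h2 (by linarith))
      · exact Or.inl h2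
  have hFC : ContDiff ℝ 1 F := contDiff_of_cover hUo hBo hcov ((hχ.comp hφ).contDiffOn.congr hFA) (contDiffOn_const.congr hFB)
  have hDc : IsCompact (closure U ∩ {z | t + ε * δ ≤ φ z}) :=
    (hK.of_isClosed_subset isClosed_closure (closure_minimal hUK hK.isClosed)).inter_right (isClosed_le continuous_const hφ.continuous)
  obtain ⟨D, hD⟩ : ∃ D, D = closure U ∩ {z | t + ε * δ ≤ φ z} := ⟨_, rfl⟩
  have hDU : D ⊆ U := by
    rw [hD]; rintro z ⟨h1, h2⟩
    have h2 : t + ε * δ ≤ φ z := h2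
    exact hUcl z h1 (by linarith)
  rw [← hD] at hDc
  have hFD : ∀ z, z ∉ D → F z = 0 := by
    intro z hz
    rw [hD] at hz
    apply hFB
    by_contra h
    apply hz
    constructor
    · by_contra h1; exact h (Or.inl h1)
    · show t + ε * δ ≤ φ z
      by_contra h1; exact h (Or.inr (not_le.1 h1))
  have key := split hΩ hsc hg hlap hi hb (O := U ∩ {z | t + δ < φ z}) hUo hUΩ hCcomp hCcon hFC
    (fun z => by rw [hF]; split_ifs <;> simp [hχl]) (hUo.inter (isOpen_lt continuous_const hφ.continuous))
    (fun z hz => ⟨hCU hz, by show t + δ < φ z; linarith [hCr z hz]⟩)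
    (fun z hz => by rw [hFA z hz.1]; exact hχ1 _ (le_of_lt hz.2)) hDc hDU hFD (by
      obtain ⟨k, hk⟩ := hVD D hDU hDc
      have h1 : hull (hull C ∪ D) ⊆ ⋃ n, hull (closure (V n)) := by
        refine Subset.trans ?_ (subset_iUnion _ (max n k))
        refine hull_hull (hCc _) ?_ ((hull_compact hCcomp).union hDc)
        refine union_subset ?_ ?_
        · rw [hC]; exact hHm (le_max_left n k)
        · exact hk.trans ((hVm (le_max_right n k)).trans (subset_closure.trans (subset_hull _)))
      have := ms_mono hi h1 hHU
      linarith)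
  have hI := grad_int hg.continuousOn hφ hK hKΩ hφ0
  have hms : MeasurableSet (U ∩ {z | φ z ≤ t + δ}) := hUo.measurableSet.inter (isClosed_le hφ.continuous continuous_const).measurableSet
  have hε1' : 0 < 1 - ε := by linarith
  have hle : ∫ z, ‖fderiv ℝ F z‖ * exp (g z / 2) ≤ ∫ z, (U ∩ {z | φ z ≤ t + δ}).indicator (fun z => (1 + ε) / ((1 - ε) * δ) * (‖fderiv ℝ φ z‖ * exp (g z / 2))) z := by
    refine integral_mono_of_nonneg (ae_of_all _ fun z => by positivity) ((hI.const_mul _).indicator hms) (ae_of_all _ fun z => ?_)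
    simp only
    rcases hcov z with h | h
    · have e1 : F =ᶠ[𝓝 z] fun z => χ (φ z) := by
        filter_upwards [hUo.mem_nhds h] with y hy using hFA y hy
      have hd : HasFDerivAt (fun z => χ (φ z)) (deriv χ (φ z) • fderiv ℝ φ z) z :=
        ((hχ.differentiable (by norm_num) (φ z)).hasDerivAt).comp_hasFDerivAt z (hφ.differentiable (by norm_num) z).hasFDerivAt
      rw [e1.fderiv_eq, hd.fderiv, norm_smul, Real.norm_of_nonneg (hχp _)]
      by_cases h2 : t + δ ≤ φ z
      · rw [hχz _ (Or.inr h2)]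
        simp only [zero_mul]
        exact indicator_nonneg (fun y _ => by positivity) _
      · rw [indicator_of_mem]
        · rw [mul_assoc]
          refine mul_le_mul_of_nonneg_right ?_ (by positivity)
          have := hχd (φ z)
          rwa [show t + δ - (t + ε * δ) = (1 - ε) * δ by ring] at this
        · exact ⟨h, (not_le.1 h2).le⟩
    · have e1 : F =ᶠ[𝓝 z] fun z => 0 := by
        filter_upwards [hBo.mem_nhds h] with y hy using hFB y hy
      rw [e1.fderiv_eq]
      simp only [fderiv_fun_const, Pi.zero_apply, norm_zero, zero_mul]
      exact indicator_nonneg (fun y _ => by positivity) _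
  rw [integral_indicator hms, integral_const_mul] at hle
  have h3 := (hcε.trans key).trans hle
  rw [div_le_iff₀ hε1'] at h3
  have h4 : c * (1 + ε) * δ ≤ (1 + ε) * ∫ z in U ∩ {z | φ z ≤ t + δ}, ‖fderiv ℝ φ z‖ * exp (g z / 2) := by
    calc c * (1 + ε) * δ ≤ _ := mul_le_mul_of_nonneg_right h3 hδ.le
      _ = _ := by field_simp
  have h5 : (1 + ε) * (c * δ) ≤ (1 + ε) * ∫ z in U ∩ {z | φ z ≤ t + δ}, ‖fderiv ℝ φ z‖ * exp (g z / 2) := by linarith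
  exact le_of_mul_le_mul_left h5 (by linarith)

lemma coarea_germ {Ω : Set ℂ} {g : ℂ → ℝ} (hΩ : IsOpen Ω) (hsc : IsSimplyConnected Ω) (hg : ContDiffOn ℝ 2 g Ω)
    (hlap : ∀ z ∈ Ω, 0 ≤ lap g z + exp (g z)) (hi : IntegrableOn (fun z => exp (g z)) Ω) (hb : ms g Ω ≤ 8 * π)
    {φ : ℂ → ℝ} (hφ : ContDiff ℝ 1 φ) {K : Set ℂ} (hK : IsCompact K) (hKΩ : K ⊆ Ω) (hφ0 : ∀ z, z ∉ K → φ z = 0)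
    {t : ℝ} (ht : 0 < t) (h4 : ms g {z | t < φ z} < 4 * π) {c : ℝ} (hc : c < pp (ms g {z | t < φ z})) :
    ∃ δ₀ > 0, ∀ δ, 0 < δ → δ < δ₀ → c * δ ≤ ∫ z in {z | t < φ z} ∩ {z | φ z ≤ t + δ}, ‖fderiv ℝ φ z‖ * exp (g z / 2) := by
  obtain ⟨S, hS⟩ : ∃ S, S = {z | t < φ z} := ⟨_, rfl⟩
  have hSo : IsOpen S := by rw [hS]; exact isOpen_lt continuous_const hφ.continuous
  have hSK : S ⊆ K := by
    intro z hz
    by_contra h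
    rw [hS] at hz
    have hz : t < φ z := hz
    rw [hφ0 z h] at hz; linarith
  have hSΩ := hSK.trans hKΩ
  have hI := grad_int hg.continuousOn hφ hK hKΩ hφ0
  obtain ⟨W, hW⟩ : ∃ W : ℕ → Set ℂ, ∀ k, W k = ⋃ i < k, connectedComponentIn S (TopologicalSpace.denseSeq ℂ i) := ⟨_, fun _ => rfl⟩
  have hWo : ∀ k, IsOpen (W k) := fun k => by rw [hW]; exact isOpen_biUnion fun i _ => hSo.connectedComponentIn
  have hWS : ∀ k, W k ⊆ S := fun k => by rw [hW]; exact iUnion₂_subset fun i _ => connectedComponentIn_subset _ _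
  have hWs : ∀ k, W (k+1) = W k ∪ connectedComponentIn S (TopologicalSpace.denseSeq ℂ k) := by
    intro k
    rw [hW, hW]
    ext z
    simp only [mem_iUnion, mem_union, Nat.lt_succ_iff_lt_or_eq]
    constructor
    · rintro ⟨i, h | rfl, h2⟩
      · exact Or.inl ⟨i, h, h2⟩
      · exact Or.inr h2
    · rintro (⟨i, h, h2⟩ | h)
      · exact ⟨i, Or.inl h, h2⟩
      · exact ⟨k, Or.inr rfl, h⟩
  have hWm : Monotone W := monotone_nat_of_le_succ fun k => by rw [hWs]; exact subset_union_left
  have hWU : (⋃ k, W k) = S := by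
    refine subset_antisymm (iUnion_subset hWS) fun z hz => ?_
    obtain ⟨y, hy, i, rfl⟩ := (TopologicalSpace.denseRange_denseSeq ℂ).inter_open_nonempty _ (hSo.connectedComponentIn (x := z)) ⟨z, mem_connectedComponentIn hz⟩
    refine mem_iUnion.2 ⟨i + 1, ?_⟩
    rw [hWs]; right
    rw [← connectedComponentIn_eq hy]
    exact mem_connectedComponentIn hz
  have hms : ∀ δ, MeasurableSet {z | φ z ≤ t + δ} := fun δ => (isClosed_le hφ.continuous continuous_const).measurableSet
  have main : ∀ k, ∀ c, c < pp (ms g (W k)) → ∃ δ₀ > 0, ∀ δ, 0 < δ → δ < δ₀ → c * δ ≤ ∫ z in W k ∩ {z | φ z ≤ t + δ}, ‖fderiv ℝ φ z‖ * exp (g z / 2) := by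
    intro k
    induction k with
    | zero =>
      intro c hc
      have : W 0 = ∅ := by rw [hW]; simp
      rw [this] at hc ⊢
      simp [ms, pp] at hc
      refine ⟨1, one_pos, fun δ hδ _ => ?_⟩
      simp
      nlinarith
    | succ k ih =>
      intro c hc
      by_cases hx : TopologicalSpace.denseSeq ℂ k ∈ S
      · by_cases hd : Disjoint (W k) (connectedComponentIn S (TopologicalSpace.denseSeq ℂ k))
        · have hUo : IsOpen (connectedComponentIn S (TopologicalSpace.denseSeq ℂ k)) := hSo.connectedComponentIn
          have hUS : connectedComponentIn S (TopologicalSpace.denseSeq ℂ k) ⊆ S := connectedComponentIn_subset _ _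
          have e1 : ms g (W (k+1)) = ms g (W k) + ms g (connectedComponentIn S (TopologicalSpace.denseSeq ℂ k)) := by
            rw [hWs]
            exact setIntegral_union hd hUo.measurableSet (hi.mono_set ((hWS k).trans hSΩ)) (hi.mono_set (hUS.trans hSΩ))
          have hle := ms_mono hi (hWS (k+1)) hSΩ
          have hle2 := ms_mono hi hUS hSΩ
          have hle3 := ms_mono hi hSΩ le_rfl
          rw [e1] at hc hle
          have h1 := pp_add (ms_nonneg g (W k)) (ms_nonneg g (connectedComponentIn S (TopologicalSpace.denseSeq ℂ k))) (by linarith)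
          obtain ⟨η, hη⟩ : ∃ η, η = pp (ms g (W k)) + pp (ms g (connectedComponentIn S (TopologicalSpace.denseSeq ℂ k))) - c := ⟨_, rfl⟩
          have hη0 : 0 < η := by linarith
          obtain ⟨d1, hd1, h2⟩ := ih (pp (ms g (W k)) - η / 2) (by linarith)
          rw [hS] at hx
          obtain ⟨d2, hd2, h3⟩ := comp_germ hΩ hsc hg hlap hi hb hφ hK hKΩ hφ0 ht hx (U := connectedComponentIn S (TopologicalSpace.denseSeq ℂ k)) (by rw [hS])
            (by rw [← hS] at h4; linarith) (c := pp (ms g (connectedComponentIn S (TopologicalSpace.denseSeq ℂ k))) - η / 2) (by linarith)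
          refine ⟨min d1 d2, lt_min hd1 hd2, fun δ hδ hδ2 => ?_⟩
          have a1 := h2 δ hδ (hδ2.trans_le (min_le_left _ _))
          have a2 := h3 δ hδ (hδ2.trans_le (min_le_right _ _))
          rw [hWs, union_inter_distrib_right, setIntegral_union (hd.mono inter_subset_left inter_subset_left) (hUo.measurableSet.inter (hms δ)) hI.integrableOn hI.integrableOn]
          nlinarith
        · have : W (k+1) = W k := by
            rw [hWs]
            apply union_eq_left.2
            obtain ⟨y, hy1, hy2⟩ := not_disjoint_iff.1 hd
            rw [hW] at hy1 ⊢
            simp only [mem_iUnion] at hy1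
            obtain ⟨i, hik, hy1⟩ := hy1
            rw [connectedComponentIn_eq hy2, ← connectedComponentIn_eq hy1]
            exact subset_iUnion₂_of_subset i hik le_rfl
          rw [this] at hc ⊢
          exact ih c hc
      · have : W (k+1) = W k := by
          rw [hWs, connectedComponentIn_eq_empty hx, union_empty]
        rw [this] at hc ⊢
        exact ih c hc
  have l1 : Tendsto (fun n => ms g (W n)) atTop (𝓝 (ms g S)) := by
    rw [← hWU]
    exact tendsto_setIntegral_of_monotone (fun n => (hWo n).measurableSet) hWm (by rw [hWU]; exact hi.mono_set hSΩ)
  rw [← hS] at hc ⊢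
  obtain ⟨k, hk⟩ := (((pp_cont.tendsto _).comp l1).eventually (lt_mem_nhds hc)).exists
  obtain ⟨δ₀, hδ₀, h⟩ := main k c hk
  refine ⟨δ₀, hδ₀, fun δ h1 h2 => (h δ h1 h2).trans ?_⟩
  exact setIntegral_mono_set hI.integrableOn (ae_of_all _ fun z => by positivity) (Eventually.of_forall (inter_subset_inter_left _ (hWS k)))

lemma coarea {Ω : Set ℂ} {g : ℂ → ℝ} (hΩ : IsOpen Ω) (hsc : IsSimplyConnected Ω) (hg : ContDiffOn ℝ 2 g Ω)
    (hlap : ∀ z ∈ Ω, 0 ≤ lap g z + exp (g z)) (hi : IntegrableOn (fun z => exp (g z)) Ω) (hb : ms g Ω ≤ 8 * π)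
    {φ : ℂ → ℝ} (hφ : ContDiff ℝ 1 φ) {K : Set ℂ} (hK : IsCompact K) (hKΩ : K ⊆ Ω) (hφ0 : ∀ z, z ∉ K → φ z = 0)
    (h4 : ms g K < 4 * π) {a b : ℝ} (ha : 0 < a) (hab : a ≤ b) :
    pp (ms g {z | b < φ z}) * (b - a) ≤ ∫ z in {z | a < φ z} ∩ {z | φ z ≤ b}, ‖fderiv ℝ φ z‖ * exp (g z / 2) := by
  have hI := grad_int hg.continuousOn hφ hK hKΩ hφ0
  have hSK : ∀ t, 0 < t → {z | t < φ z} ⊆ K := by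
    intro t ht z hz
    by_contra h
    have hz : t < φ z := hz
    rw [hφ0 z h] at hz; linarith
  have hms : ∀ t, MeasurableSet {z | φ z ≤ t} := fun t => (isClosed_le hφ.continuous continuous_const).measurableSet
  obtain ⟨E, hE⟩ : ∃ E : ℝ → ℝ, ∀ s, E s = ∫ z in {z | φ z ≤ s}, ‖fderiv ℝ φ z‖ * exp (g z / 2) := ⟨_, fun _ => rfl⟩
  have hdiff : ∀ s u, s ≤ u → E u - E s = ∫ z in {z | s < φ z} ∩ {z | φ z ≤ u}, ‖fderiv ℝ φ z‖ * exp (g z / 2) := by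
    intro s u hsu
    have hss : {z | φ z ≤ s} ⊆ {z | φ z ≤ u} := fun z (hz : φ z ≤ s) => hz.trans hsu
    rw [hE, hE, ← setIntegral_sdiff (hms s) hI.integrableOn hss]
    congr 2
    ext z
    simp only [mem_diff, mem_setOf_eq, mem_inter_iff, not_le, and_comm]
  rw [← hdiff a b hab]
  refine le_of_forall_lt_imp_le_of_dense ?_ |>.trans le_rfl
  intro y hy
  rcases eq_or_lt_of_le hab with rfl | hab'
  · simp at hy ⊢; exact hy.le
  have hy2 : y / (b - a) < pp (ms g {z | b < φ z}) := by rwa [div_lt_iff₀ (by linarith)]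
  have := dini (E := E) (c := y / (b - a)) hab ?_ ?_
  · rwa [div_mul_cancel₀ _ (by linarith)] at this
  · intro x hx u hu hxu
    have := hdiff x u hxu
    have h2 : 0 ≤ ∫ z in {z | x < φ z} ∩ {z | φ z ≤ u}, ‖fderiv ℝ φ z‖ * exp (g z / 2) := integral_nonneg fun z => by positivity
    linarith
  · intro s hs
    have hs0 : 0 < s := by linarith [hs.1]
    have m1 := ms_mono hi (hSK s hs0) hKΩ
    have m2 : ms g {z | b < φ z} ≤ ms g {z | s < φ z} := ms_mono hi (fun z (hz : b < φ z) => hs.2.trans hz) ((hSK s hs0).trans hKΩ)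
    have m3 := pp_mono (ms_nonneg g _) m2 (by linarith)
    obtain ⟨δ₀, hδ₀, h⟩ := coarea_germ hΩ hsc hg hlap hi hb hφ hK hKΩ hφ0 hs0 (by linarith) (hy2.trans_le m3)
    have hδ : 0 < min (δ₀ / 2) (b - s) := lt_min (by linarith) (by linarith [hs.2])
    have h1 := h _ hδ ((min_le_left _ _).trans_lt (by linarith))
    refine ⟨s + min (δ₀ / 2) (b - s), ⟨by linarith, by linarith [min_le_right (δ₀ / 2) (b - s)]⟩, ?_⟩
    rw [hdiff _ _ (by linarith), add_sub_cancel_left]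
    exact h1

end Bol

namespace Bol
open Set Filter Topology
open scoped Manifold ContDiff

/-- auxiliary barrier -/
noncomputable def bt (κ x : ℝ) : ℝ := (1 - x ^ 2) / (x - κ)

lemma fk_step {κ a b xa xb Ga Gb Na Nb M : ℝ} (hκ : 0 < κ) (hκ1 : κ ≤ 1) (ha : 0 < a) (hab : a ≤ b) (hbM : b ≤ M) (hxa : 2 * κ ≤ xa)
    (hx : xa ≤ xb) (hx1 : xb ≤ 1)
    (hG : ∀ s, 0 ≤ s → 2 * s * (√(8 * π ^ 2 * (1 - xb ^ 2)) * (b - a)) - s ^ 2 * (4 * π * (xb - xa)) ≤ Gb - Ga)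
    (hN : Nb - Na ≤ b ^ 2 * (4 * π * (xb - xa))) :
    -(2 * π / κ * (b - a) ^ 2 + 8 * π * (1 + κ) * M * (b - a) * (xb - xa)) ≤
      (Gb - (1 + κ) * Nb - 2 * π * b ^ 2 * bt κ xb) - (Ga - (1 + κ) * Na - 2 * π * a ^ 2 * bt κ xa) := by
  have hπ := pi_pos
  obtain ⟨w, hw⟩ : ∃ w, w = xb - κ := ⟨_, rfl⟩
  obtain ⟨wa, hwa⟩ : ∃ w, w = xa - κ := ⟨_, rfl⟩
  have hwak : κ ≤ wa := by linarith
  have hww : wa ≤ w := by linarith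
  have hw0 : 0 < w := by linarith
  have hwa0 : 0 < wa := by linarith
  have hw1 : w ≤ 1 := by linarith
  obtain ⟨v, hv⟩ : ∃ v, v = w⁻¹ := ⟨_, rfl⟩
  obtain ⟨u, hu⟩ : ∃ v, v = wa⁻¹ := ⟨_, rfl⟩
  have hvw : w * v = 1 := by rw [hv]; exact mul_inv_cancel₀ hw0.ne'
  have huw : wa * u = 1 := by rw [hu]; exact mul_inv_cancel₀ hwa0.ne'
  have hv0 : 0 < v := by rw [hv]; positivity
  have hu0 : 0 < u := by rw [hu]; positivity
  have hv1 : 1 ≤ v := by nlinarith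
  have huv : v ≤ u := by rw [hv, hu]; exact inv_anti₀ hwa0 hww
  have hD : 0 ≤ xb - xa := by linarith
  have hΔ : xb - xa = w - wa := by rw [hw, hwa]; ring
  have hxb : xb = w + κ := by rw [hw]; ring
  have hxa' : xa = wa + κ := by rw [hwa]; ring
  have huv2 : u - v = (xb - xa) * (u * v) := by
    rw [hΔ]
    linear_combination (-u) * hvw + v * huw
  have huv3 : (xb - xa) * v ^ 2 ≤ u - v := by
    rw [huv2, pow_two]
    exact mul_le_mul_of_nonneg_left (mul_le_mul_of_nonneg_right huv hv0.le) hD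
  have bb : bt κ xb = (1 - κ ^ 2) * v - 2 * κ - w := by
    rw [bt, ← hw, hxb, div_eq_mul_inv, ← hv]
    linear_combination (- w - 2 * κ) * hvw
  have ba : bt κ xa = (1 - κ ^ 2) * u - 2 * κ - wa := by
    rw [bt, ← hwa, hxa', div_eq_mul_inv, ← hu]
    linear_combination (- wa - 2 * κ) * huw
  have hQ : (1 - xb ^ 2) * v ^ 2 = (1 - κ ^ 2) * v ^ 2 - 1 - 2 * κ * v := by
    rw [hxb]
    linear_combination (- w * v - 1 - 2 * κ * v) * hvw
  have hβ : (xb - xa) * ((1 - xb ^ 2) * v ^ 2 + 2 * (1 + κ)) ≤ bt κ xa - bt κ xb := by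
    rw [ba, bb, hQ]
    have e1 : 0 ≤ (1 - κ ^ 2) * (u - v - (xb - xa) * v ^ 2) := mul_nonneg (by nlinarith) (by linarith)
    have e2 : 0 ≤ (xb - xa) * (2 * κ * (v - 1)) := mul_nonneg hD (mul_nonneg (by linarith) (by linarith))
    nlinarith
  have hq0 : 0 ≤ 1 - xb ^ 2 := by nlinarith
  obtain ⟨P, hP⟩ : ∃ P, P = √(8 * π ^ 2 * (1 - xb ^ 2)) := ⟨_, rfl⟩
  have hP2 : P ^ 2 = 8 * π ^ 2 * (1 - xb ^ 2) := by rw [hP]; exact Real.sq_sqrt (by positivity)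
  have hP0 : 0 ≤ P := by rw [hP]; positivity
  have g1 := hG (a * P * v / (4 * π)) (by positivity)
  rw [← hP] at g1
  have bb2 : bt κ xb = (1 - xb ^ 2) * v := by rw [bt, ← hw, hv, div_eq_mul_inv]
  have g2 : 2 * (a * P * v / (4 * π)) * (P * (b - a)) - (a * P * v / (4 * π)) ^ 2 * (4 * π * (xb - xa)) =
      4 * π * a * (b - a) * bt κ xb - 2 * π * a ^ 2 * ((xb - xa) * ((1 - xb ^ 2) * v ^ 2)) := by
    rw [bb2]
    have e1 : 2 * (a * P * v / (4 * π)) * (P * (b - a)) = P ^ 2 * (a * v * (b - a)) / (2 * π) := by field_simp; ring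
    have e2 : (a * P * v / (4 * π)) ^ 2 * (4 * π * (xb - xa)) = P ^ 2 * (a ^ 2 * v ^ 2 * (xb - xa)) / (4 * π) := by field_simp
    rw [e1, e2, hP2]
    field_simp
    ring
  rw [g2] at g1
  have hβ0 : 0 ≤ bt κ xb := by rw [bb2]; positivity
  have hβ1 : bt κ xb ≤ 1 / κ := by
    rw [bt, ← hw]
    exact div_le_div₀ zero_le_one (by linarith [sq_nonneg xb]) hκ (by linarith)
  have hβ2 := mul_le_mul_of_nonneg_left hβ (show 0 ≤ 2 * π * a ^ 2 by positivity)
  have hN2 := mul_le_mul_of_nonneg_left hN (show 0 ≤ 1 + κ by linarith)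
  have r1 : 2 * π * bt κ xb * (b - a) ^ 2 ≤ 2 * π / κ * (b - a) ^ 2 := by
    refine mul_le_mul_of_nonneg_right ?_ (sq_nonneg _)
    rw [show 2 * π / κ = 2 * π * (1 / κ) by ring]
    exact mul_le_mul_of_nonneg_left hβ1 (by positivity)
  have r2 : 4 * π * (1 + κ) * (xb - xa) * (b - a) * (a + b) ≤ 4 * π * (1 + κ) * (xb - xa) * (b - a) * (2 * M) := by
    refine mul_le_mul_of_nonneg_left (by linarith) ?_
    have : 0 ≤ b - a := by linarith
    positivity
  linarith

lemma fk1d {κ M C : ℝ} {x G N : ℝ → ℝ} (hκ : 0 < κ) (hκ1 : κ ≤ 1) (hM : 0 < M) (hx2 : ∀ t, 0 < t → 2 * κ ≤ x t)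
    (hxm : ∀ a b, 0 < a → a ≤ b → x a ≤ x b) (hxl : ∀ t, x t ≤ 1) (hxM : x M = 1)
    (hG : ∀ a b s, 0 < a → a ≤ b → 0 ≤ s → 2 * s * (√(8 * π ^ 2 * (1 - x b ^ 2)) * (b - a)) - s ^ 2 * (4 * π * (x b - x a)) ≤ G b - G a)
    (hN : ∀ a b, 0 < a → a ≤ b → N b - N a ≤ b ^ 2 * (4 * π * (x b - x a)))
    (hG0 : ∀ t, 0 ≤ G t) (hN0 : ∀ t, 0 < t → N t ≤ t ^ 2 * C) :
    (1 + κ) * N M ≤ G M := by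
  have hπ := pi_pos
  obtain ⟨Ψ, hΨ⟩ : ∃ Ψ : ℝ → ℝ, ∀ t, Ψ t = G t - (1 + κ) * N t - 2 * π * t ^ 2 * bt κ (x t) := ⟨_, fun _ => rfl⟩
  have hΨM : Ψ M = G M - (1 + κ) * N M := by rw [hΨ, hxM]; simp [bt]
  have step1 : ∀ τ, 0 < τ → τ ≤ M → ∀ n : ℕ, Ψ τ - (2 * π / κ * M ^ 2 + 8 * π * (1 + κ) * M * M) / (n + 1) ≤ Ψ M := by
    intro τ hτ hτM n
    obtain ⟨δ, hδ⟩ : ∃ δ, δ = (M - τ) / (n + 1) := ⟨_, rfl⟩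
    have hδ0 : 0 ≤ δ := by rw [hδ]; exact div_nonneg (by linarith) (by positivity)
    have hnδ : (n + 1) * δ = M - τ := by rw [hδ]; field_simp
    have ind : ∀ i : ℕ, i ≤ n + 1 → Ψ τ - (2 * π / κ * δ ^ 2 * i + 8 * π * (1 + κ) * M * δ * (x (τ + i * δ) - x τ)) ≤ Ψ (τ + i * δ) := by
      intro i
      induction i with
      | zero => intro _; simp
      | succ i ih =>
        intro hi
        have h1 := ih (by omega)
        have hi' : ((i:ℝ) + 1) ≤ n + 1 := by exact_mod_cast hi
        have hiδ : 0 ≤ (i:ℝ) * δ := by positivity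
        have hle : τ + i * δ ≤ τ + (i + 1) * δ := by nlinarith
        have hpos : 0 < τ + i * δ := by linarith
        have h2 := fk_step (κ := κ) (M := M) hκ hκ1 hpos hle (by nlinarith) (hx2 _ hpos) (hxm _ _ hpos hle) (hxl _)
          (fun s hs => hG _ _ s hpos hle hs) (hN _ _ hpos hle)
        rw [← hΨ, ← hΨ] at h2
        rw [show τ + (i + 1) * δ - (τ + i * δ) = δ by ring] at h2
        push_cast
        nlinarith
    have h1 := ind (n + 1) le_rfl
    push_cast at h1
    rw [hnδ, add_sub_cancel, hxM] at h1
    have hδM : δ ≤ M / (n + 1) := by rw [hδ]; gcongr; linarith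
    have hMτ : M - τ ≤ M := by linarith
    have hx0 := hx2 τ hτ
    have e1 : 2 * π / κ * δ ^ 2 * (n + 1) ≤ 2 * π / κ * (M * (M / (n + 1))) := by
      rw [show 2 * π / κ * δ ^ 2 * (n + 1) = 2 * π / κ * (((n + 1) * δ) * δ) by ring, hnδ]
      exact mul_le_mul_of_nonneg_left (mul_le_mul hMτ hδM hδ0 hM.le) (by positivity)
    have e2 : 8 * π * (1 + κ) * M * δ * (1 - x τ) ≤ 8 * π * (1 + κ) * M * (M / (n + 1)) * 1 := by
      have h3 : 0 ≤ 1 - x τ := by linarith [hxl τ]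
      refine mul_le_mul ?_ (by linarith) h3 (by positivity)
      exact mul_le_mul_of_nonneg_left hδM (by positivity)
    have e3 : (2 * π / κ * M ^ 2 + 8 * π * (1 + κ) * M * M) / (n + 1) = 2 * π / κ * (M * (M / (n + 1))) + 8 * π * (1 + κ) * M * (M / (n + 1)) * 1 := by ring
    linarith
  have step2 : ∀ τ, 0 < τ → τ ≤ M → Ψ τ ≤ Ψ M := by
    intro τ hτ hτM
    have l1 : Tendsto (fun n : ℕ => Ψ τ - (2 * π / κ * M ^ 2 + 8 * π * (1 + κ) * M * M) / (n + 1)) atTop (𝓝 (Ψ τ - 0)) := by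
      refine tendsto_const_nhds.sub ?_
      exact tendsto_const_nhds.div_atTop (tendsto_natCast_atTop_atTop.atTop_add tendsto_const_nhds)
    rw [sub_zero] at l1
    exact le_of_tendsto' l1 (step1 τ hτ hτM)
  have step3 : ∀ τ, 0 < τ → τ ≤ M → -(τ ^ 2 * ((1 + κ) * C + 2 * π / κ)) ≤ Ψ M := by
    intro τ hτ hτM
    refine le_trans ?_ (step2 τ hτ hτM)
    rw [hΨ]
    have h1 := mul_le_mul_of_nonneg_left (hN0 τ hτ) (show 0 ≤ 1 + κ by linarith)
    have h2 : bt κ (x τ) ≤ 1 / κ := by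
      have := hx2 τ hτ
      have := hxl τ
      rw [bt]
      exact div_le_div₀ zero_le_one (by linarith [sq_nonneg (x τ)]) hκ (by linarith)
    have h3 := mul_le_mul_of_nonneg_left h2 (show 0 ≤ 2 * π * τ ^ 2 by positivity)
    have h4 := hG0 τ
    have h5 : 2 * π * τ ^ 2 * (1 / κ) = τ ^ 2 * (2 * π / κ) := by ring
    nlinarith
  have l2 : Tendsto (fun τ : ℝ => -(τ ^ 2 * ((1 + κ) * C + 2 * π / κ))) (𝓝[>] 0) (𝓝 0) := by
    have : Continuous fun τ : ℝ => -(τ ^ 2 * ((1 + κ) * C + 2 * π / κ)) := by fun_prop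
    have h := (this.tendsto 0).mono_left (nhdsWithin_le_nhds (s := Ioi 0))
    simpa using h
  have : 0 ≤ Ψ M := by
    refine le_of_tendsto l2 ?_
    filter_upwards [Ioo_mem_nhdsGT hM] with τ hτ using step3 τ hτ.1 hτ.2.le
  linarith

lemma FK {Ω : Set ℂ} {g : ℂ → ℝ} (hΩ : IsOpen Ω) (hsc : IsSimplyConnected Ω) (hg : ContDiffOn ℝ 2 g Ω)
    (hlap : ∀ z ∈ Ω, 0 ≤ lap g z + exp (g z)) (hi : IntegrableOn (fun z => exp (g z)) Ω) (hb : ms g Ω ≤ 8 * π)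
    {φ : ℂ → ℝ} (hφ : ContDiff ℝ 1 φ) {K : Set ℂ} (hK : IsCompact K) (hKΩ : K ⊆ Ω) (hφ0 : ∀ z, z ∉ K → φ z = 0)
    (hφp : ∀ z, 0 ≤ φ z) {κ : ℝ} (hκ : 0 < κ) (hκ1 : κ ≤ 1) (h4 : ms g K ≤ 4 * π * (1 - 2 * κ)) :
    (1 + κ) * ∫ z in K, exp (g z) * φ z ^ 2 ≤ ∫ z in K, ‖fderiv ℝ φ z‖ ^ 2 := by
  have hπ := pi_pos
  have hgc := hg.continuousOn
  have hI := grad_int hgc hφ hK hKΩ hφ0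
  have hm4 : ms g K < 4 * π := by nlinarith
  have hSK : ∀ t, 0 < t → {z | t < φ z} ⊆ K := by
    intro t ht z hz
    by_contra h
    have hz : t < φ z := hz
    rw [hφ0 z h] at hz; linarith
  have hms : ∀ t, MeasurableSet {z | φ z ≤ t} := fun t => (isClosed_le hφ.continuous continuous_const).measurableSet
  have hms2 : ∀ t, MeasurableSet {z | t < φ z} := fun t => (isOpen_lt continuous_const hφ.continuous).measurableSet
  have ce : ContinuousOn (fun z => exp (g z)) K := continuous_exp.comp_continuousOn (hgc.mono hKΩ)
  have iG : IntegrableOn (fun z => ‖fderiv ℝ φ z‖ ^ 2) K :=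
    (((hφ.continuous_fderiv (by norm_num)).norm.pow 2).continuousOn).integrableOn_compact hK
  have iN : IntegrableOn (fun z => exp (g z) * φ z ^ 2) K := (ce.mul (hφ.continuous.pow 2).continuousOn).integrableOn_compact hK
  have ie : IntegrableOn (fun z => exp (g z)) K := ce.integrableOn_compact hK
  obtain ⟨M, hM0, hM⟩ : ∃ M > 0, ∀ z, φ z ≤ M := by
    obtain ⟨C, hC⟩ := hK.exists_bound_of_continuousOn hφ.continuous.continuousOn
    refine ⟨max C 1, by positivity, fun z => ?_⟩
    by_cases h : z ∈ K
    · exact (le_abs_self _).trans ((hC z h).trans (le_max_left _ _))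
    · rw [hφ0 z h]; positivity
  obtain ⟨x, hx⟩ : ∃ x : ℝ → ℝ, ∀ t, x t = 1 - ms g {z | t < φ z} / (4 * π) := ⟨_, fun _ => rfl⟩
  obtain ⟨G, hG⟩ : ∃ x : ℝ → ℝ, ∀ t, x t = ∫ z in K ∩ {z | φ z ≤ t}, ‖fderiv ℝ φ z‖ ^ 2 := ⟨_, fun _ => rfl⟩
  obtain ⟨N, hN⟩ : ∃ x : ℝ → ℝ, ∀ t, x t = ∫ z in K ∩ {z | φ z ≤ t}, exp (g z) * φ z ^ 2 := ⟨_, fun _ => rfl⟩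
  have hKM : K ∩ {z | φ z ≤ M} = K := inter_eq_left.2 fun z _ => hM z
  have hpp : ∀ t, pp (ms g {z | t < φ z}) = √(8 * π ^ 2 * (1 - x t ^ 2)) := by
    intro t
    rw [hx, pp]
    congr 1
    field_simp
    ring
  have hset : ∀ a b, 0 < a → a ≤ b → (K ∩ {z | φ z ≤ b}) \ (K ∩ {z | φ z ≤ a}) = {z | a < φ z} ∩ {z | φ z ≤ b} := by
    intro a b ha hab
    ext z
    simp only [mem_diff, mem_inter_iff, mem_setOf_eq, not_and, not_le]
    constructor
    · rintro ⟨⟨h1, h2⟩, h3⟩; exact ⟨h3 h1, h2⟩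
    · rintro ⟨h1, h2⟩; exact ⟨⟨hSK a ha h1, h2⟩, fun _ => h1⟩
  have hsub : ∀ a b, a ≤ b → K ∩ {z | φ z ≤ a} ⊆ K ∩ {z | φ z ≤ b} := by
    intro a b hab z hz
    have h2 : φ z ≤ a := hz.2
    exact ⟨hz.1, h2.trans hab⟩
  have hmK : ∀ a, MeasurableSet (K ∩ {z | φ z ≤ a}) := fun a => hK.isClosed.measurableSet.inter (hms a)
  have hΔ : ∀ a b, 0 < a → a ≤ b → ∫ z in {z | a < φ z} ∩ {z | φ z ≤ b}, exp (g z) = 4 * π * (x b - x a) := by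
    intro a b ha hab
    have hs : {z | b < φ z} ⊆ {z | a < φ z} := fun z (hz : b < φ z) => hab.trans_lt hz
    have h1 := ms_diff hi (hms2 b) hs ((hSK a ha).trans hKΩ)
    have h2 : {z | a < φ z} \ {z | b < φ z} = {z | a < φ z} ∩ {z | φ z ≤ b} := by
      ext z; simp only [mem_diff, mem_inter_iff, mem_setOf_eq, not_lt]
    rw [h2] at h1
    rw [hx, hx]
    rw [ms] at h1
    rw [h1]
    field_simp
    ring
  have hSsub : ∀ a b, 0 < a → {z | a < φ z} ∩ {z | φ z ≤ b} ⊆ K := fun a b ha => inter_subset_left.trans (hSK a ha)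
  have hGd : ∀ a b, 0 < a → a ≤ b → G b - G a = ∫ z in {z | a < φ z} ∩ {z | φ z ≤ b}, ‖fderiv ℝ φ z‖ ^ 2 := by
    intro a b ha hab
    rw [hG, hG, ← setIntegral_sdiff (hmK a) (iG.mono_set inter_subset_left) (hsub a b hab), hset a b ha hab]
  have hNd : ∀ a b, 0 < a → a ≤ b → N b - N a = ∫ z in {z | a < φ z} ∩ {z | φ z ≤ b}, exp (g z) * φ z ^ 2 := by
    intro a b ha hab
    rw [hN, hN, ← setIntegral_sdiff (hmK a) (iN.mono_set inter_subset_left) (hsub a b hab), hset a b ha hab]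
  have key := fk1d (κ := κ) (M := M) (C := ms g K) (x := x) (G := G) (N := N) hκ hκ1 hM0 ?_ ?_ ?_ ?_ ?_ ?_ ?_ ?_
  · rw [hG, hN, hKM] at key; exact key
  · intro t ht
    rw [hx]
    have := ms_mono hi (hSK t ht) hKΩ
    have h2 : ms g {z | t < φ z} / (4 * π) ≤ 1 - 2 * κ := by rw [div_le_iff₀ (by positivity)]; linarith
    linarith
  · intro a b ha hab
    have h1 := hΔ a b ha hab
    have h2 : 0 ≤ ∫ z in {z | a < φ z} ∩ {z | φ z ≤ b}, exp (g z) := integral_nonneg fun z => (exp_pos _).le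
    by_contra h
    nlinarith
  · intro t
    rw [hx]
    have : 0 ≤ ms g {z | t < φ z} / (4 * π) := div_nonneg (ms_nonneg _ _) (by positivity)
    linarith
  · rw [hx]
    have : {z | M < φ z} = ∅ := by
      ext z; simp only [mem_setOf_eq, mem_empty_iff_false, iff_false, not_lt]; exact hM z
    rw [this]; simp [ms]
  · intro a b s ha hab hs
    rw [hGd a b ha hab, ← hpp, ← hΔ a b ha hab]
    have hco := coarea hΩ hsc hg hlap hi hb hφ hK hKΩ hφ0 hm4 ha hab
    have h1 := mul_le_mul_of_nonneg_left hco (show 0 ≤ 2 * s by linarith)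
    refine (sub_le_sub_right h1 _).trans ?_
    rw [← integral_const_mul, ← integral_const_mul, ← integral_sub (hI.integrableOn.const_mul _) ((ie.mono_set (hSsub a b ha)).const_mul _)]
    refine integral_mono ((hI.integrableOn.const_mul _).sub ((ie.mono_set (hSsub a b ha)).const_mul _)) (iG.mono_set (hSsub a b ha)) fun z => ?_
    simp only
    have e : exp (g z) = exp (g z / 2) ^ 2 := by rw [← exp_nat_mul]; congr 1; push_cast; ring
    rw [e]
    nlinarith [sq_nonneg (‖fderiv ℝ φ z‖ - s * exp (g z / 2))]
  · intro a b ha hab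
    rw [hNd a b ha hab, ← hΔ a b ha hab, ← integral_const_mul]
    refine setIntegral_mono_on (iN.mono_set (hSsub a b ha)) ((ie.mono_set (hSsub a b ha)).const_mul _) ((hms2 a).inter (hms b)) fun z hz => ?_
    have h2 : φ z ≤ b := hz.2
    rw [mul_comm]
    refine mul_le_mul_of_nonneg_right ?_ (exp_pos _).le
    have := hφp z
    gcongr
  · intro t; rw [hG]; exact integral_nonneg fun z => by positivity
  · intro t ht
    rw [hN]
    have h1 : ∫ z in K ∩ {z | φ z ≤ t}, exp (g z) * φ z ^ 2 ≤ ∫ z in K ∩ {z | φ z ≤ t}, t ^ 2 * exp (g z) := by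
      refine setIntegral_mono_on (iN.mono_set inter_subset_left) ((ie.mono_set inter_subset_left).const_mul _) (hmK t) fun z hz => ?_
      have h2 : φ z ≤ t := hz.2
      rw [mul_comm]
      refine mul_le_mul_of_nonneg_right ?_ (exp_pos _).le
      have := hφp z
      gcongr
    rw [integral_const_mul] at h1
    refine h1.trans (mul_le_mul_of_nonneg_left ?_ (by positivity))
    exact ms_mono hi inter_subset_left hKΩ

end Bol

namespace Bol
open Set Filter Topology
open scoped Manifold ContDiff

/-- The directional derivative of a mollification. -/
lemma moll_deriv {ρ u : ℂ → ℝ} {L : NNReal} (hu : LipschitzWith L u)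
    (hρi : Integrable ρ) (hρ0 : ∀ y, 0 ≤ ρ y) (hρc : Continuous ρ)
    (hρs : HasCompactSupport ρ) (x v : ℂ) :
    HasDerivAt (fun s : ℝ => ∫ y, ρ y * u (x + (s : ℝ) • v - y))
      (∫ y, ρ y * fderiv ℝ u (x - y) v) 0 := by
  have hmp := Measure.measurePreserving_sub_left (volume : Measure ℂ) x
  have hd : ∀ᵐ y : ℂ, DifferentiableAt ℝ u (x - y) :=
    hmp.quasiMeasurePreserving.ae hu.ae_differentiableAt
  refine (hasDerivAt_integral_of_dominated_loc_of_lip (𝕜 := ℝ) (μ := (volume : Measure ℂ))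
    (F := fun s y => ρ y * u (x + (s : ℝ) • v - y)) (x₀ := (0 : ℝ))
    (bound := fun y => ρ y * (L * ‖v‖)) (F' := fun y => ρ y * fderiv ℝ u (x - y) v)
    (s := univ) univ_mem ?_ ?_ ?_ ?_ ?_ ?_).2
  · refine Eventually.of_forall fun s => ?_
    exact (hρc.mul (hu.continuous.comp (continuous_const.sub continuous_id))).aestronglyMeasurable
  · have hc : Continuous fun y => ρ y * u (x + (0 : ℝ) • v - y) :=
      hρc.mul (hu.continuous.comp (continuous_const.sub continuous_id))
    exact hc.integrable_of_hasCompactSupport hρs.mul_right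
  · have h1 : Measurable fun z => fderiv ℝ u z v := measurable_fderiv_apply_const ℝ u v
    exact (hρc.measurable.mul (h1.comp (measurable_const.sub measurable_id))).aestronglyMeasurable
  · refine ae_of_all _ fun y => ?_
    refine LipschitzOnWith.of_dist_le_mul fun s _ t _ => ?_
    have h1 := hu.dist_le_mul (x + s • v - y) (x + t • v - y)
    have h2 : dist (x + s • v - y) (x + t • v - y) = dist s t * ‖v‖ := by
      rw [dist_eq_norm, dist_eq_norm, ← norm_smul]; congr 1; rw [sub_smul]; ring
    rw [h2] at h1
    have h3 : ((Real.nnabs (ρ y * (L * ‖v‖)) : NNReal) : ℝ) = ρ y * (L * ‖v‖) := by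
      rw [Real.coe_nnabs, abs_of_nonneg]
      exact mul_nonneg (hρ0 y) (by positivity)
    rw [h3, Real.dist_eq, ← mul_sub, abs_mul, abs_of_nonneg (hρ0 y), ← Real.dist_eq]
    calc ρ y * dist (u (x + s • v - y)) (u (x + t • v - y)) ≤ ρ y * (L * (dist s t * ‖v‖)) :=
          mul_le_mul_of_nonneg_left h1 (hρ0 y)
      _ = _ := by ring
  · exact hρi.mul_const _
  · filter_upwards [hd] with y hy
    have h1 : HasDerivAt (fun s : ℝ => x + s • v - y) v 0 := by
      have := (((hasDerivAt_id (0 : ℝ)).smul_const v).const_add x).sub_const y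
      simpa using this
    have h2 : HasFDerivAt u (fderiv ℝ u (x - y)) (x + (0 : ℝ) • v - y) := by
      simpa using hy.hasFDerivAt
    exact (h2.comp_hasDerivAt (0 : ℝ) h1).const_mul (ρ y)

/-- Smoothing a compactly supported nonnegative Lipschitz function does not increase the
Dirichlet energy. -/
lemma mollify {u : ℂ → ℝ} {L : NNReal} (hu : LipschitzWith L u) {K : Set ℂ}
    (hK : IsCompact K) (h0 : ∀ z, z ∉ K → u z = 0) (hup : ∀ z, 0 ≤ u z) {η : ℝ} (hη : 0 < η) :
    ∃ φ : ℂ → ℝ, ContDiff ℝ 1 φ ∧ (∀ z, 0 ≤ φ z) ∧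
      (∀ z, z ∉ Metric.cthickening η K → φ z = 0) ∧ (∀ z, |φ z - u z| ≤ L * η) ∧
      ∫ z, ‖fderiv ℝ φ z‖ ^ 2 ≤ ∫ z, ‖fderiv ℝ u z‖ ^ 2 := by
  let b : ContDiffBump (0 : ℂ) := ⟨η / 2, η, by positivity, by linarith⟩
  obtain ⟨ρ, hρ⟩ : ∃ ρ : ℂ → ℝ, ρ = b.normed volume := ⟨_, rfl⟩
  have hρ0 : ∀ y, 0 ≤ ρ y := fun y => by rw [hρ]; exact b.nonneg_normed y
  have hρc : Continuous ρ := by rw [hρ]; exact b.continuous_normed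
  have hρs : HasCompactSupport ρ := by rw [hρ]; exact b.hasCompactSupport_normed
  have hρi : Integrable ρ := hρc.integrable_of_hasCompactSupport hρs
  have hρ1 : ∫ y, ρ y = 1 := by rw [hρ]; exact b.integral_normed
  have hρd : ContDiff ℝ ((1 : ℕ∞)) ρ := by rw [hρ]; exact b.contDiff_normed
  have hρb : ∀ y, η ≤ ‖y‖ → ρ y = 0 := by
    intro y hy
    by_contra hne
    have h1 : y ∈ Function.support ρ := hne
    rw [hρ, b.support_normed_eq, mem_ball_zero_iff] at h1
    exact absurd h1 (not_lt.2 hy)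
  obtain ⟨φ, hφ⟩ : ∃ φ : ℂ → ℝ, φ = convolution ρ u (ContinuousLinearMap.lsmul ℝ ℝ) volume :=
    ⟨_, rfl⟩
  have hφe : ∀ x, φ x = ∫ y, ρ y * u (x - y) := fun x => by rw [hφ]; rfl
  have hφc : ContDiff ℝ ((1 : ℕ∞)) φ := by
    rw [hφ]
    exact HasCompactSupport.contDiff_convolution_left _ hρs hρd hu.continuous.locallyIntegrable
  have hφ1 : ContDiff ℝ 1 φ := hφc
  refine ⟨φ, hφ1, fun z => ?_, fun z hz => ?_, fun z => ?_, ?_⟩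
  · rw [hφe]; exact integral_nonneg fun y => mul_nonneg (hρ0 y) (hup _)
  · rw [hφe]
    refine integral_eq_zero_of_ae (ae_of_all _ fun y => ?_)
    rcases le_or_gt η ‖y‖ with hy | hy
    · simp [hρb y hy]
    · have : u (z - y) = 0 := by
        refine h0 _ fun hm => hz ?_
        refine Metric.mem_cthickening_of_dist_le z (z - y) η K hm ?_
        rw [dist_eq_norm]; simpa using hy.le
      simp [this]
  · rw [← Real.dist_eq, hφ, hρ]
    refine b.dist_normed_convolution_le hu.continuous.aestronglyMeasurable fun x hx => ?_
    refine (hu.dist_le_mul x z).trans ?_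
    have : dist x z ≤ η := (Metric.mem_ball.1 hx).le
    gcongr
  · obtain ⟨h, hh⟩ : ∃ h : ℂ → ℝ, ∀ z, h z = ‖fderiv ℝ u z‖ := ⟨_, fun _ => rfl⟩
    have hhm : Measurable h := by
      have : h = fun z => ‖fderiv ℝ u z‖ := funext hh
      rw [this]; exact (measurable_fderiv ℝ u).norm
    have hh0 : ∀ z, 0 ≤ h z := fun z => by rw [hh]; positivity
    have hhL : ∀ z, h z ≤ L := fun z => by rw [hh]; exact norm_fderiv_le_of_lipschitz ℝ hu
    have hhoff : ∀ z, z ∉ K → h z = 0 := fun z hz => by rw [hh, fderiv_off hK h0 hz, norm_zero]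
    have hh2 : Integrable fun z => h z ^ 2 := by
      refine IntegrableOn.integrable_of_forall_notMem_eq_zero (s := K) ?_ ?_
      · refine Measure.integrableOn_of_bounded (M := (L : ℝ) ^ 2) hK.measure_lt_top.ne
          (hhm.pow_const 2).aestronglyMeasurable (ae_of_all _ fun z => ?_)
        rw [Real.norm_of_nonneg (by positivity)]
        exact pow_le_pow_left₀ (hh0 z) (hhL z) 2
      · intro z hz; simp [hhoff z hz]
    have hsub : ∀ x : ℂ, Measurable fun y : ℂ => x - y := fun x =>
      measurable_const.sub measurable_id
    have hi1 : ∀ x, Integrable fun y => ρ y * h (x - y) := by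
      intro x
      refine (hρi.mul_const (L : ℝ)).mono'
        (hρc.measurable.mul (hhm.comp (hsub x))).aestronglyMeasurable (ae_of_all _ fun y => ?_)
      rw [Real.norm_of_nonneg (mul_nonneg (hρ0 y) (hh0 _))]
      exact mul_le_mul_of_nonneg_left (hhL _) (hρ0 y)
    have hi2 : ∀ x, Integrable fun y => ρ y * h (x - y) ^ 2 := by
      intro x
      refine (hρi.mul_const ((L : ℝ) ^ 2)).mono'
        (hρc.measurable.mul ((hhm.comp (hsub x)).pow_const 2)).aestronglyMeasurable
        (ae_of_all _ fun y => ?_)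
      rw [Real.norm_of_nonneg (mul_nonneg (hρ0 y) (by positivity))]
      exact mul_le_mul_of_nonneg_left (pow_le_pow_left₀ (hh0 _) (hhL _) 2) (hρ0 y)
    -- pointwise derivative bound
    have hD : ∀ x, ‖fderiv ℝ φ x‖ ≤ ∫ y, ρ y * h (x - y) := by
      intro x
      refine ContinuousLinearMap.opNorm_le_bound _
        (integral_nonneg fun y => mul_nonneg (hρ0 y) (hh0 _)) fun v => ?_
      have h1 := moll_deriv hu hρi hρ0 hρc hρs x v
      have h2 : HasDerivAt (fun s : ℝ => φ (x + s • v)) (fderiv ℝ φ x v) 0 := by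
        have h3 : HasDerivAt (fun s : ℝ => x + s • v) v 0 := by
          have := ((hasDerivAt_id (0 : ℝ)).smul_const v).const_add x
          simpa using this
        have h4 : HasFDerivAt φ (fderiv ℝ φ x) (x + (0 : ℝ) • v) := by
          simpa using ((hφ1.differentiable one_ne_zero) x).hasFDerivAt
        exact h4.comp_hasDerivAt (0 : ℝ) h3
      have h5 : (fun s : ℝ => φ (x + s • v)) = fun s : ℝ => ∫ y, ρ y * u (x + s • v - y) :=
        funext fun s => hφe _
      rw [h5] at h2
      rw [h2.unique h1, ← integral_mul_const]
      refine (norm_integral_le_of_norm_le ((hi1 x).mul_const ‖v‖) (ae_of_all _ fun y => ?_))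
      rw [norm_mul, Real.norm_of_nonneg (hρ0 y), mul_assoc, hh]
      exact mul_le_mul_of_nonneg_left (ContinuousLinearMap.le_opNorm _ _) (hρ0 y)
    have hJ : ∀ x, ‖fderiv ℝ φ x‖ ^ 2 ≤ ∫ y, ρ y * h (x - y) ^ 2 := by
      intro x
      obtain ⟨c, hc⟩ : ∃ c : ℝ, c = ∫ y, ρ y * h (x - y) := ⟨_, rfl⟩
      have h1 : 0 ≤ ∫ y, (ρ y * h (x - y) ^ 2 - 2 * c * (ρ y * h (x - y)) + c ^ 2 * ρ y) := by
        refine integral_nonneg fun y => ?_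
        have : ρ y * h (x - y) ^ 2 - 2 * c * (ρ y * h (x - y)) + c ^ 2 * ρ y
          = ρ y * (h (x - y) - c) ^ 2 := by ring
        show 0 ≤ ρ y * h (x - y) ^ 2 - 2 * c * (ρ y * h (x - y)) + c ^ 2 * ρ y
        rw [this]; exact mul_nonneg (hρ0 y) (sq_nonneg _)
      have ha : Integrable fun y => ρ y * h (x - y) ^ 2 - 2 * c * (ρ y * h (x - y)) :=
        (hi2 x).sub ((hi1 x).const_mul _)
      rw [integral_add ha (hρi.const_mul _), integral_sub (hi2 x) ((hi1 x).const_mul _),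
        integral_const_mul, integral_const_mul, hρ1, ← hc] at h1
      have h2 : ‖fderiv ℝ φ x‖ ^ 2 ≤ c ^ 2 := by
        have := hD x
        rw [← hc] at this
        exact pow_le_pow_left₀ (norm_nonneg _) this 2
      nlinarith
    have hconv : (fun x => ∫ y, ρ y * h (x - y) ^ 2) =
        convolution ρ (fun z => h z ^ 2) (ContinuousLinearMap.lsmul ℝ ℝ) volume := rfl
    have hci : Integrable fun x => ∫ y, ρ y * h (x - y) ^ 2 := by
      rw [hconv]; exact hρi.integrable_convolution _ hh2
    have hcv : ∫ x, ∫ y, ρ y * h (x - y) ^ 2 = ∫ z, h z ^ 2 := by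
      have := integral_convolution (ContinuousLinearMap.lsmul ℝ ℝ) hρi hh2
      rw [← hconv, hρ1] at this
      rw [this]; simp
    have hfin : ∫ z, ‖fderiv ℝ φ z‖ ^ 2 ≤ ∫ x, ∫ y, ρ y * h (x - y) ^ 2 :=
      integral_mono_of_nonneg (ae_of_all _ fun z => by positivity) hci (ae_of_all _ hJ)
    rw [hcv] at hfin
    simpa only [hh] using hfin

end Bol

namespace Bol
open Set Filter Topology

lemma norm_fderiv_abs_le {ψ : ℂ → ℝ} (hc : Continuous ψ) (z : ℂ) :
    ‖fderiv ℝ (fun y => |ψ y|) z‖ ≤ ‖fderiv ℝ ψ z‖ := by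
  rcases lt_trichotomy (ψ z) 0 with h | h | h
  · have : (fun y => |ψ y|) =ᶠ[𝓝 z] fun y => -ψ y := by
      filter_upwards [hc.continuousAt.eventually_lt_const h] with y hy
      exact abs_of_neg hy
    rw [this.fderiv_eq, fderiv_fun_neg, norm_neg]
  · have : IsLocalMin (fun y => |ψ y|) z := by
      refine Eventually.of_forall fun y => ?_
      show |ψ z| ≤ |ψ y|
      rw [h, abs_zero]; exact abs_nonneg _
    rw [this.fderiv_eq_zero, norm_zero]; exact norm_nonneg _
  · have : (fun y => |ψ y|) =ᶠ[𝓝 z] fun y => ψ y := by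
      filter_upwards [hc.continuousAt.eventually_const_lt h] with y hy
      exact abs_of_pos hy
    rw [this.fderiv_eq]

/-- The Bol type lemma in the complex plane. -/
theorem main_complex {Ω : Set ℂ} (hΩ : IsOpen Ω) (hsc : IsSimplyConnected Ω) {g : ℂ → ℝ}
    (hg : ContDiffOn ℝ 2 g Ω) (hlap : ∀ z ∈ Ω, 0 ≤ lap g z + exp (g z))
    (hi : IntegrableOn (fun z => exp (g z)) Ω) (hb : ms g Ω ≤ 8 * π)
    {ω : Set ℂ} (hω : IsOpen ω) (hωΩ : ω ⊆ Ω) {ψ : ℂ → ℝ} {L : NNReal}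
    (hψ : LipschitzWith L ψ) (hne : ∃ z, ψ z ≠ 0) {K : Set ℂ} (hK : IsCompact K)
    (hKω : K ⊆ ω) (hψ0 : ∀ z, z ∉ K → ψ z = 0)
    (heig : ∫ z in ω, ‖fderiv ℝ ψ z‖ ^ 2 ≤ ∫ z in ω, exp (g z) * ψ z ^ 2) :
    4 * π < ms g ω := by
  by_contra hcon
  rw [not_lt] at hcon
  obtain ⟨z₀, hz₀⟩ := hne
  have hz₀K : z₀ ∈ K := by by_contra h; exact hz₀ (hψ0 _ h)
  obtain ⟨η, hη, hηω⟩ := hK.exists_cthickening_subset_open hω hKω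
  obtain ⟨K', hK'e⟩ : ∃ K', K' = Metric.cthickening η K := ⟨_, rfl⟩
  rw [← hK'e] at hηω
  have hK' : IsCompact K' := by rw [hK'e]; exact hK.cthickening
  have hKK' : K ⊆ K' := by rw [hK'e]; exact Metric.self_subset_cthickening K
  have hgc : ContinuousOn (fun z => exp (g z)) Ω := hg.continuousOn.rexp
  -- mass of K'
  have hneq : (ω \ K').Nonempty := by
    by_contra hemp
    rw [not_nonempty_iff_eq_empty, diff_eq_empty] at hemp
    have he : ω = K' := Subset.antisymm hemp hηω
    have hcl : IsClopen ω := ⟨by rw [he]; exact hK'.isClosed, hω⟩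
    have hu := hcl.eq_univ ⟨z₀, hKω hz₀K⟩
    rw [he] at hu
    rw [hu] at hK'
    exact noncompact_univ ℂ hK'
  have hdo : IsOpen (ω \ K') := hω.sdiff hK'.isClosed
  have hdΩ : ω \ K' ⊆ Ω := diff_subset.trans hωΩ
  have hpos : 0 < ms g (ω \ K') := by
    unfold ms
    rw [setIntegral_pos_iff_support_of_nonneg_ae (ae_of_all _ fun z => (exp_pos _).le)
      (hi.mono_set hdΩ)]
    have : Function.support (fun z => exp (g z)) = univ := by
      ext z; simp [(exp_pos (g z)).ne']
    rw [this, univ_inter]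
    exact hdo.measure_pos volume hneq
  have hK'm : ms g K' < 4 * π := by
    have := ms_diff hi hK'.isClosed.measurableSet hηω hωΩ
    linarith
  obtain ⟨κ, hκe⟩ : ∃ κ, κ = (1 - ms g K' / (4 * π)) / 2 := ⟨_, rfl⟩
  have hπ := Real.pi_pos
  have hq : ms g K' / (4 * π) < 1 := (div_lt_one (by positivity)).2 hK'm
  have hq0 : 0 ≤ ms g K' / (4 * π) := div_nonneg (ms_nonneg g K') (by positivity)
  have hκ : 0 < κ := by rw [hκe]; linarith
  have hκ1 : κ ≤ 1 := by rw [hκe]; linarith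
  have h4 : ms g K' ≤ 4 * π * (1 - 2 * κ) := by
    have : 1 - 2 * κ = ms g K' / (4 * π) := by rw [hκe]; ring
    rw [this, mul_div_cancel₀ _ (by positivity)]
  have hK'Ω : K' ⊆ Ω := hηω.trans hωΩ
  have hgK : ContinuousOn (fun z => exp (g z)) K' := hgc.mono hK'Ω
  -- the absolute value
  obtain ⟨u, hu⟩ : ∃ u : ℂ → ℝ, u = fun z => |ψ z| := ⟨_, rfl⟩
  have hux : ∀ z, u z = |ψ z| := fun z => by rw [hu]
  have huL : LipschitzWith L u := by
    refine LipschitzWith.of_dist_le_mul fun x y => ?_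
    refine le_trans ?_ (hψ.dist_le_mul x y)
    rw [hux, hux, Real.dist_eq, Real.dist_eq]
    exact abs_abs_sub_abs_le_abs_sub _ _
  have hup : ∀ z, 0 ≤ u z := fun z => by rw [hux]; exact abs_nonneg _
  have hu0 : ∀ z, z ∉ K → u z = 0 := fun z hz => by rw [hux, hψ0 z hz, abs_zero]
  have huc := huL.continuous
  -- energy comparison
  have hDm : Measurable fun z => ‖fderiv ℝ ψ z‖ ^ 2 := (measurable_fderiv ℝ ψ).norm.pow_const 2
  have hDoff : ∀ z, z ∉ K → ‖fderiv ℝ ψ z‖ ^ 2 = 0 := fun z hz => by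
    rw [fderiv_off hK hψ0 hz, norm_zero]; norm_num
  have hDi : Integrable fun z => ‖fderiv ℝ ψ z‖ ^ 2 := by
    refine IntegrableOn.integrable_of_forall_notMem_eq_zero (s := K) ?_ hDoff
    refine Measure.integrableOn_of_bounded (M := (L : ℝ) ^ 2) hK.measure_lt_top.ne
      hDm.aestronglyMeasurable (ae_of_all _ fun z => ?_)
    rw [Real.norm_of_nonneg (by positivity)]
    exact pow_le_pow_left₀ (norm_nonneg _) (norm_fderiv_le_of_lipschitz ℝ hψ) 2
  have hE1 : ∫ z, ‖fderiv ℝ u z‖ ^ 2 ≤ ∫ z in ω, ‖fderiv ℝ ψ z‖ ^ 2 := by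
    rw [setIntegral_eq_integral_of_forall_compl_eq_zero
      (fun z hz => hDoff z fun h => hz (hKω h))]
    refine integral_mono_of_nonneg (ae_of_all _ fun z => by positivity) hDi
      (ae_of_all _ fun z => ?_)
    have := norm_fderiv_abs_le hψ.continuous z
    rw [← hu] at this
    exact pow_le_pow_left₀ (norm_nonneg _) this 2
  obtain ⟨I, hI⟩ : ∃ I, I = ∫ z in K', exp (g z) * u z ^ 2 := ⟨_, rfl⟩
  have hI1 : ∫ z in ω, exp (g z) * ψ z ^ 2 = I := by
    rw [hI]
    rw [setIntegral_eq_of_subset_of_forall_sdiff_eq_zero hω.measurableSet hηω]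
    · refine setIntegral_congr_fun hK'.isClosed.measurableSet fun z _ => ?_
      show exp (g z) * ψ z ^ 2 = exp (g z) * u z ^ 2
      rw [hux, sq_abs]
    · intro z hz
      show exp (g z) * ψ z ^ 2 = 0
      rw [hψ0 z (fun h => hz.2 (hKK' h))]; ring
  have hIi : IntegrableOn (fun z => exp (g z) * u z ^ 2) K' :=
    (hgK.mul (huc.pow 2).continuousOn).integrableOn_compact hK'
  have hJi : IntegrableOn (fun z => exp (g z) * u z) K' :=
    (hgK.mul huc.continuousOn).integrableOn_compact hK'
  have hIpos : 0 < I := by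
    rw [hI, setIntegral_pos_iff_support_of_nonneg_ae
      (ae_of_all _ fun z => mul_nonneg (exp_pos _).le (sq_nonneg _)) hIi]
    have hs : {z | u z ≠ 0} ⊆ Function.support (fun z => exp (g z) * u z ^ 2) ∩ K' := by
      intro z (hz : u z ≠ 0)
      refine ⟨?_, hKK' (by by_contra h; exact hz (hu0 _ h))⟩
      show exp (g z) * u z ^ 2 ≠ 0
      exact mul_ne_zero (exp_pos _).ne' (pow_ne_zero 2 hz)
    have ho : IsOpen {z | u z ≠ 0} := isOpen_ne_fun huc continuous_const
    have hn : {z | u z ≠ 0}.Nonempty := ⟨z₀, by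
      show u z₀ ≠ 0
      rw [hux]; exact abs_ne_zero.2 hz₀⟩
    exact (ho.measure_pos volume hn).trans_le (measure_mono hs)
  obtain ⟨J, hJ⟩ : ∃ J, J = ∫ z in K', exp (g z) * u z := ⟨_, rfl⟩
  -- mollified inequality
  have key : ∀ ε : ℝ, 0 < ε → ε ≤ η → (1 + κ) * (I - 2 * (L * ε) * J) ≤ I := by
    intro ε hε hεη
    obtain ⟨φ, hφ1, hφp, hφ0, hφu, hφE⟩ := mollify huL hK hu0 hup hε
    have hφK : ∀ z, z ∉ K' → φ z = 0 := fun z hz => hφ0 z fun h => hz (by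
      rw [hK'e]; exact Metric.cthickening_mono hεη K h)
    have hF := FK hΩ hsc hg hlap hi hb hφ1 hK' hK'Ω hφK hφp hκ hκ1 h4
    have hF2 : ∫ z in K', ‖fderiv ℝ φ z‖ ^ 2 = ∫ z, ‖fderiv ℝ φ z‖ ^ 2 :=
      setIntegral_eq_integral_of_forall_compl_eq_zero fun z hz => by
        rw [fderiv_off hK' hφK hz, norm_zero]; norm_num
    have hlow : I - 2 * (L * ε) * J ≤ ∫ z in K', exp (g z) * φ z ^ 2 := by
      rw [hI, hJ, ← integral_const_mul, ← integral_sub hIi (hJi.const_mul _)]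
      refine setIntegral_mono_on (hIi.sub (hJi.const_mul _))
        ((hgK.mul (hφ1.continuous.pow 2).continuousOn).integrableOn_compact hK')
        hK'.isClosed.measurableSet fun z _ => ?_
      have h1 : u z ^ 2 - 2 * (L * ε) * u z ≤ φ z ^ 2 := by
        have h2 := (abs_le.1 (hφu z)).1
        have h3 := hup z
        nlinarith [sq_nonneg (φ z - u z)]
      have h5 := mul_le_mul_of_nonneg_left h1 (exp_pos (g z)).le
      show exp (g z) * u z ^ 2 - 2 * (L * ε) * (exp (g z) * u z) ≤ exp (g z) * φ z ^ 2
      linarith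
    have h6 := mul_le_mul_of_nonneg_left hlow (by linarith : 0 ≤ 1 + κ)
    rw [hF2] at hF
    linarith
  have hlim : Tendsto (fun ε : ℝ => (1 + κ) * (I - 2 * (L * ε) * J)) (𝓝[>] 0)
      (𝓝 ((1 + κ) * (I - 2 * (L * 0) * J))) := by
    have hc : Continuous fun ε : ℝ => (1 + κ) * (I - 2 * (L * ε) * J) := by fun_prop
    exact (hc.tendsto 0).mono_left nhdsWithin_le_nhds
  have hle := le_of_tendsto hlim (by
    filter_upwards [Ioc_mem_nhdsGT hη] with ε hε
    exact key ε hε.1 hε.2)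
  have : 0 < κ * I := mul_pos hκ hIpos
  rw [mul_zero, mul_zero, zero_mul, sub_zero] at hle
  linarith

end Bol

namespace Bol
open Set Filter Topology

noncomputable abbrev ee : ℂ ≃ₗᵢ[ℝ] EuclideanSpace ℝ (Fin 2) := Complex.orthonormalBasisOneI.repr

lemma ee_one : ee 1 = EuclideanSpace.single 0 1 := by
  ext i; fin_cases i <;> simp [Complex.orthonormalBasisOneI_repr_apply]

lemma ee_I : ee Complex.I = EuclideanSpace.single 1 1 := by
  ext i; fin_cases i <;> simp [Complex.orthonormalBasisOneI_repr_apply]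

lemma fderiv_ee (f : EuclideanSpace ℝ (Fin 2) → ℝ) (z v : ℂ) :
    fderiv ℝ (fun y => f (ee y)) z v = fderiv ℝ f (ee z) (ee v) := by
  have := ContinuousLinearEquiv.comp_right_fderiv (f := f) (x := z) ee.toContinuousLinearEquiv
  exact congrArg (fun A => A v) this

lemma norm_fderiv_ee (f : EuclideanSpace ℝ (Fin 2) → ℝ) (z : ℂ) :
    ‖fderiv ℝ (fun y => f (ee y)) z‖ = ‖fderiv ℝ f (ee z)‖ := by
  have := ContinuousLinearEquiv.comp_right_fderiv (f := f) (x := z) ee.toContinuousLinearEquiv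
  have h2 : fderiv ℝ (fun y => f (ee y)) z
    = (fderiv ℝ f (ee z)).comp (ee.toContinuousLinearEquiv : ℂ →L[ℝ] _) := this
  rw [h2]
  exact ContinuousLinearMap.opNorm_comp_linearIsometryEquiv _ ee

lemma lap_ee (f : EuclideanSpace ℝ (Fin 2) → ℝ) (z : ℂ) :
    lap (fun y => f (ee y)) z = planeLaplacian f (ee z) := by
  unfold lap planeLaplacian
  rw [Fin.sum_univ_two, ← ee_one, ← ee_I, ← fderiv_ee, ← fderiv_ee]
  simp only [fderiv_ee f]

lemma setInt_ee (f : EuclideanSpace ℝ (Fin 2) → ℝ) (S : Set (EuclideanSpace ℝ (Fin 2))) :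
    ∫ z in ee ⁻¹' S, f (ee z) = ∫ y in S, f y :=
  ee.measurePreserving.setIntegral_preimage_emb
    ee.toHomeomorph.measurableEmbedding f S


end Bol

/-- Bol-type lemma: if `Ω ⊆ ℝ²` is open and simply connected, `g` is `C²` on `Ω`
with `Δg + e^g > 0` on `Ω` and `∫_Ω e^g ≤ 8π`, and if an open subset `ω ⊆ Ω`
carries a nontrivial compactly supported Lipschitz function `ψ` witnessing that
the first eigenvalue of `Δ + e^g` on `ω` is `≤ 0`
(i.e., `∫_ω |∇ψ|² ≤ ∫_ω e^g ψ²`), then `∫_ω e^g > 4π`. -/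
theorem bol_type_lemma (Ω : Set (EuclideanSpace ℝ (Fin 2)))
    (hΩopen : IsOpen Ω) (hΩsc : SimplyConnectedSpace Ω)
    (g : EuclideanSpace ℝ (Fin 2) → ℝ) (hg : ContDiffOn ℝ 2 g Ω)
    (hineq : ∀ y ∈ Ω, 0 < planeLaplacian g y + Real.exp (g y))
    (hgint : IntegrableOn (fun y => Real.exp (g y)) Ω)
    (hbound : (∫ y in Ω, Real.exp (g y)) ≤ 8 * Real.pi)
    (ω : Set (EuclideanSpace ℝ (Fin 2))) (hωopen : IsOpen ω) (hωsub : ω ⊆ Ω)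
    (ψ : EuclideanSpace ℝ (Fin 2) → ℝ)
    (hψlip : ∃ c : NNReal, LipschitzWith c ψ)
    (hψne : ∃ y, ψ y ≠ 0)
    (hψsupp : ∃ K : Set (EuclideanSpace ℝ (Fin 2)),
      IsCompact K ∧ K ⊆ ω ∧ ∀ y ∉ K, ψ y = 0)
    (heig : (∫ y in ω, ‖fderiv ℝ ψ y‖ ^ 2) ≤ ∫ y in ω, Real.exp (g y) * (ψ y) ^ 2) :
    4 * Real.pi < ∫ y in ω, Real.exp (g y) := by
  obtain ⟨c, hc⟩ := hψlip
  obtain ⟨y₀, hy₀⟩ := hψne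
  obtain ⟨K, hK, hKω, hK0⟩ := hψsupp
  have hsc : IsSimplyConnected (Bol.ee ⁻¹' Ω) :=
    (Homeomorph.isSimplyConnected_preimage Bol.ee.toHomeomorph).2 hΩsc
  have hcont := Bol.ee.continuous
  have h := Bol.main_complex (Ω := Bol.ee ⁻¹' Ω) (g := fun z => g (Bol.ee z))
    (ω := Bol.ee ⁻¹' ω) (ψ := fun z => ψ (Bol.ee z)) (L := c) (K := Bol.ee ⁻¹' K)
    (hΩopen.preimage hcont) hsc
    (hg.comp (s := Bol.ee ⁻¹' Ω) (f := fun z => Bol.ee z) Bol.ee.contDiff.contDiffOn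
      (fun z hz => hz))
    (fun z hz => by rw [Bol.lap_ee]; exact (hineq _ hz).le)
    ((Bol.ee.measurePreserving.integrableOn_comp_preimage
      Bol.ee.toHomeomorph.measurableEmbedding).2 hgint)
    (by
      unfold Bol.ms
      rw [Bol.setInt_ee (fun y => Real.exp (g y)) Ω]; exact hbound)
    (hωopen.preimage hcont) (fun z hz => hωsub hz)
    (by
      have h1 := hc.comp Bol.ee.lipschitz
      rw [mul_one] at h1
      exact h1)
    ⟨Bol.ee.symm y₀, by
      show ψ (Bol.ee (Bol.ee.symm y₀)) ≠ 0
      rw [Bol.ee.apply_symm_apply]; exact hy₀⟩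
    (Bol.ee.toHomeomorph.isCompact_preimage.2 hK) (fun z hz => hKω hz) (fun z hz => hK0 _ hz)
    (by
      simp only [Bol.norm_fderiv_ee]
      rw [Bol.setInt_ee (fun y => ‖fderiv ℝ ψ y‖ ^ 2) ω,
        Bol.setInt_ee (fun y => Real.exp (g y) * ψ y ^ 2) ω]
      exact heig)
  unfold Bol.ms at h
  rwa [Bol.setInt_ee (fun y => Real.exp (g y)) ω] at h
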